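/- Let (A, m) be a two-dimensional regular local ring with infinite residue field, M ≠ (0) a finitely generated torsion-free A-module with F = M** of rank r > 0. Suppose R(M) is a Buchsbaum ring and tilde(M) = bar(M). Then the fiber cone F(M) = A/m ⊗_A R(M) ≅ R(M)/m R(M) is a Buchsbaum ring. -/

import Mathlib

set_option maxHeartbeats 1000000
set_option synthInstance.maxHeartbeats 400000

open MvPolynomial IsLocalRing

/-- The embedding of the free module `A^r` onto the degree-one part of the
polynomial ring `Sym_A(A^r) = A[t_1, ..., t_r]`, sending `f` to `∑ i, f i • X i`. -/
noncomputable abbrev emb (A : Type) [CommRing A] (r : ℕ) :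
    (Fin r → A) →ₗ[A] MvPolynomial (Fin r) A :=
  Fintype.linearCombination A MvPolynomial.X

/-- The image `F₁` of the free module `F = A^r` inside `S = Sym_A(F)`. -/
noncomputable def freeSub (A : Type) [CommRing A] (r : ℕ) :
    Submodule A (MvPolynomial (Fin r) A) :=
  Submodule.map (emb A r) ⊤

/-- The image `M₁` of a submodule `M ⊆ F` inside `S = Sym_A(F)`. -/
noncomputable def sub1 (A : Type) [CommRing A] (r : ℕ) (M : Submodule A (Fin r → A)) :
    Submodule A (MvPolynomial (Fin r) A) :=
  M.map (emb A r)

/-- The Rees algebra `R(M)` of `M ⊆ F`, i.e. the `A`-subalgebra of `S = Sym_A(F)`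
generated by the degree-one part `M₁`; its `n`-th homogeneous component is `M₁ ^ n`. -/
noncomputable abbrev reesAlg (A : Type) [CommRing A] (r : ℕ) (M : Submodule A (Fin r → A)) :
    Subalgebra A (MvPolynomial (Fin r) A) :=
  Algebra.adjoin A (sub1 A r M : Set (MvPolynomial (Fin r) A))

/-- The Ratliff--Rush closure `⋃_{ℓ > 0} [N^{ℓ+1} :_{Fn} N^ℓ]` of `N` (inside `Fn`),
where all powers and quotients of submodules are taken inside `S = Sym_A(F)`. -/
noncomputable def ratliffRush (A : Type) [CommRing A] (r : ℕ)
    (Fn N : Submodule A (MvPolynomial (Fin r) A)) : Submodule A (MvPolynomial (Fin r) A) :=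
  ⨆ ℓ : ℕ, (Fn ⊓ (N ^ (ℓ + 2) / N ^ (ℓ + 1)))

/-- The positive part `R₊ = ker(constant term)` of a graded subalgebra `R₀ ⊆ S`. -/
noncomputable def posPart (A : Type) [CommRing A] (r : ℕ)
    (R0 : Subalgebra A (MvPolynomial (Fin r) A)) : Ideal ↥R0 :=
  RingHom.ker ((MvPolynomial.constantCoeff).comp R0.val.toRingHom)

/-- `widetilde{R₀} = ε⁻¹(H⁰_{R₀₊}(S/R₀))`, i.e., the set of `x ∈ S` annihilated into `R₀`
by a power of the irrelevant ideal `R₀₊`; a graded subring of `S` containing `R₀`. -/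
noncomputable def rrAlg (A : Type) [CommRing A] (r : ℕ)
    (R0 : Subalgebra A (MvPolynomial (Fin r) A)) : Subalgebra A (MvPolynomial (Fin r) A) where
  carrier := {x | ∃ m : ℕ, ∀ y ∈ (posPart A r R0) ^ m,
    (y : MvPolynomial (Fin r) A) * x ∈ R0}
  mul_mem' := by
    rintro x₁ x₂ ⟨m₁, h₁⟩ ⟨m₂, h₂⟩
    refine ⟨m₁ + m₂, fun y hy => ?_⟩
    rw [pow_add] at hy
    refine Submodule.mul_induction_on hy (fun p hp q hq => ?_) (fun a b ha hb => ?_)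
    · have : ((p * q : ↥R0) : MvPolynomial (Fin r) A) * (x₁ * x₂)
          = ((p : MvPolynomial (Fin r) A) * x₁) * ((q : MvPolynomial (Fin r) A) * x₂) := by
        push_cast; ring
      rw [this]
      exact mul_mem (h₁ p hp) (h₂ q hq)
    · have : ((a + b : ↥R0) : MvPolynomial (Fin r) A) * (x₁ * x₂)
          = (a : MvPolynomial (Fin r) A) * (x₁ * x₂)
            + (b : MvPolynomial (Fin r) A) * (x₁ * x₂) := by
        push_cast; ring
      rw [this]
      exact add_mem ha hb
  one_mem' := ⟨0, fun y _ => by rw [mul_one]; exact y.2⟩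
  add_mem' := by
    rintro x₁ x₂ ⟨m₁, h₁⟩ ⟨m₂, h₂⟩
    refine ⟨m₁ + m₂, fun y hy => ?_⟩
    rw [mul_add]
    exact add_mem (h₁ y (Ideal.pow_le_pow_right (Nat.le_add_right _ _) hy))
      (h₂ y (Ideal.pow_le_pow_right (Nat.le_add_left _ _) hy))
  zero_mem' := ⟨0, fun y _ => by simpa using R0.zero_mem⟩
  algebraMap_mem' := fun a =>
    ⟨0, fun y _ => mul_mem y.2 (R0.algebraMap_mem a)⟩

/-- The integral closure of the Rees algebra `R(M)` inside `S = Sym_A(F)`,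
viewed as an `A`-subalgebra of `S`. -/
noncomputable def intClAlg (A : Type) [CommRing A] (r : ℕ) (M : Submodule A (Fin r → A)) :
    Subalgebra A (MvPolynomial (Fin r) A) :=
  (integralClosure (↥(reesAlg A r M)) (MvPolynomial (Fin r) A)).restrictScalars A

/-- The integral closure `overline{M^n}`: the `n`-th homogeneous component of the
integral closure of `R(M)` in `S`. -/
noncomputable def barPow (A : Type) [CommRing A] (r : ℕ) (M : Submodule A (Fin r → A))
    (n : ℕ) : Submodule A (MvPolynomial (Fin r) A) :=
  (freeSub A r) ^ n ⊓ (Subalgebra.toSubmodule (intClAlg A r M))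

/-- `M` is a faithful `A`-module. -/
def faithfulSub (A : Type) [CommRing A] (r : ℕ) (M : Submodule A (Fin r → A)) : Prop :=
  ∀ a : A, (∀ x ∈ M, a • x = (0 : Fin r → A)) → a = 0

/-- The length of an `A`-module, as the Krull dimension of its lattice of submodules. -/
noncomputable def modLength (A : Type) [CommRing A] (N : Type) [AddCommGroup N]
    [Module A N] : WithBot ℕ∞ :=
  Order.krullDim (Submodule A N)

/-- The quotient module `P/N` of two submodules of `S`. -/
abbrev quotNP (A : Type) [CommRing A] (r : ℕ)
    (N P : Submodule A (MvPolynomial (Fin r) A)) :=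
  ↥P ⧸ (N.comap P.subtype)

/-- The minimal number of generators of a submodule. -/
noncomputable def minGen (A : Type) [CommRing A] {V : Type} [AddCommGroup V] [Module A V]
    (N : Submodule A V) : ℕ :=
  sInf {n : ℕ | ∃ f : Fin n → V, Submodule.span A (Set.range f) = N}

/-- A Noetherian local ring is Cohen--Macaulay if its depth equals its Krull dimension,
i.e. there is a regular sequence in the maximal ideal whose length is the dimension. -/
def IsCohenMacaulayLocalRing (R : Type) [CommRing R] [IsLocalRing R] : Prop :=
  ∃ rs : List R, (∀ x ∈ rs, x ∈ maximalIdeal R) ∧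
    RingTheory.Sequence.IsRegular R rs ∧ (rs.length : WithBot ℕ∞) = ringKrullDim R

/-- A Noetherian local ring is Buchsbaum (in the sense of Stückrad--Vogel) if every
system of parameters `x_1, …, x_d` is a weak sequence:
`(x_1, …, x_{i-1}) : x_i ⊆ (x_1, …, x_{i-1}) : 𝔪` for all `i`. -/
def IsBuchsbaumLocalRing (R : Type) [CommRing R] [IsLocalRing R] : Prop :=
  ∀ d : ℕ, ringKrullDim R = d →
    ∀ x : Fin d → R, (∀ i, x i ∈ maximalIdeal R) →
      maximalIdeal R ≤ (Ideal.span (Set.range x)).radical →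
      ∀ i : Fin d,
        (Ideal.span (x '' {j | j < i})).colon (Ideal.span {x i}) ≤
          (Ideal.span (x '' {j | j < i})).colon (maximalIdeal R)

/-- An ideal `P` of a graded subalgebra `R₀ ⊆ S` is graded (homogeneous) if it contains,
together with any element, all of its homogeneous components. -/
def IsGradedIdeal (A : Type) [CommRing A] (r : ℕ)
    (R0 : Subalgebra A (MvPolynomial (Fin r) A)) (P : Ideal ↥R0) : Prop :=
  ∀ x : ↥R0, x ∈ P → ∀ n : ℕ,
    ∀ h : MvPolynomial.homogeneousComponent n (x : MvPolynomial (Fin r) A) ∈ R0,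
      (⟨_, h⟩ : ↥R0) ∈ P

/-- The graded maximal ideal `𝔐 = 𝔪 R(M) + R(M)₊` of the Rees algebra, i.e. the
preimage of the maximal ideal under the degree-zero projection. -/
noncomputable abbrev gradedMax (A : Type) [CommRing A] [IsLocalRing A] (r : ℕ)
    (M : Submodule A (Fin r → A)) : Ideal ↥(reesAlg A r M) :=
  Ideal.comap ((MvPolynomial.constantCoeff).comp (reesAlg A r M).val.toRingHom)
    (maximalIdeal A)


/-- The fiber cone `F(M) = A/𝔪 ⊗_A R(M) ≅ R(M)/𝔪R(M)` of `M`. -/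
noncomputable abbrev fiberCone (A : Type) [CommRing A] [IsLocalRing A] (r : ℕ)
    (M : Submodule A (Fin r → A)) :=
  ↥(reesAlg A r M) ⧸ (Ideal.map (algebraMap A ↥(reesAlg A r M)) (maximalIdeal A))

/-- The graded maximal ideal `𝔐/𝔪R(M)` of the fiber cone `F(M) = R(M)/𝔪R(M)`. -/
noncomputable abbrev fiberConeMax (A : Type) [CommRing A] [IsLocalRing A] (r : ℕ)
    (M : Submodule A (Fin r → A)) :
    @Ideal (fiberCone A r M) CommRing.toCommSemiring.toSemiring :=
  Ideal.map (Ideal.Quotient.mk (Ideal.map (algebraMap A ↥(reesAlg A r M))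
    (maximalIdeal A))) (gradedMax A r M)

set_option maxHeartbeats 1000000
set_option synthInstance.maxHeartbeats 400000
set_option autoImplicit false

/-- a set with pairwise unit differences -/
def UnitDiff {Q : Type} [CommRing Q] (Λ : Set Q) : Prop :=
  ∀ a ∈ Λ, ∀ b ∈ Λ, a ≠ b → IsUnit (a - b)

lemma avoid_field {Q K : Type} [CommRing Q] [Field K] {Λ : Set Q} (hΛ : UnitDiff Λ)
    (g : Q →+* K) {n : ℕ} (c : Fin n → K) (hc : ¬ ∀ i, c i = 0) :
    {l ∈ Λ | ∑ i : Fin n, g l ^ (i : ℕ) * c i = 0}.Finite := by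
  classical
  let p : Polynomial K := ∑ i : Fin n, Polynomial.C (c i) * Polynomial.X ^ (i : ℕ)
  have hp : p ≠ 0 := by
    intro h0
    apply hc
    intro i
    have : p.coeff i = 0 := by rw [h0]; simp
    simp only [p, Polynomial.finsetSum_coeff, Polynomial.coeff_C_mul_X_pow] at this
    rw [Finset.sum_eq_single i] at this
    · simpa using this
    · intro b _ hb
      rw [if_neg]
      exact fun h => hb (Fin.ext h.symm)
    · simp
  have hfin : (p.roots.toFinset : Set K).Finite := Finset.finite_toSet _
  apply Set.Finite.of_finite_image (f := g)
  · refine hfin.subset ?_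
    rintro _ ⟨l, ⟨_, hl⟩, rfl⟩
    simp only [Finset.mem_coe, Multiset.mem_toFinset, Polynomial.mem_roots hp, Polynomial.IsRoot]
    simp only [p, Polynomial.eval_finsetSum, Polynomial.eval_mul, Polynomial.eval_C,
      Polynomial.eval_pow, Polynomial.eval_X]
    rw [← hl]
    exact Finset.sum_congr rfl fun i _ => mul_comm _ _
  · intro a ha b hb hab
    by_contra hne
    have := (hΛ a ha.1 b hb.1 hne).map g
    rw [map_sub, hab, sub_self] at this
    exact not_isUnit_zero this

lemma avoid_prime {Q : Type} [CommRing Q] {Λ : Set Q} (hΛ : UnitDiff Λ)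
    (P : Ideal Q) [P.IsPrime] {n : ℕ} (x : Fin n → Q) (hx : ¬ ∀ i, x i ∈ P) :
    {l ∈ Λ | ∑ i : Fin n, l ^ (i : ℕ) * x i ∈ P}.Finite := by
  let g : Q →+* FractionRing (Q ⧸ P) := (algebraMap _ _).comp (Ideal.Quotient.mk P)
  have hg : ∀ q, g q = 0 ↔ q ∈ P := by
    intro q
    simp only [g, RingHom.comp_apply]
    rw [FaithfulSMul.algebraMap_eq_zero_iff, Ideal.Quotient.eq_zero_iff_mem]
  have := avoid_field hΛ g (fun i => g (x i)) (by simpa only [hg] using hx)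
  refine this.subset ?_
  rintro l ⟨hl, h⟩
  refine ⟨hl, ?_⟩
  have := (hg _).2 h
  simpa using this

lemma avoid_primes {Q : Type} [CommRing Q] {Λ : Set Q} (hΛ : UnitDiff Λ) (hinf : Λ.Infinite)
    (Ps : Set (Ideal Q)) (hfin : Ps.Finite) (hP : ∀ P ∈ Ps, P.IsPrime) {n : ℕ} (x : Fin n → Q)
    (hx : ∀ P ∈ Ps, ¬ ∀ i, x i ∈ P) :
    ∃ l ∈ Λ, ∀ P ∈ Ps, ∑ i : Fin n, l ^ (i : ℕ) * x i ∉ P := by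
  have h : (⋃ P ∈ Ps, {l ∈ Λ | ∑ i : Fin n, l ^ (i : ℕ) * x i ∈ P}).Finite := by
    refine hfin.biUnion fun P h => ?_
    haveI := hP P h
    exact avoid_prime hΛ P x (hx P h)
  obtain ⟨l, hl, hl2⟩ := (hinf.sdiff h).nonempty
  refine ⟨l, hl, fun P hPs hmem => hl2 ?_⟩
  simp only [Set.mem_iUnion]
  exact ⟨P, hPs, hl, hmem⟩

open RingTheory.Sequence in
lemma cm_lemma {Q : Type} [CommRing Q] [IsLocalRing Q] [IsNoetherianRing Q] {Λ : Set Q}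
    (hΛ : UnitDiff Λ) (hinf : Λ.Infinite) (n : ℕ) :
    ∀ (C : Type) [AddCommGroup C] [Module Q C] [Module.Finite Q C] (ts xs : List Q),
      ts.length = n → xs.length = n → (∀ t ∈ ts, t ∈ maximalIdeal Q) →
      (∀ t ∈ xs, t ∈ maximalIdeal Q) → IsWeaklyRegular C ts →
      maximalIdeal Q ≤ (Ideal.ofList xs ⊔ Module.annihilator Q C).radical →
      IsWeaklyRegular C xs := by
  induction n with
  | zero =>
    intro C _ _ _ ts xs _ hx _ _ _ _
    rw [List.length_eq_zero_iff.1 hx]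
    exact IsWeaklyRegular.nil Q C
  | succ n ih =>
    intro C _ _ _ ts xs hts hxs htm hxm hreg hrad
    obtain ⟨ts', t, rfl⟩ : ∃ ts' t, ts = ts' ++ [t] := by
      have : ts ≠ [] := by rintro rfl; simp at hts
      exact ⟨_, _, (List.dropLast_append_getLast this).symm⟩
    obtain ⟨x, xs', rfl⟩ : ∃ x xs', xs = x :: xs' := by
      cases xs with
      | nil => simp at hxs
      | cons x xs' => exact ⟨x, xs', rfl⟩
    simp only [List.length_append, List.length_cons, List.length_nil] at hts hxs
    have hts : ts'.length = n := by omega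
    have hxs : xs'.length = n := by omega
    rw [isWeaklyRegular_append_iff, isWeaklyRegular_singleton_iff] at hreg
    obtain ⟨hreg1, hreg2⟩ := hreg
    set C' := C ⧸ (Ideal.ofList ts' • ⊤ : Submodule Q C) with hC'
    have hann : Module.annihilator Q C ≤ Module.annihilator Q C' :=
      (Submodule.mkQ _).annihilator_le_of_surjective (Submodule.mkQ_surjective _)
    obtain ⟨l, hl, hlP⟩ := avoid_primes hΛ hinf (associatedPrimes Q C')
      (associatedPrimes.finite Q C') (fun P hP => IsAssociatedPrime.isPrime hP)
      (x :: xs').get (by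
        intro P hP hall
        haveI : P.IsPrime := IsAssociatedPrime.isPrime hP
        have h1 : Ideal.ofList (x :: xs') ≤ P := by
          refine Ideal.span_le.2 ?_
          intro y hy
          obtain ⟨i, rfl⟩ := List.mem_iff_get.1 hy
          exact hall i
        have h2 : Module.annihilator Q C ≤ P := hann.trans (by
          have := hP.annihilator_le
          rwa [Submodule.annihilator_top] at this)
        have h3 : t ∈ P := by
          have := hrad (htm t (by simp))
          exact (Ideal.IsPrime.radical_le_iff inferInstance).2 (sup_le h1 h2) this
        have h4 : t ∈ ⋃ p ∈ associatedPrimes Q C', (p : Set Q) := by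
          simp only [Set.mem_iUnion]; exact ⟨P, hP, h3⟩
        rw [biUnion_associatedPrimes_eq_compl_regular] at h4
        exact h4 hreg2)
    set y : Q := ∑ i : Fin (x :: xs').length, l ^ (i : ℕ) * (x :: xs').get i with hy
    have hyreg : IsSMulRegular C' y := by
      by_contra hcon
      have : y ∈ ({r : Q | IsSMulRegular C' r} : Set Q)ᶜ := hcon
      rw [← biUnion_associatedPrimes_eq_compl_regular] at this
      simp only [Set.mem_iUnion] at this
      obtain ⟨P, hP, h⟩ := this
      exact hlP P hP h
    have hyx : y - x ∈ Ideal.ofList xs' := by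
      have : y - x = ∑ i : Fin xs'.length, l ^ ((i : ℕ) + 1) * xs'.get i := by
        rw [hy]
        simp only [List.length_cons]
        rw [Fin.sum_univ_succ]
        simp
      rw [this]
      exact Ideal.sum_mem _ fun i _ => Ideal.mul_mem_left _ _
        (Ideal.subset_span (List.get_mem _ _))
    have hxs'm : Ideal.ofList xs' ≤ maximalIdeal Q :=
      Ideal.span_le.2 fun z hz => hxm z (List.mem_cons_of_mem _ hz)
    have hym : y ∈ maximalIdeal Q := by
      have := add_mem (hxs'm hyx) (hxm x (by simp))
      simpa using this
    have hy1 : IsWeaklyRegular C (y :: ts') := by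
      have h : IsWeaklyRegular C (ts' ++ [y]) := by
        rw [isWeaklyRegular_append_iff, isWeaklyRegular_singleton_iff]
        exact ⟨hreg1, hyreg⟩
      refine IsLocalRing.isWeaklyRegular_of_perm_of_subset_maximalIdeal h
        (List.perm_append_comm) ?_
      intro r hr
      simp only [List.mem_append, List.mem_singleton] at hr
      rcases hr with hr | rfl
      · exact htm r (by simp [hr])
      · exact hym
    rw [isWeaklyRegular_cons_iff] at hy1
    have hih := ih (QuotSMulTop y C) ts' xs' hts hxs (fun t ht => htm t (by simp [ht]))
      (fun t ht => hxm t (by simp [ht])) hy1.2 (by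
        refine hrad.trans (Ideal.radical_mono ?_)
        have hyann : y ∈ Module.annihilator Q (QuotSMulTop y C) := by
          rw [Module.mem_annihilator]
          intro m
          obtain ⟨m, rfl⟩ := Submodule.mkQ_surjective _ m
          rw [← map_smul]
          exact (Submodule.Quotient.mk_eq_zero _).2
            (Submodule.smul_mem_pointwise_smul m y ⊤ trivial)
        have hann2 : Module.annihilator Q C ≤ Module.annihilator Q (QuotSMulTop y C) :=
          (Submodule.mkQ _).annihilator_le_of_surjective (Submodule.mkQ_surjective _)
        refine sup_le ?_ (hann2.trans le_sup_right)
        rw [Ideal.ofList_cons]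
        refine sup_le ?_ le_sup_left
        rw [Ideal.span_singleton_le_iff_mem]
        have : x = y - (y - x) := by ring
        rw [this]
        exact sub_mem (Ideal.mem_sup_right hyann) (Ideal.mem_sup_left hyx))
    have h2 : IsWeaklyRegular C (xs' ++ [y]) := by
      refine IsLocalRing.isWeaklyRegular_of_perm_of_subset_maximalIdeal
        ((isWeaklyRegular_cons_iff C y xs').2 ⟨hy1.1, hih⟩)
        (List.perm_append_comm (l₁ := [y])) ?_
      intro r hr
      simp only [List.cons_append, List.nil_append, List.mem_cons] at hr
      rcases hr with rfl | hr
      · exact hym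
      · exact hxm r (by simp [hr])
    have h3 : IsWeaklyRegular C (xs' ++ [x]) := by
      rw [isWeaklyRegular_append_iff, isWeaklyRegular_singleton_iff] at h2 ⊢
      refine ⟨h2.1, ?_⟩
      have heq : ∀ c : C ⧸ (Ideal.ofList xs' • ⊤ : Submodule Q C), x • c = y • c := by
        intro c
        obtain ⟨c, rfl⟩ := Submodule.mkQ_surjective _ c
        rw [← sub_eq_zero, ← sub_smul, ← map_smul]
        refine (Submodule.Quotient.mk_eq_zero _).2 (Submodule.smul_mem_smul ?_ trivial)
        rw [← neg_sub]; exact neg_mem hyx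
      intro a b hab
      apply h2.2
      simpa only [heq] using hab
    refine IsLocalRing.isWeaklyRegular_of_perm_of_subset_maximalIdeal h3
        (List.perm_append_comm (l₂ := [x])) ?_
    intro r hr
    simp only [List.mem_append, List.mem_singleton] at hr
    rcases hr with hr | rfl
    · exact hxm r (by simp [hr])
    · exact hxm r (by simp)

lemma exists_unitDiff (A : Type) [CommRing A] [IsLocalRing A] (hres : Infinite (ResidueField A)) :
    ∃ Λ : Set A, UnitDiff Λ ∧ Λ.Infinite := by
  refine ⟨Set.range (Function.surjInv (residue_surjective (R := A))), ?_, ?_⟩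
  · rintro _ ⟨a, rfl⟩ _ ⟨b, rfl⟩ hne
    by_contra h
    apply hne
    have : Function.surjInv (residue_surjective (R := A)) a - Function.surjInv (residue_surjective (R := A)) b
        ∈ maximalIdeal A := h
    rw [← residue_eq_zero_iff, map_sub, Function.surjInv_eq residue_surjective,
      Function.surjInv_eq residue_surjective, sub_eq_zero] at this
    rw [this]
  · exact Set.infinite_range_of_injective (Function.injective_surjInv _)

/-- two-dimensional regular local ring facts -/
lemma exists_prime_param (A : Type) [CommRing A] [IsLocalRing A] [IsNoetherianRing A]
    (hdim : ringKrullDim A = 2)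
    (hreg : ∃ x y : A, Ideal.span {x, y} = maximalIdeal A)
    (hres : Infinite (ResidueField A)) :
    IsDomain A ∧ ∃ x q : A, Ideal.span {x, q} = maximalIdeal A ∧ (Ideal.span {x}).IsPrime ∧
      x ≠ 0 ∧ q ∉ Ideal.span {x} := by
  obtain ⟨Λ, hΛ, hinf⟩ := exists_unitDiff A hres
  obtain ⟨p, q, hpq⟩ := hreg
  have hht : (maximalIdeal A).height = 2 := by
    have := IsLocalRing.maximalIdeal_height_eq_ringKrullDim (R := A)
    rw [hdim] at this
    exact WithBot.coe_injective this
  obtain ⟨l, hl, hlP⟩ := avoid_primes hΛ hinf (minimalPrimes A) (minimalPrimes.finite_of_isNoetherianRing A)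
    (fun P hP => hP.1.1) ![p, q] (by
      intro P hP hall
      have hPp : P.IsPrime := hP.1.1
      have h1 : maximalIdeal A ≤ P := by
        rw [← hpq, Ideal.span_le]
        rintro z (rfl | rfl)
        · exact hall 0
        · exact hall 1
      have h2 : P = maximalIdeal A := le_antisymm (IsLocalRing.le_maximalIdeal hPp.ne_top) h1
      have h3 : P.height = 0 := by
        rw [Ideal.height_eq_zero_iff]; exact hP
      rw [h2, hht] at h3
      exact absurd h3 (by norm_num))
  simp only [Fin.sum_univ_two, Matrix.cons_val_zero, Matrix.cons_val_one, Fin.val_zero, Fin.val_one, pow_zero, one_mul, pow_one] at hlP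
  set x := p + l * q with hx
  have hxq : Ideal.span {x, q} = maximalIdeal A := by
    rw [← hpq]
    apply le_antisymm
    · rw [Ideal.span_le]
      rintro z (rfl | rfl)
      · exact Ideal.mem_span_pair.2 ⟨1, l, by rw [hx]; ring⟩
      · exact Ideal.mem_span_pair.2 ⟨0, 1, by ring⟩
    · rw [Ideal.span_le]
      rintro z (rfl | rfl)
      · exact Ideal.mem_span_pair.2 ⟨1, -l, by rw [hx]; ring⟩
      · exact Ideal.mem_span_pair.2 ⟨0, 1, by ring⟩
  have hxm : x ∈ maximalIdeal A := by rw [← hxq]; exact Ideal.subset_span (by simp)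
  have hjac : maximalIdeal A ≤ (⊥ : Ideal A).jacobson := by
    rw [IsLocalRing.jacobson_eq_maximalIdeal _ bot_ne_top]
  -- a prime containing x different from m
  obtain ⟨P, hPp, hxP, hPm⟩ : ∃ P : Ideal A, P.IsPrime ∧ x ∈ P ∧ P ≠ maximalIdeal A := by
    by_contra hcon
    push Not at hcon
    have : maximalIdeal A ∈ (Ideal.span {x}).minimalPrimes := by
      refine ⟨⟨inferInstance, by rwa [Ideal.span_singleton_le_iff_mem]⟩, ?_⟩
      rintro P ⟨hP, hxP⟩ _
      exact (hcon P hP ((Ideal.span_singleton_le_iff_mem _).1 hxP)).ge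
    have := Ideal.height_le_one_of_isPrincipal_of_mem_minimalPrimes (Ideal.span {x}) _ this
    rw [hht] at this
    exact absurd this (by norm_num)
  have hqP : q ∉ P := by
    intro h
    apply hPm
    refine le_antisymm (IsLocalRing.le_maximalIdeal hPp.ne_top) ?_
    rw [← hxq, Ideal.span_le]
    rintro z (rfl | rfl) <;> assumption
  have hPx : P = Ideal.span {x} := by
    apply le_antisymm
    · refine Submodule.le_of_le_smul_of_le_jacobson_bot (I := maximalIdeal A) (IsNoetherian.noetherian P) hjac ?_
      intro a ha
      have ham := IsLocalRing.le_maximalIdeal hPp.ne_top ha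
      rw [← hxq, Ideal.mem_span_pair] at ham
      obtain ⟨α, β, rfl⟩ := ham
      have hβ : β ∈ P := by
        have : β * q ∈ P := by
          have := sub_mem ha (P.mul_mem_left α hxP); simpa using this
        exact (hPp.mem_or_mem this).resolve_right hqP
      refine Submodule.add_mem_sup ?_ ?_
      · exact Ideal.mul_mem_left _ _ (Ideal.mem_span_singleton_self x)
      · rw [mul_comm]
        exact Submodule.smul_mem_smul (by rw [← hxq]; exact Ideal.subset_span (by simp)) hβ
    · rwa [Ideal.span_singleton_le_iff_mem]
  subst hPx
  obtain ⟨P0, hP0, hP0x⟩ := Ideal.exists_minimalPrimes_le (I := ⊥) (J := Ideal.span {x}) bot_le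
  have hP0p : P0.IsPrime := hP0.1.1
  have hxP0 : x ∉ P0 := hlP P0 hP0
  have hP00 : P0 = ⊥ := by
    rw [eq_bot_iff]
    refine Submodule.le_of_le_smul_of_le_jacobson_bot (I := maximalIdeal A) (IsNoetherian.noetherian P0) hjac ?_
    intro a ha
    obtain ⟨b, rfl⟩ := Ideal.mem_span_singleton.1 (hP0x ha)
    refine Submodule.mem_sup_right (Submodule.smul_mem_smul hxm ?_)
    exact (hP0p.mem_or_mem ha).resolve_left hxP0
  have hdom : IsDomain A := by
    have := hP0p
    rw [hP00] at this
    exact IsDomain.of_bot_isPrime A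
  exact ⟨hdom, x, q, hxq, hPp, fun h => hxP0 (h ▸ zero_mem _), hqP⟩

/-- depth two -/
def DepthTwo (A : Type) [CommRing A] [IsLocalRing A] : Prop :=
  ∀ h x : A, h ≠ 0 → (∀ t ∈ maximalIdeal A, h ∣ t * x) → h ∣ x

lemma depthTwo (A : Type) [CommRing A] [IsLocalRing A] [IsDomain A] (p q : A)
    (hpq : Ideal.span {p, q} = maximalIdeal A) (hp : (Ideal.span {p}).IsPrime) (hp0 : p ≠ 0)
    (hq : q ∉ Ideal.span {p}) : DepthTwo A := by
  intro h x hh ht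
  obtain ⟨a, ha⟩ := ht p (by rw [← hpq]; exact Ideal.subset_span (by simp))
  obtain ⟨b, hb⟩ := ht q (by rw [← hpq]; exact Ideal.subset_span (by simp))
  have h1 : q * a = p * b := by
    apply mul_left_cancel₀ hh
    linear_combination (-q) * ha + p * hb
  have h2 : a ∈ Ideal.span {p} := by
    have : q * a ∈ Ideal.span {p} := Ideal.mem_span_singleton.2 ⟨b, h1⟩
    exact (hp.mem_or_mem this).resolve_left hq
  obtain ⟨c, rfl⟩ := Ideal.mem_span_singleton.1 h2
  exact ⟨c, mul_left_cancel₀ hp0 (by linear_combination ha)⟩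

lemma DepthTwo.pow {A : Type} [CommRing A] [IsLocalRing A] (hA : DepthTwo A) (k : ℕ) :
    ∀ h x : A, h ≠ 0 → (∀ t ∈ maximalIdeal A ^ k, h ∣ t * x) → h ∣ x := by
  induction k with
  | zero => intro h x _ ht; simpa using ht 1 (by simp)
  | succ k ih =>
    intro h x hh ht
    refine ih h x hh fun t htk => ?_
    refine hA h _ hh fun s hs => ?_
    rw [← mul_assoc]
    refine ht _ ?_
    rw [pow_succ']
    exact Ideal.mul_mem_mul hs htk

lemma DepthTwo.coprime {A : Type} [CommRing A] [IsLocalRing A] [IsNoetherianRing A] (hA : DepthTwo A)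
    {f g : A} (hfg : maximalIdeal A ≤ (Ideal.span {f, g}).radical) (hf : f ≠ 0) {y : A}
    (h : f ∣ g * y) : f ∣ y := by
  obtain ⟨k, hk⟩ := Ideal.exists_pow_le_of_le_radical_of_fg hfg (IsNoetherian.noetherian _)
  refine hA.pow k f y hf fun t ht => ?_
  obtain ⟨a, b, rfl⟩ := Ideal.mem_span_pair.1 (hk ht)
  have : (a * f + b * g) * y = f * (a * y) + b * (g * y) := by ring
  rw [this]
  exact dvd_add (dvd_mul_right _ _) (h.mul_left b)

lemma radical_span_pair_pow {A : Type} [CommRing A] {I : Ideal A} 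
    {f g : A} (hfg : I ≤ (Ideal.span {f, g}).radical) (m n : ℕ) :
    I ≤ (Ideal.span {f ^ m, g ^ n}).radical := by
  refine hfg.trans (Ideal.radical_le_radical_iff.2 ?_)
  rw [Ideal.span_le]
  rintro z (rfl | rfl)
  · exact ⟨m, Ideal.subset_span (by simp)⟩
  · exact ⟨n, Ideal.subset_span (by simp)⟩

lemma DepthTwo.coprime_pow {A : Type} [CommRing A] [IsLocalRing A] [IsDomain A] [IsNoetherianRing A] (hA : DepthTwo A)
    {f g : A} (hfg : maximalIdeal A ≤ (Ideal.span {f, g}).radical) (hf : f ≠ 0) (m n : ℕ) {y : A}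
    (h : f ^ m ∣ g ^ n * y) : f ^ m ∣ y :=
  hA.coprime (radical_span_pair_pow hfg m n) (pow_ne_zero _ hf) h

namespace Chain
variable {A K : Type} [CommRing A] [IsDomain A] [IsNoetherianRing A] [Field K] [Algebra A K]

/-- span of `o * σ^i`, `i < m` -/
def J (O : Subalgebra A K) (σ : K) (m : ℕ) : Submodule A K :=
  Submodule.span A {x | ∃ o ∈ O, ∃ i < m, x = o * σ ^ i}

lemma J_mono {O O' : Subalgebra A K} (h : O ≤ O') (σ : K) {m n : ℕ} (hmn : m ≤ n) :
    J O σ m ≤ J O' σ n := by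
  refine Submodule.span_mono ?_
  rintro x ⟨o, ho, i, hi, rfl⟩
  exact ⟨o, h ho, i, by omega, rfl⟩

lemma mem_J {O : Subalgebra A K} {σ : K} {m i : ℕ} {o : K} (ho : o ∈ O) (hi : i < m) :
    o * σ ^ i ∈ J O σ m := Submodule.subset_span ⟨o, ho, i, hi, rfl⟩

lemma pow_mem_J {O : Subalgebra A K} {σ : K} {m i : ℕ} (hi : i < m) :
    σ ^ i ∈ J O σ m := by
  have := mem_J (σ := σ) (one_mem O) hi
  simpa using this

lemma mul_mem_J {O : Subalgebra A K} {σ : K} {m : ℕ} {o x : K} (ho : o ∈ O) (hx : x ∈ J O σ m) :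
    o * x ∈ J O σ m := by
  induction hx using Submodule.span_induction with
  | mem x hx =>
    obtain ⟨o', ho', i, hi, rfl⟩ := hx
    rw [← mul_assoc]; exact mem_J (mul_mem ho ho') hi
  | zero => rw [mul_zero]; exact zero_mem _
  | add x y _ _ hx hy => rw [mul_add]; exact add_mem hx hy
  | smul a x _ hx => rw [mul_smul_comm]; exact Submodule.smul_mem _ _ hx

lemma sigma_mul_mem_J {O : Subalgebra A K} {σ : K} {m : ℕ} {x : K} (hx : x ∈ J O σ m) :
    σ * x ∈ J O σ (m + 1) := by
  induction hx using Submodule.span_induction with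
  | mem x hx =>
    obtain ⟨o', ho', i, hi, rfl⟩ := hx
    have : σ * (o' * σ ^ i) = o' * σ ^ (i + 1) := by ring
    rw [this]; exact mem_J ho' (by omega)
  | zero => rw [mul_zero]; exact zero_mem _
  | add x y _ _ hx hy => rw [mul_add]; exact add_mem hx hy
  | smul a x _ hx => rw [mul_smul_comm]; exact Submodule.smul_mem _ _ hx

lemma diff_mem_J {O : Subalgebra A K} {σ τ : K} (h : σ - τ ∈ O) (i : ℕ) :
    σ ^ i - τ ^ i ∈ J O σ i := by
  induction i with
  | zero => simp
  | succ i ih =>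
    have h1 : τ ^ i ∈ J O σ (i + 1) := by
      have := sub_mem (pow_mem_J (O := O) (σ := σ) (Nat.lt_succ_self i)) (J_mono le_rfl σ (Nat.le_succ i) ih)
      simpa using this
    have : σ ^ (i + 1) - τ ^ (i + 1) = σ * (σ ^ i - τ ^ i) + (σ - τ) * τ ^ i := by ring
    rw [this]
    exact add_mem (sigma_mul_mem_J ih) (mul_mem_J h h1)

/-- the blowup algebra `A[I/g]` -/
def Bl (I : Ideal A) (g : K) : Subalgebra A K :=
  Algebra.adjoin A {x | ∃ z ∈ I, x = algebraMap A K z / g}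

lemma pow_div_mem (I : Ideal A) (g : K) (k : ℕ) (z : A) (hz : z ∈ I ^ k) :
    algebraMap A K z / g ^ k ∈ Bl I g := by
  induction k generalizing z with
  | zero => simpa using Subalgebra.algebraMap_mem _ z
  | succ k ih =>
    rw [pow_succ] at hz
    refine Submodule.mul_induction_on hz ?_ ?_
    · intro a ha b hb
      have : algebraMap A K (a * b) / g ^ (k + 1) = (algebraMap A K a / g ^ k) * (algebraMap A K b / g) := by
        rw [map_mul, pow_succ, div_mul_div_comm]
      rw [this]
      exact mul_mem (ih a ha) (Algebra.subset_adjoin ⟨b, hb, rfl⟩)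
    · intro a b ha hb
      rw [map_add, add_div]; exact add_mem ha hb

lemma exists_pow_div (I : Ideal A) (g : A) (hg : g ∈ I) (hg0 : algebraMap A K g ≠ 0) (x : K)
    (hx : x ∈ Bl I (algebraMap A K g)) :
    ∃ k, ∃ z ∈ I ^ k, x = algebraMap A K z / algebraMap A K g ^ k := by
  induction hx using Algebra.adjoin_induction with
  | mem x hx =>
    obtain ⟨z, hz, rfl⟩ := hx
    exact ⟨1, z, by simpa using hz, by simp⟩
  | algebraMap a => exact ⟨0, a, by simp, by simp⟩
  | add x y _ _ hx hy =>
    obtain ⟨k, z, hz, rfl⟩ := hx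
    obtain ⟨l, w, hw, rfl⟩ := hy
    refine ⟨k + l, z * g ^ l + g ^ k * w, ?_, ?_⟩
    · rw [pow_add]
      exact add_mem (Ideal.mul_mem_mul hz (Ideal.pow_mem_pow hg l)) (Ideal.mul_mem_mul (Ideal.pow_mem_pow hg k) hw)
    · simp only [map_add, map_mul, map_pow]
      field_simp
      try ring
  | mul x y _ _ hx hy =>
    obtain ⟨k, z, hz, rfl⟩ := hx
    obtain ⟨l, w, hw, rfl⟩ := hy
    refine ⟨k + l, z * w, ?_, ?_⟩
    · rw [pow_add]; exact Ideal.mul_mem_mul hz hw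
    · rw [map_mul, pow_add, div_mul_div_comm]

lemma claimD (I : Ideal A) (f g : A) (hg : g ∈ I)
    (hf0 : algebraMap A K f ≠ 0) (hg0 : algebraMap A K g ≠ 0)
    (hI : ∀ n, 2 ≤ n → I ^ (n + 1) ≤ Ideal.span {f, g} * I ^ n) (N : ℕ) :
    ∀ a b : ℕ, a + b = N → ∀ w ∈ I ^ (a + b), ∃ α ∈ Bl I (algebraMap A K g), ∃ β ∈ Bl I (algebraMap A K f),
      algebraMap A K g * (algebraMap A K w / (algebraMap A K f ^ a * algebraMap A K g ^ b)) =
        algebraMap A K g * α + algebraMap A K f * β := by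
  induction N with
  | zero =>
    intro a b hab w hw
    obtain ⟨rfl, rfl⟩ : a = 0 ∧ b = 0 := by omega
    exact ⟨algebraMap A K w, Subalgebra.algebraMap_mem _ _, 0, zero_mem _, by simp⟩
  | succ N ih =>
    intro a b hab w hw
    rcases Nat.eq_zero_or_pos a with rfl | ha
    · refine ⟨_, pow_div_mem I _ _ w hw, 0, zero_mem _, by simp⟩
    by_cases hb : b ≤ 1
    · refine ⟨0, zero_mem _, algebraMap A K (g ^ (1 - b) * w) / algebraMap A K f ^ (a + 1), pow_div_mem I _ _ _ ?_, ?_⟩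
      · have : a + 1 = (1 - b) + (a + b) := by omega
        rw [this, pow_add]
        exact Ideal.mul_mem_mul (Ideal.pow_mem_pow hg _) hw
      · obtain rfl | rfl : b = 0 ∨ b = 1 := by omega
        · simp only [map_mul, map_pow]; field_simp; simp; try ring
        · simp only [map_mul, map_pow]; field_simp; simp; try ring
    · obtain ⟨a, rfl⟩ : ∃ a', a = a' + 1 := ⟨a - 1, by omega⟩
      obtain ⟨b, rfl⟩ : ∃ b', b = b' + 1 := ⟨b - 1, by omega⟩
      have e1 : a + 1 + (b + 1) = (a + b + 1) + 1 := by omega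
      rw [e1] at hw
      have hw2 := hI (a + b + 1) (by omega) hw
      have : ∃ w1 ∈ I ^ (a + b + 1), ∃ w2 ∈ I ^ (a + b + 1), w = f * w1 + g * w2 := by
        refine Submodule.mul_induction_on hw2 ?_ ?_
        · intro m hm n hn
          obtain ⟨x, y, rfl⟩ := Ideal.mem_span_pair.1 hm
          exact ⟨x * n, Ideal.mul_mem_left _ _ hn, y * n, Ideal.mul_mem_left _ _ hn, by ring⟩
        · rintro _ _ ⟨w1, h1, w2, h2, rfl⟩ ⟨w3, h3, w4, h4, rfl⟩
          exact ⟨w1 + w3, add_mem h1 h3, w2 + w4, add_mem h2 h4, by ring⟩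
      obtain ⟨w1, hw1, w2, hw2, rfl⟩ := this
      obtain ⟨α1, hα1, β1, hβ1, E1⟩ := ih a (b + 1) (by omega) w1 (by rwa [← add_assoc])
      obtain ⟨α2, hα2, β2, hβ2, E2⟩ := ih (a + 1) b (by omega) w2 (by rwa [add_right_comm])
      refine ⟨α1 + α2, add_mem hα1 hα2, β1 + β2, add_mem hβ1 hβ2, ?_⟩
      have : algebraMap A K g * (algebraMap A K (f * w1 + g * w2) / (algebraMap A K f ^ (a + 1) * algebraMap A K g ^ (b + 1)))
        = algebraMap A K g * (algebraMap A K w1 / (algebraMap A K f ^ a * algebraMap A K g ^ (b + 1))) +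
          algebraMap A K g * (algebraMap A K w2 / (algebraMap A K f ^ (a + 1) * algebraMap A K g ^ b)) := by
        simp only [map_mul, map_add]
        field_simp
        try ring
      rw [this, E1, E2]
      ring

lemma J_denom (I : Ideal A) (g s : A) (hg : g ∈ I) (hg0 : algebraMap A K g ≠ 0) (m : ℕ) (x : K)
    (hx : x ∈ J (Bl I (algebraMap A K g)) (algebraMap A K s / algebraMap A K g) m) :
    ∃ k, ∃ z : A, algebraMap A K g ^ k * x = algebraMap A K z := by
  induction hx using Submodule.span_induction with
  | mem x hx =>
    obtain ⟨o, ho, i, hi, rfl⟩ := hx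
    obtain ⟨k, z, hz, rfl⟩ := exists_pow_div I g hg hg0 o ho
    refine ⟨k + i, z * s ^ i, ?_⟩
    simp only [map_mul, map_pow, div_pow, pow_add]
    field_simp
  | zero => exact ⟨0, 0, by simp⟩
  | add x y _ _ hx hy =>
    obtain ⟨k, z, hz⟩ := hx
    obtain ⟨l, w, hw⟩ := hy
    refine ⟨k + l, g ^ l * z + g ^ k * w, ?_⟩
    simp only [map_add, map_mul, map_pow, ← hz, ← hw]
    ring
  | smul a x _ hx =>
    obtain ⟨k, z, hz⟩ := hx
    refine ⟨k, a * z, ?_⟩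
    rw [map_mul, ← hz, Algebra.smul_def]; ring

theorem chain (I : Ideal A) (f g s s' : A) (hf : f ∈ I) (hg : g ∈ I)
    (hf0 : algebraMap A K f ≠ 0) (hg0 : algebraMap A K g ≠ 0)
    (hI : ∀ n, 2 ≤ n → I ^ (n + 1) ≤ Ideal.span {f, g} * I ^ n)
    (hcop : ∀ x : K, (∃ k, ∃ z : A, algebraMap A K f ^ k * x = algebraMap A K z) →
      (∃ k, ∃ z : A, algebraMap A K g ^ k * x = algebraMap A K z) → ∃ z : A, x = algebraMap A K z)
    (hs : s * f - s' * g ∈ I ^ 2) (V : ValuationSubring K)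
    (hV : ∀ a : A, algebraMap A K a ∈ V) (hVI : ∀ z ∈ I, algebraMap A K z / algebraMap A K g ∈ V) :
    algebraMap A K s / algebraMap A K g ∈ V := by
  set F := algebraMap A K f with hF
  set G := algebraMap A K g with hG
  set O2 := Bl I G with hO2
  set O1 := Bl I F with hO1
  set O12 : Subalgebra A K := Bl (I ^ 2) (F * G) with hO12
  set σ := algebraMap A K s / G with hσ
  set τ := algebraMap A K s' / F with hτ
  have hO2le : O2 ≤ O12 := by
    refine Algebra.adjoin_le ?_
    rintro x ⟨z, hz, rfl⟩
    refine Algebra.subset_adjoin ⟨z * f, by rw [pow_two]; exact Ideal.mul_mem_mul hz hf, ?_⟩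
    rw [map_mul, mul_comm F G, mul_div_mul_right _ _ hf0]
  have hO1le : O1 ≤ O12 := by
    refine Algebra.adjoin_le ?_
    rintro x ⟨z, hz, rfl⟩
    refine Algebra.subset_adjoin ⟨z * g, by rw [pow_two]; exact Ideal.mul_mem_mul hz hg, ?_⟩
    rw [map_mul, mul_div_mul_right _ _ hg0]
  have hFG : F / G ∈ O12 := hO2le (Algebra.subset_adjoin ⟨f, hf, rfl⟩)
  have hst : σ - τ ∈ O12 := by
    refine Algebra.subset_adjoin ⟨s * f - s' * g, hs, ?_⟩
    simp only [map_sub, map_mul, hσ, hτ]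
    rw [← hF, ← hG]
    field_simp
  have claimA : ∀ θ ∈ O12, ∃ α ∈ O2, ∃ β ∈ O1, G * θ = G * α + F * β := by
    intro θ hθ
    have hfg : f * g ∈ I ^ 2 := by rw [pow_two]; exact Ideal.mul_mem_mul hf hg
    have hne : algebraMap A K (f * g) ≠ 0 := by rw [map_mul]; exact mul_ne_zero hf0 hg0
    obtain ⟨k, z, hz, rfl⟩ := exists_pow_div (K := K) (I ^ 2) (f * g) hfg hne θ (by rw [map_mul]; exact hθ)
    obtain ⟨α, hα, β, hβ, E⟩ := claimD (K := K) I f g hg hf0 hg0 hI (k + k) k k rfl z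
      (by rwa [← two_mul, pow_mul])
    refine ⟨α, hα, β, hβ, ?_⟩
    rw [← E, map_mul, mul_pow]
  have claimJ : ∀ m : ℕ, ∀ x ∈ J O12 σ m, ∃ u ∈ J O2 σ m, ∃ w ∈ J O1 τ m, G * x = G * u + F * w := by
    intro m
    induction m using Nat.strong_induction_on with
    | _ m ih =>
    intro x hx
    induction hx using Submodule.span_induction with
    | mem x hx =>
      obtain ⟨θ, hθ, i, hi, rfl⟩ := hx
      obtain ⟨α, hα, β, hβ, E⟩ := claimA θ hθ
      have h1 : F / G * β * (σ ^ i - τ ^ i) ∈ J O12 σ i :=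
        mul_mem_J (mul_mem hFG (hO1le hβ)) (diff_mem_J hst i)
      obtain ⟨u, hu, w, hw, E2⟩ := ih i hi _ h1
      refine ⟨α * σ ^ i + u, add_mem (mem_J hα hi) (J_mono le_rfl _ hi.le hu),
        β * τ ^ i + w, add_mem (mem_J hβ hi) (J_mono le_rfl _ hi.le hw), ?_⟩
      have E3 : G * (F / G * β * (σ ^ i - τ ^ i)) = F * β * (σ ^ i - τ ^ i) := by
        field_simp
      rw [E3] at E2
      have : G * (θ * σ ^ i) = (G * θ) * σ ^ i := by ring
      rw [this, E]
      linear_combination E2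
    | zero => exact ⟨0, zero_mem _, 0, zero_mem _, by simp⟩
    | add x y _ _ hx hy =>
      obtain ⟨u, hu, w, hw, E⟩ := hx
      obtain ⟨u', hu', w', hw', E'⟩ := hy
      exact ⟨u + u', add_mem hu hu', w + w', add_mem hw hw', by linear_combination E + E'⟩
    | smul a x _ hx =>
      obtain ⟨u, hu, w, hw, E⟩ := hx
      refine ⟨a • u, Submodule.smul_mem _ _ hu, a • w, Submodule.smul_mem _ _ hw, ?_⟩
      simp only [Algebra.smul_def]
      linear_combination (algebraMap A K a) * E
  have hc : ∀ n : ℕ, ∃ c : A, ∃ u ∈ J O2 σ n, algebraMap A K c = G * σ ^ n - G * u := by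
    intro n
    obtain ⟨u, hu, w, hw, E⟩ := claimJ n _ (diff_mem_J hst n)
    have h2 : G * σ ^ n - G * u ∈ J O2 σ (n + 1) := by
      have hGO : G ∈ O2 := Subalgebra.algebraMap_mem _ _
      exact sub_mem (mem_J hGO (Nat.lt_succ_self n)) (mul_mem_J hGO (J_mono le_rfl _ (Nat.le_succ n) hu))
    have h1 : G * σ ^ n - G * u ∈ J O1 τ (n + 1) := by
      have : G * σ ^ n - G * u = G * τ ^ n + F * w := by linear_combination E
      rw [this]
      have hGO : G ∈ O1 := Subalgebra.algebraMap_mem _ _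
      have hFO : F ∈ O1 := Subalgebra.algebraMap_mem _ _
      exact add_mem (mem_J hGO (Nat.lt_succ_self n)) (mul_mem_J hFO (J_mono le_rfl _ (Nat.le_succ n) hw))
    obtain ⟨c, hc⟩ := hcop _ (J_denom I f s' hf hf0 _ _ h1) (J_denom I g s hg hg0 _ _ h2)
    exact ⟨c, u, hu, hc.symm⟩
  choose c u hu hcu using hc
  obtain ⟨n, hn⟩ : ∃ n, c n ∈ Ideal.span (c '' Set.Iio n) := by
    let chainI : ℕ →o Ideal A := ⟨fun n => Ideal.span (c '' Set.Iio n), by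
      intro a b hab
      exact Ideal.span_mono (Set.image_mono (Set.Iio_subset_Iio hab))⟩
    obtain ⟨n, hn⟩ := monotone_stabilizes_iff_noetherian.2 (inferInstance : IsNoetherian A A) chainI
    refine ⟨n, ?_⟩
    have := hn (n + 1) (Nat.le_succ n)
    change c n ∈ chainI n
    rw [this]
    exact Ideal.subset_span ⟨n, Nat.lt_succ_self n, rfl⟩
  have hkey : ∃ y ∈ J O2 σ n, algebraMap A K (c n) = G * y := by
    refine Submodule.span_induction (p := fun x _ => ∃ y ∈ J O2 σ n, algebraMap A K x = G * y) ?_ ?_ ?_ ?_ hn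
    · rintro _ ⟨i, hi, rfl⟩
      exact ⟨σ ^ i - u i, sub_mem (pow_mem_J hi) (J_mono le_rfl _ (le_of_lt hi) (hu i)), by rw [hcu]; ring⟩
    · exact ⟨0, zero_mem _, by simp⟩
    · rintro x y _ _ ⟨a, ha, ea⟩ ⟨b, hb, eb⟩
      exact ⟨a + b, add_mem ha hb, by rw [map_add, ea, eb]; ring⟩
    · rintro a x _ ⟨y, hy, e⟩
      exact ⟨a • y, Submodule.smul_mem _ _ hy, by rw [smul_eq_mul, map_mul, e, Algebra.smul_def]; ring⟩
  obtain ⟨y, hy, ey⟩ := hkey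
  have hσn : σ ^ n ∈ J O2 σ n := by
    have : σ ^ n = y + u n := by
      apply mul_left_cancel₀ hg0
      rw [hcu] at ey
      linear_combination ey
    rw [this]; exact add_mem hy (hu n)
  have hO2V : ∀ x ∈ O2, x ∈ V := by
    intro x hx
    induction hx using Algebra.adjoin_induction with
    | mem x hx => obtain ⟨z, hz, rfl⟩ := hx; exact hVI z hz
    | algebraMap a => exact hV a
    | add x y _ _ hx hy => exact add_mem hx hy
    | mul x y _ _ hx hy => exact mul_mem hx hy
  by_contra hσV
  have hv1 : 1 < V.valuation σ := by
    rw [← V.valuation_le_one_iff] at hσV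
    exact not_le.1 hσV
  have hσ0 : σ ≠ 0 := by rintro h; rw [h] at hσV; exact hσV (zero_mem _)
  have hlt : ∀ x ∈ J O2 σ n, V.valuation x < V.valuation σ ^ n := by
    intro x hx
    induction hx using Submodule.span_induction with
    | mem x hx =>
      obtain ⟨o, ho, i, hi, rfl⟩ := hx
      rw [map_mul, map_pow]
      calc _ ≤ 1 * V.valuation σ ^ i := by
            gcongr
            exact (V.valuation_le_one_iff _).2 (hO2V o ho)
        _ = V.valuation σ ^ i := one_mul _
        _ < _ := pow_lt_pow_right₀ hv1 hi
    | zero => rw [map_zero]; exact zero_lt_iff.2 (pow_ne_zero _ (by simpa using hσ0))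
    | add x y _ _ hx hy => exact Valuation.map_add_lt _ hx hy
    | smul a x _ hx =>
      rw [Algebra.smul_def, map_mul]
      calc _ ≤ 1 * V.valuation x := by
            gcongr
            exact (V.valuation_le_one_iff _).2 (hV a)
        _ = _ := one_mul _
        _ < _ := hx
  have := hlt _ hσn
  rw [map_pow] at this
  exact lt_irrefl _ this

end Chain

section UU
variable {R : Type} [CommRing R]

/-- elements multiplied into `X` by `Q` -/
def UU (Q X : Ideal R) : Ideal R where
  carrier := {u | ∀ t ∈ Q, t * u ∈ X}
  add_mem' := fun {a b} ha hb t ht => by rw [mul_add]; exact add_mem (ha t ht) (hb t ht)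
  zero_mem' := fun t _ => by rw [mul_zero]; exact zero_mem X
  smul_mem' := fun c x hx t ht => by
    rw [smul_eq_mul, mul_left_comm]; exact X.mul_mem_left _ (hx t ht)

lemma mem_UU {Q X : Ideal R} {u : R} : u ∈ UU Q X ↔ ∀ t ∈ Q, t * u ∈ X := Iff.rfl

lemma le_UU (Q X : Ideal R) : X ≤ UU Q X := fun _ hx _ _ => X.mul_mem_left _ hx

lemma UU_mono {Q X Y : Ideal R} (h : X ≤ Y) : UU Q X ≤ UU Q Y := fun _ hx t ht => h (hx t ht)

lemma UU_bot [IsDomain R] {Q : Ideal R} (hQ : Q ≠ ⊥) : UU Q ⊥ = ⊥ := by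
  rw [eq_bot_iff]
  intro u hu
  obtain ⟨t, ht, ht0⟩ := Submodule.exists_mem_ne_zero_of_ne_bot hQ
  have := hu t ht
  rw [Ideal.mem_bot] at this ⊢
  exact (mul_eq_zero.1 this).resolve_left ht0

lemma mem_sup_span {X : Ideal R} {x u : R} : u ∈ X ⊔ Ideal.span {x} ↔ ∃ a, u - x * a ∈ X := by
  rw [Submodule.mem_sup]
  constructor
  · rintro ⟨y, hy, z, hz, rfl⟩
    obtain ⟨a, rfl⟩ := Ideal.mem_span_singleton'.1 hz
    exact ⟨a, by convert hy using 1; ring⟩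
  · rintro ⟨a, ha⟩
    exact ⟨_, ha, x * a, Ideal.mul_mem_right _ _ (Ideal.mem_span_singleton_self x), by ring⟩

lemma mem_sup_span2 {X : Ideal R} {x z u : R} :
    u ∈ X ⊔ Ideal.span {x} ⊔ Ideal.span {z} ↔ ∃ a b, u - x * a - z * b ∈ X := by
  rw [mem_sup_span]
  constructor
  · rintro ⟨b, hb⟩
    obtain ⟨a, ha⟩ := mem_sup_span.1 hb
    exact ⟨a, b, by convert ha using 1; ring⟩
  · rintro ⟨a, b, h⟩
    exact ⟨b, mem_sup_span.2 ⟨a, by convert h using 1; ring⟩⟩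

/-- combination of memberships -/
lemma comb2 {X : Ideal R} {u v w : R} (c d : R) (hu : u ∈ X) (hv : v ∈ X) (h : w = c * u + d * v) :
    w ∈ X := h ▸ add_mem (X.mul_mem_left _ hu) (X.mul_mem_left _ hv)
lemma comb1 {X : Ideal R} {u w : R} (c : R) (hu : u ∈ X) (h : w = c * u) :
    w ∈ X := h ▸ (X.mul_mem_left _ hu)
lemma comb3 {X : Ideal R} {u v w z : R} (c d e : R) (hu : u ∈ X) (hv : v ∈ X) (hz : z ∈ X)
    (h : w = c * u + d * v + e * z) :
    w ∈ X := h ▸ add_mem (add_mem (X.mul_mem_left _ hu) (X.mul_mem_left _ hv)) (X.mul_mem_left _ hz)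

lemma step_lemma {Q Z : Ideal R} {x z y : R} (hx : x ∈ Q) (hz : z ∈ Q) (hy : y ∈ Q)
    (w1 : ∀ u, z * u ∈ Z ⊔ Ideal.span {x} ⊔ Ideal.span {y} → u ∈ UU Q (Z ⊔ Ideal.span {x} ⊔ Ideal.span {y}))
    (w2 : ∀ u, y ^ 2 * u ∈ Z ⊔ Ideal.span {x ^ 2} ⊔ Ideal.span {z ^ 2} →
      u ∈ UU Q (Z ⊔ Ideal.span {x ^ 2} ⊔ Ideal.span {z ^ 2}))
    (w3 : ∀ u, z * u ∈ Z ⊔ Ideal.span {x ^ 2} → u ∈ UU Q (Z ⊔ Ideal.span {x ^ 2}))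
    (w4 : ∀ u, z ^ 2 * u ∈ Z ⊔ Ideal.span {x} → u ∈ UU Q (Z ⊔ Ideal.span {x}))
    (w5 : ∀ u, x * u ∈ Z ⊔ Ideal.span {z} → u ∈ UU Q (Z ⊔ Ideal.span {z}))
    (w6 : ∀ u, x * u ∈ Z → u ∈ UU Q Z)
    (w7 : ∀ u, y ^ 2 * u ∈ Z ⊔ Ideal.span {x} → u ∈ UU Q (Z ⊔ Ideal.span {x}))
    (u α β : R) (hu : u ∈ UU Q (Z ⊔ Ideal.span {x} ⊔ Ideal.span {z}))
    (he : y * u - x * α - z * β ∈ Z)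
    (hdec : β ∈ UU Q (Z ⊔ Ideal.span {x} ⊔ Ideal.span {y}) →
      β ∈ UU Q (Z ⊔ Ideal.span {x} ⊔ Ideal.span {z}) ⊔ UU Q (Z ⊔ Ideal.span {y} ⊔ Ideal.span {z})) :
    u ∈ UU Q (Z ⊔ Ideal.span {x}) ⊔ UU Q (Z ⊔ Ideal.span {z}) := by
  have hβ := hdec (w1 β (mem_sup_span2.2 ⟨-α, u, comb1 (-1) he (by ring)⟩))
  obtain ⟨c1, hc1, c2, hc2, rfl⟩ := Submodule.mem_sup.1 hβ
  obtain ⟨γ, ε, hγ⟩ := mem_sup_span2.1 (hc2 x hx)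
  obtain ⟨δ, θ, hδ⟩ := mem_sup_span2.1 (hc1 y hy)
  have h2 := w2 (x * u - z * γ) (mem_sup_span2.2 ⟨y * α + z * δ, y * ε + x * θ,
    comb3 (x * y) (z * y) (x * z) he hγ hδ (by ring)⟩)
  obtain ⟨a, b, hab⟩ := mem_sup_span2.1 (h2 z hz)
  have h3 : x * u - z * γ - z * b ∈ UU Q (Z ⊔ Ideal.span {x ^ 2}) :=
    w3 _ (mem_sup_span.2 ⟨a, comb1 1 hab (by ring)⟩)
  obtain ⟨a', ha'⟩ := mem_sup_span.1 (h3 z hz)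
  have h4 : b + γ ∈ UU Q (Z ⊔ Ideal.span {x}) :=
    w4 _ (mem_sup_span.2 ⟨z * u - x * a', comb1 (-1) ha' (by ring)⟩)
  obtain ⟨u2, hu2⟩ := mem_sup_span.1 (h4 z hz)
  have h5 : u2 ∈ UU Q (Z ⊔ Ideal.span {z}) :=
    w5 _ (mem_sup_span.2 ⟨b + γ, comb1 (-1) hu2 (by ring)⟩)
  obtain ⟨s, hs⟩ := mem_sup_span.1 (h3 y hy)
  have h6 : y * (u - u2) - x * s ∈ UU Q Z :=
    w6 _ (comb2 1 y hs hu2 (by ring))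
  have h7 : u - u2 ∈ UU Q (Z ⊔ Ideal.span {x}) :=
    w7 _ (mem_sup_span.2 ⟨y * s, comb1 1 (h6 y hy) (by ring)⟩)
  exact Submodule.mem_sup.2 ⟨_, h7, _, h5, by ring⟩

lemma hstep_lemma {Q Z : Ideal R} {x z : R} (hx : x ∈ Q) (hz : z ∈ Q)
    (w1 : ∀ u, z ^ 2 * u ∈ Z ⊔ Ideal.span {x ^ 2} → u ∈ UU Q (Z ⊔ Ideal.span {x ^ 2}))
    (w2 : ∀ u, x * u ∈ Z → u ∈ UU Q Z)
    (v : R) (hv : v ∈ UU Q (Z ⊔ Ideal.span {x}))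
    (hdec : v ∈ Ideal.span {x} ⊔ UU Q (Z ⊔ Ideal.span {z})) :
    v ∈ Ideal.span {x} ⊔ UU Q Z := by
  rw [sup_comm, mem_sup_span] at hdec ⊢
  obtain ⟨m, hm⟩ := hdec
  obtain ⟨g, hg⟩ := mem_sup_span.1 (hm x hx)
  obtain ⟨k, hk⟩ := mem_sup_span.1 (hv z hz)
  have h1 : g ∈ UU Q (Z ⊔ Ideal.span {x ^ 2}) :=
    w1 _ (mem_sup_span.2 ⟨k - z * m, comb2 (-z) x hg hk (by ring)⟩)
  obtain ⟨m', hm'⟩ := mem_sup_span.1 (h1 z hz)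
  exact ⟨m + m', w2 _ (comb2 1 1 hg hm' (by ring))⟩

end UU

section grad
variable {A R : Type} [CommRing A] [CommRing R] [Algebra A R] (𝒜 : ℕ → Submodule A R) [GradedAlgebra 𝒜]

/-- homogeneous component -/
noncomputable def pr (n : ℕ) (x : R) : R := (DirectSum.decompose 𝒜 x n : R)

lemma pr_mem (n : ℕ) (x : R) : pr 𝒜 n x ∈ 𝒜 n := SetLike.coe_mem _

lemma pr_add (n : ℕ) (x y : R) : pr 𝒜 n (x + y) = pr 𝒜 n x + pr 𝒜 n y := by
  simp [pr, DirectSum.decompose_add]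

lemma pr_sub (n : ℕ) (x y : R) : pr 𝒜 n (x - y) = pr 𝒜 n x - pr 𝒜 n y := by
  simp [pr, DirectSum.decompose_sub]

lemma pr_same {n : ℕ} {x : R} (h : x ∈ 𝒜 n) : pr 𝒜 n x = x := DirectSum.decompose_of_mem_same _ h

lemma pr_ne {n m : ℕ} {x : R} (h : x ∈ 𝒜 n) (hn : n ≠ m) : pr 𝒜 m x = 0 :=
  DirectSum.decompose_of_mem_ne _ h hn

lemma pr_mul {i : ℕ} {x : R} (h : x ∈ 𝒜 i) (n : ℕ) (y : R) : pr 𝒜 (i + n) (x * y) = x * pr 𝒜 n y :=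
  DirectSum.coe_decompose_mul_add_of_left_mem 𝒜 h

lemma pr_mul_lt {i : ℕ} {x : R} (h : x ∈ 𝒜 i) (n : ℕ) (hn : n < i) (y : R) : pr 𝒜 n (x * y) = 0 :=
  DirectSum.coe_decompose_mul_of_left_mem_of_not_le 𝒜 h (by omega)

lemma pr_alg (n : ℕ) (c : A) (y : R) : pr 𝒜 n (algebraMap A R c * y) = algebraMap A R c * pr 𝒜 n y := by
  have h : algebraMap A R c ∈ 𝒜 0 := SetLike.algebraMap_mem_graded 𝒜 c
  have := pr_mul 𝒜 h n y
  rwa [zero_add] at this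

lemma pr_ideal {X : Ideal R} (hX : X.IsHomogeneous 𝒜) (n : ℕ) {x : R} (hx : x ∈ X) : pr 𝒜 n x ∈ X :=
  hX n hx

open Classical in
lemma pr_sum (x : R) : x = ∑ i ∈ (DirectSum.decompose 𝒜 x).support, pr 𝒜 i x :=
  (DirectSum.sum_support_decompose 𝒜 x).symm

open Classical in
lemma isHomogeneous_UU {Q X : Ideal R} (hQ : Q.IsHomogeneous 𝒜) (hX : X.IsHomogeneous 𝒜) :
    (UU Q X).IsHomogeneous 𝒜 := by
  intro n u hu t ht
  rw [pr_sum 𝒜 t, Finset.sum_mul]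
  refine sum_mem fun i _ => ?_
  have h1 : pr 𝒜 (i + n) (pr 𝒜 i t * u) ∈ X := pr_ideal 𝒜 hX _ (hu _ (pr_ideal 𝒜 hQ i ht))
  rwa [pr_mul 𝒜 (pr_mem 𝒜 i t)] at h1

lemma isHomogeneous_span_single {i : ℕ} {x : R} (hx : x ∈ 𝒜 i) : (Ideal.span {x}).IsHomogeneous 𝒜 :=
  Ideal.homogeneous_span 𝒜 _ (by rintro _ rfl; exact ⟨i, hx⟩)

open Classical in
/-- (G) -/
lemma graded_cancel {X : Ideal R} (hX : X.IsHomogeneous 𝒜) (s : R)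
    (hs : IsUnit (pr 𝒜 0 s)) (y : R) (h : s * y ∈ X) : y ∈ X := by
  have key : ∀ n, pr 𝒜 n y ∈ X := by
    intro n
    induction n using Nat.strong_induction_on with
    | _ n ih =>
      have h1 : pr 𝒜 n (s * y) ∈ X := pr_ideal 𝒜 hX n h
      have h2 : pr 𝒜 n (s * y) = ∑ p ∈ Finset.HasAntidiagonal.antidiagonal n, pr 𝒜 p.1 s * pr 𝒜 p.2 y := by
        conv_lhs => rw [pr_sum 𝒜 s]
        rw [Finset.sum_mul]
        have : ∀ (F : Finset ℕ) (f : ℕ → R), pr 𝒜 n (∑ i ∈ F, f i) = ∑ i ∈ F, pr 𝒜 n (f i) := by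
          intro F f
          simp [pr, DirectSum.decompose_sum, DFinsupp.finset_sum_apply]
        rw [this]
        rw [Finset.Nat.sum_antidiagonal_eq_sum_range_succ (fun i j => pr 𝒜 i s * pr 𝒜 j y)]
        rw [← Finset.sum_subset (Finset.inter_subset_left (s₁ := (DirectSum.decompose 𝒜 s).support) (s₂ := Finset.range n.succ)),
          ← Finset.sum_subset (Finset.inter_subset_right (s₁ := (DirectSum.decompose 𝒜 s).support) (s₂ := Finset.range n.succ))]
        · refine Finset.sum_congr rfl fun i hi => ?_
          have hi2 := Finset.mem_range.1 (Finset.mem_inter.1 hi).2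
          obtain ⟨k, rfl⟩ := Nat.exists_eq_add_of_le (Nat.lt_succ_iff.1 hi2)
          rw [pr_mul 𝒜 (pr_mem 𝒜 i s), Nat.add_sub_cancel_left]
        · intro i hi hi'
          have : i ∉ (DirectSum.decompose 𝒜 s).support := fun h' => hi' (Finset.mem_inter.2 ⟨h', hi⟩)
          have : pr 𝒜 i s = 0 := by
            simpa [pr, DFinsupp.mem_support_iff] using this
          rw [this, zero_mul]
        · intro i hi hi'
          have : i ∉ Finset.range n.succ := fun h' => hi' (Finset.mem_inter.2 ⟨hi, h'⟩)
          rw [Finset.mem_range] at this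
          exact pr_mul_lt 𝒜 (pr_mem 𝒜 i s) n (by omega) y
      rw [h2, ← Finset.sum_erase_add _ _ (show (0, n) ∈ Finset.HasAntidiagonal.antidiagonal n by simp)] at h1
      have h3 : ∑ p ∈ (Finset.HasAntidiagonal.antidiagonal n).erase (0, n), pr 𝒜 p.1 s * pr 𝒜 p.2 y ∈ X := by
        refine sum_mem fun p hp => X.mul_mem_left _ (ih _ ?_)
        obtain ⟨p1, p2⟩ := p
        simp at hp
        rcases Nat.eq_zero_or_pos p1 with rfl | h
        · simp at hp
        · simp; omega
      exact (Ideal.unit_mul_mem_iff_mem X hs).1 ((Submodule.add_mem_iff_right X h3).1 h1)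
  rw [pr_sum 𝒜 y]
  exact sum_mem fun i _ => key i

/-- homogeneous coefficients -/
lemma hom_coef {X : Ideal R} (hX : X.IsHomogeneous 𝒜) {i n : ℕ} {x u : R} (hx : x ∈ 𝒜 i) (hu : u ∈ 𝒜 (i + n))
    (h : u ∈ X ⊔ Ideal.span {x}) : ∃ a ∈ 𝒜 n, u - x * a ∈ X := by
  obtain ⟨a, ha⟩ := mem_sup_span.1 h
  refine ⟨pr 𝒜 n a, pr_mem 𝒜 n a, ?_⟩
  have := pr_ideal 𝒜 hX (i + n) ha
  rwa [pr_sub, pr_same 𝒜 hu, pr_mul 𝒜 hx] at this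

lemma hom_coef2 {X : Ideal R} (hX : X.IsHomogeneous 𝒜) {i n j m k : ℕ} {x z u : R} (hx : x ∈ 𝒜 i) (hz : z ∈ 𝒜 j)
    (hu : u ∈ 𝒜 k) (h1 : k = i + n) (h2 : k = j + m)
    (h : u ∈ X ⊔ Ideal.span {x} ⊔ Ideal.span {z}) : ∃ a ∈ 𝒜 n, ∃ b ∈ 𝒜 m, u - x * a - z * b ∈ X := by
  obtain ⟨a, b, ha⟩ := mem_sup_span2.1 h
  refine ⟨pr 𝒜 n a, pr_mem 𝒜 n a, pr 𝒜 m b, pr_mem 𝒜 m b, ?_⟩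
  have := pr_ideal 𝒜 hX k ha
  rw [pr_sub, pr_sub, pr_same 𝒜 hu] at this
  nth_rewrite 1 [h1] at this
  nth_rewrite 1 [h2] at this
  rwa [pr_mul 𝒜 hx, pr_mul 𝒜 hz] at this

lemma hom_sup {X Y : Ideal R} (hX : X.IsHomogeneous 𝒜) (hY : Y.IsHomogeneous 𝒜) {n : ℕ} {u : R} (hu : u ∈ 𝒜 n)
    (h : u ∈ X ⊔ Y) : ∃ a ∈ 𝒜 n, a ∈ X ∧ ∃ b ∈ 𝒜 n, b ∈ Y ∧ u = a + b := by
  obtain ⟨a, ha, b, hb, rfl⟩ := Submodule.mem_sup.1 h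
  refine ⟨_, pr_mem 𝒜 n a, pr_ideal 𝒜 hX _ ha, _, pr_mem 𝒜 n b, pr_ideal 𝒜 hY _ hb, ?_⟩
  rw [← pr_add, pr_same 𝒜 hu]
end grad

section cut
variable {A R : Type} [CommRing A] [IsDomain A] [CommRing R] [Algebra A R] (𝒜 : ℕ → Submodule A R) [GradedAlgebra 𝒜]

local notation "κ" => algebraMap A R

/-- data of a cut -/
structure Cut1 (Q J : Ideal R) (Ta Tb : R) (φ : R →ₐ[A] A) (f g : A) : Prop where
  gen : ∀ n, 𝒜 (n + 1) = 𝒜 1 * 𝒜 n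
  zero : ∀ x ∈ 𝒜 0, ∃ c : A, x = κ c
  hQ : Q.IsHomogeneous 𝒜
  hJ : J.IsHomogeneous 𝒜
  hTa : Ta ∈ 𝒜 1
  hTb : Tb ∈ 𝒜 1
  hTaQ : Ta ∈ Q
  hTbQ : Tb ∈ Q
  hAQ : 𝒜 1 ≤ Q.restrictScalars A
  φJ : ∀ x ∈ J, φ x = 0
  φTa : φ Ta = f
  φTb : φ Tb = g
  hf : f ≠ 0
  hg : g ≠ 0
  hfQ : κ f ∈ Q
  LK : ∀ w ∈ 𝒜 1, κ f * w - κ (φ w) * Ta ∈ J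
  LK2 : ∀ w ∈ 𝒜 1, κ g * w - κ (φ w) * Tb ∈ J
  cop : ∀ m n y, f ^ m ∣ g ^ n * y → f ^ m ∣ y
  W1 : ∀ n u, 0 < n → κ f ^ n * u ∈ J → u ∈ UU Q J
  W2 : ∀ n k u, 0 < n → 0 < k → κ f ^ n * u ∈ J ⊔ Ideal.span {Tb ^ k} → u ∈ UU Q (J ⊔ Ideal.span {Tb ^ k})
  W3 : ∀ N a b u, 0 < N → 0 < a → 0 < b → κ g ^ N * u ∈ J ⊔ Ideal.span {κ f ^ a} ⊔ Ideal.span {Tb ^ b} →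
    Ta ^ N * u ∈ J ⊔ Ideal.span {κ f ^ a} ⊔ Ideal.span {Tb ^ b} → u ∈ UU Q (J ⊔ Ideal.span {κ f ^ a} ⊔ Ideal.span {Tb ^ b})
  W4 : ∀ n u, 0 < n → Tb ^ n * u ∈ J ⊔ Ideal.span {κ f} → u ∈ UU Q (J ⊔ Ideal.span {κ f})

namespace Cut1
variable {𝒜} {Q J : Ideal R} {Ta Tb : R} {φ : R →ₐ[A] A} {f g : A} (C : Cut1 𝒜 Q J Ta Tb φ f g)
include C

lemma gT : κ g * Ta - κ f * Tb ∈ J := by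
  have := C.LK2 Ta C.hTa
  rwa [C.φTa] at this

omit C in
lemma alg0 (c : A) : κ c ∈ 𝒜 0 := SetLike.algebraMap_mem_graded 𝒜 c

omit C in
lemma algpow0 (c : A) (n : ℕ) : κ c ^ n ∈ 𝒜 0 := by
  rw [← map_pow]; exact alg0 _

omit C in
lemma algmul (c : A) {n : ℕ} {w : R} (hw : w ∈ 𝒜 n) : κ c * w ∈ 𝒜 n := by
  rw [← Algebra.smul_def]; exact (𝒜 n).smul_mem _ hw

omit C in
lemma powmem {T : R} (hT : T ∈ 𝒜 1) (n : ℕ) : T ^ n ∈ 𝒜 n := by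
  have := SetLike.pow_mem_graded n hT
  simpa using this

omit C in
lemma mulmem {i j k : ℕ} {x y : R} (hx : x ∈ 𝒜 i) (hy : y ∈ 𝒜 j) (h : k = i + j := by omega) : x * y ∈ 𝒜 k := by
  subst h; exact SetLike.mul_mem_graded hx hy

omit C [IsDomain A] [GradedAlgebra 𝒜] in
lemma LKgen (hgen : ∀ n, 𝒜 (n + 1) = 𝒜 1 * 𝒜 n) (hzero : ∀ x ∈ 𝒜 0, ∃ c : A, x = κ c)
    (f : A) (T : R) (h : ∀ w ∈ 𝒜 1, κ f * w - κ (φ w) * T ∈ J) (n : ℕ) :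
    ∀ w ∈ 𝒜 n, κ f ^ n * w - κ (φ w) * T ^ n ∈ J := by
  induction n with
  | zero =>
    intro w hw
    obtain ⟨c, rfl⟩ := hzero w hw
    simp
  | succ n ih =>
    intro w hw
    rw [hgen n] at hw
    refine Submodule.mul_induction_on hw ?_ ?_
    · intro x hx y hy
      refine comb2 (κ f ^ n * y) (κ (φ x) * T) (h x hx) (ih y hy) ?_
      rw [map_mul, map_mul]; ring
    · intro x y hx hy
      refine comb2 1 1 hx hy ?_
      rw [map_add, map_add]; ring

lemma K0 {n : ℕ} {w : R} (hw : w ∈ 𝒜 n) : κ f ^ n * w - κ (φ w) * Ta ^ n ∈ J :=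
  LKgen C.gen C.zero f Ta C.LK n w hw

lemma K0' {n : ℕ} {w : R} (hw : w ∈ 𝒜 n) : κ g ^ n * w - κ (φ w) * Tb ^ n ∈ J :=
  LKgen C.gen C.zero g Tb C.LK2 n w hw

lemma K1 {n : ℕ} {w : R} (hw : w ∈ 𝒜 n) (h : φ w = 0) : w ∈ UU Q J := by
  refine C.W1 (n + 1) w (by omega) ?_
  have := C.K0 hw
  rw [h] at this
  exact comb1 (κ f) this (by simp; ring)

lemma gTpow (b : ℕ) : (κ g * Ta) ^ b - (κ f * Tb) ^ b ∈ J :=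
  Ideal.mem_of_dvd _ (sub_dvd_pow_sub_pow _ _ b) C.gT
  where
  Ideal.mem_of_dvd (I : Ideal R) {x y : R} (h : x ∣ y) (hx : x ∈ I) : y ∈ I := by
    obtain ⟨c, rfl⟩ := h; exact I.mul_mem_right _ hx

lemma K2 {n b : ℕ} {u : R} {β : A} (hu : u ∈ 𝒜 n) (hb : 0 < b) (hn : b ≤ n) (h : φ u = g ^ b * β) :
    u ∈ UU Q (J ⊔ Ideal.span {Tb ^ b}) := by
  refine C.W2 n b u (by omega) hb ?_
  obtain ⟨k, rfl⟩ := Nat.exists_eq_add_of_le hn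
  have h1 := C.K0 hu
  rw [h] at h1
  refine mem_sup_span.2 ⟨κ β * κ f ^ b * Ta ^ k, comb2 1 (κ β * Ta ^ k) h1 (C.gTpow b) ?_⟩
  rw [map_mul, map_pow]; ring

/-- the ideal `I` -/
def I' (_C : Cut1 𝒜 Q J Ta Tb φ f g) (n : ℕ) : Submodule A A := (𝒜 n).map φ.toLinearMap

lemma mem_I' {n : ℕ} {x : A} : x ∈ C.I' n ↔ ∃ w ∈ 𝒜 n, φ w = x := Iff.rfl

lemma φalg (c : A) : φ (κ c) = c := by simp

lemma I'_succ (n : ℕ) : C.I' (n + 1) ≤ C.I' n := by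
  rintro _ ⟨w, hw, rfl⟩
  rw [SetLike.mem_coe, C.gen n] at hw
  refine Submodule.mul_induction_on hw ?_ ?_
  · intro x _ y hy
    exact ⟨κ (φ x) * y, algmul _ hy, by simp⟩
  · intro x y hx hy
    rw [map_add]; exact add_mem hx hy

lemma I'_mono {m n : ℕ} (h : m ≤ n) : C.I' n ≤ C.I' m := by
  induction n, h using Nat.le_induction with
  | base => exact le_rfl
  | succ n _ ih => exact (C.I'_succ n).trans ih

lemma L3 {j s a b : ℕ} {u : R} (hu : u ∈ 𝒜 j) (hs : φ u ∈ C.I' s) (ha : 0 < a) (hb : 0 < b)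
    (hbj : b ≤ j) (hj : j + a ≤ s) : u ∈ UU Q (J ⊔ Ideal.span {κ f ^ a} ⊔ Ideal.span {Tb ^ b}) := by
  obtain ⟨ω, hω, he⟩ := hs
  have he : φ ω = φ u := he
  obtain ⟨c, rfl⟩ := Nat.exists_eq_add_of_le hj
  obtain ⟨d, rfl⟩ := Nat.exists_eq_add_of_le hbj
  refine C.W3 (b + d + a + c + 1) a b u (by omega) ha hb ?_ ?_
  · refine mem_sup_span2.2 ⟨0, κ g ^ (a + c + 1) * κ (φ u) * Tb ^ d, comb1 (κ g ^ (a + c + 1)) (C.K0' hu) ?_⟩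
    ring
  · have h1 : Ta ^ (a + c) * u - κ f ^ (a + c) * ω ∈ UU Q J := by
      refine C.K1 (n := b + d + a + c) (sub_mem (mulmem (powmem C.hTa _) hu) (mulmem (algpow0 _ _) hω)) ?_
      simp [he, C.φTa]
    refine mem_sup_span2.2 ⟨κ f ^ c * Ta ^ (b + d + 1) * ω, 0, comb1 (Ta ^ (b + d)) (h1 Ta C.hTaQ) ?_⟩
    ring

lemma cop1 {y : A} (h : f ∣ g * y) : f ∣ y := by simpa using C.cop 1 1 y (by simpa using h)

lemma C1 {n : ℕ} (hn : 3 ≤ n) {ζ : A} (h : ζ ∈ C.I' n) : ∃ m ∈ 𝒜 (n - 1), ∃ c, ζ = f * φ m + g * c := by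
  obtain ⟨k, rfl⟩ := Nat.exists_eq_add_of_le hn
  obtain ⟨u, hu, he⟩ := C.I'_mono (show k + 1 ≤ 3 + k by omega) h
  have he : φ u = ζ := he
  have h3 := C.L3 (a := 2) (b := 1) hu (he ▸ h) (by omega) (by omega) (by omega) (by omega)
  obtain ⟨m, hm, m', hm', h4⟩ := hom_coef2 𝒜 C.hJ (algpow0 f 2) (powmem C.hTb 1) (k := k + 2) (n := k + 2) (m := k + 1)
    (mulmem C.hTa hu) (by omega) (by omega) (h3 Ta C.hTaQ)
  have h5 := C.φJ _ h4
  simp [C.φTa, C.φTb, he] at h5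
  have : f ∣ g * φ m' := ⟨ζ - f * φ m, by linear_combination (-1) * h5⟩
  obtain ⟨c, hc⟩ := C.cop1 this
  refine ⟨m, by convert hm using 2; omega, c, mul_left_cancel₀ C.hf ?_⟩
  rw [hc] at h5
  linear_combination h5

lemma P2base {n : ℕ} (hn : 2 ≤ n) {u : R} (hu : u ∈ 𝒜 n)
    (h : u ∈ UU Q (J ⊔ Ideal.span {Tb} ⊔ Ideal.span {κ f})) :
    u ∈ UU Q (J ⊔ Ideal.span {Tb}) ⊔ Ideal.span {κ f} := by
  obtain ⟨m', hm', m, hm, h4⟩ := hom_coef2 𝒜 C.hJ C.hTb (alg0 f) (k := n + 1) (n := n) (m := n + 1)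
    (mulmem C.hTa hu) (by omega) (by omega) (h Ta C.hTaQ)
  have h5 := C.φJ _ h4
  simp [C.φTa, C.φTb] at h5
  have : f ∣ g * φ m' := ⟨φ u - φ m, by linear_combination (-1) * h5⟩
  obtain ⟨c, hc⟩ := C.cop1 this
  have h6 : φ u = φ m + g * c := mul_left_cancel₀ C.hf (by rw [hc] at h5; linear_combination h5)
  obtain ⟨w, hw, c', hc'⟩ := C.C1 (n := n + 1) (by omega) ⟨m, hm, rfl⟩
  have hc' : φ m = f * φ w + g * c' := hc'
  refine mem_sup_span.2 ⟨w, ?_⟩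
  have := C.K2 (b := 1) (β := c + c') (sub_mem hu (algmul f hw)) (by omega) (by omega) (by
    simp; rw [h6, hc']; ring)
  simpa using this

lemma P1base {n : ℕ} (hn : 2 ≤ n) {u : R} (hu : u ∈ 𝒜 (n + 1))
    (h : u ∈ UU Q (J ⊔ Ideal.span {Tb})) :
    u ∈ Ideal.span {Tb} ⊔ UU Q J := by
  obtain ⟨m0, hm0, h0⟩ := hom_coef 𝒜 C.hJ C.hTb (n := n + 1) (mulmem C.hTa hu) (h Ta C.hTaQ)
  have h5 := C.φJ _ h0
  simp [C.φTa, C.φTb] at h5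
  obtain ⟨c, hc⟩ := C.cop1 (y := φ m0) ⟨φ u, by linear_combination (-1) * h5⟩
  have hc : φ u = g * c := mul_left_cancel₀ C.hf (by rw [hc] at h5; linear_combination h5)
  have hcI : ∀ y ∈ 𝒜 1, φ y * c ∈ C.I' (n + 1) := by
    intro y hy
    obtain ⟨m, hm, h1⟩ := hom_coef 𝒜 C.hJ C.hTb (n := n + 1) (mulmem hy hu) (h y (C.hAQ hy))
    have h2 := C.φJ _ h1
    simp [C.φTb, hc] at h2
    exact ⟨m, hm, mul_left_cancel₀ C.hg (by show g * φ m = _; linear_combination (-1) * h2)⟩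
  have hfc : f * c ∈ C.I' (n + 1) := by simpa [C.φTa] using hcI Ta C.hTa
  obtain ⟨k, rfl⟩ := Nat.exists_eq_add_of_le hn
  obtain ⟨u', hu', he⟩ := C.I'_mono (show k + 1 ≤ 2 + k + 1 by omega) hfc
  have he : φ u' = f * c := he
  have h3 := C.L3 (a := 2) (b := k + 1) hu' (he ▸ hfc) (by omega) (by omega) (by omega) (by omega)
  obtain ⟨m, hm, m', hm', h4⟩ := hom_coef2 𝒜 C.hJ (algpow0 f 2) (powmem C.hTb (k + 1)) (k := 2 + k) (n := 2 + k) (m := 1)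
    (mulmem C.hTa hu') (by omega) (by omega) (h3 Ta C.hTaQ)
  have h5 := C.φJ _ h4
  simp [C.φTa, C.φTb, he] at h5
  obtain ⟨β, hβ⟩ := C.cop 2 (k + 1) (φ m') ⟨c - φ m, by linear_combination (-1) * h5⟩
  have hcβ : c = φ m + g ^ (k + 1) * β := mul_left_cancel₀ (pow_ne_zero 2 C.hf) (by
    rw [hβ] at h5; linear_combination h5)
  suffices hs : g ^ (k + 1) * β ∈ C.I' (2 + k) by
    obtain ⟨m2, hm2, he2⟩ := hs
    have he2 : φ m2 = _ := he2
    rw [sup_comm, mem_sup_span]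
    refine ⟨m + m2, C.K1 (sub_mem hu (mulmem C.hTb (add_mem hm hm2) (by omega))) ?_⟩
    simp [C.φTb, hc, hcβ, he2]
  -- g^2 β in I^3
  have hb1 : g ^ 2 * β ∈ C.I' 3 := by
    have h6 : g ^ (k + 1) * β * g ∈ C.I' (2 + k + 1) := by
      have h7 := hcI Tb C.hTb
      rw [C.φTb] at h7
      have h8 : g * φ m ∈ C.I' (2 + k + 1) :=
        ⟨Tb * m, mulmem C.hTb hm, by simp [C.φTb]⟩
      convert sub_mem h7 h8 using 1
      rw [hcβ]; ring
    obtain ⟨v, hv, hev⟩ := h6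
    have hev : φ v = _ := hev
    have h7 := C.K2 (b := k + 1) (β := β * g) hv (by omega) (by omega) (by rw [hev]; ring)
    obtain ⟨m3, hm3, h8⟩ := hom_coef 𝒜 C.hJ (powmem C.hTb (k + 1)) (n := 3) (mulmem C.hTb hv) (h7 Tb C.hTbQ)
    have h9 := C.φJ _ h8
    simp [C.φTb, hev] at h9
    exact ⟨m3, hm3, mul_left_cancel₀ (pow_ne_zero (k + 1) C.hg) (by show g ^ (k + 1) * φ m3 = _; linear_combination (-1) * h9)⟩
  obtain ⟨ω, hω, heω⟩ := hb1
  have heω : φ ω = _ := heω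
  have h6 : Tb ^ 2 * (κ β * Ta) - κ f * ω ∈ UU Q J := by
    refine C.K1 (n := 3) (sub_mem (mulmem (powmem C.hTb 2) (algmul β C.hTa)) (algmul f hω)) ?_
    simp [C.φTa, C.φTb, heω]; ring
  have h7 : κ β * Ta ∈ UU Q (J ⊔ Ideal.span {κ f}) :=
    C.W4 3 _ (by omega) (mem_sup_span.2 ⟨Tb * ω, comb1 1 (h6 Tb C.hTbQ) (by ring)⟩)
  obtain ⟨m4, hm4, h8⟩ := hom_coef 𝒜 C.hJ (alg0 f) (n := 2) (mulmem C.hTb (algmul β C.hTa)) (h7 Tb C.hTbQ)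
  have h9 := C.φJ _ h8
  simp [C.φTa, C.φTb] at h9
  have h10 : φ m4 = g * β := mul_left_cancel₀ C.hf (by linear_combination (-1) * h9)
  exact ⟨Tb ^ k * m4, mulmem (powmem C.hTb k) hm4, by simp [C.φTb, h10]; ring⟩

end Cut1
end cut

section sys
variable {A R ι : Type} [CommRing A] [IsDomain A] [CommRing R] [Algebra A R] (𝒜 : ℕ → Submodule A R) [GradedAlgebra 𝒜]
  [Fintype ι] [DecidableEq ι]

local notation "κ" => algebraMap A R

/-- the basic elements -/
def yb (T : ι → R) (h : ι → A) (b : ι) (o : Option ι) : R := o.elim (κ (h b)) T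

/-- system with weak sequences -/
structure Sys (Q : Ideal R) (T : ι → R) (h : ι → A) (φ : ι → ι → R →ₐ[A] A) : Prop where
  gen : ∀ n, 𝒜 (n + 1) = 𝒜 1 * 𝒜 n
  zero : ∀ x ∈ 𝒜 0, ∃ c : A, x = κ c
  hQ : Q.IsHomogeneous 𝒜
  hQ0 : Q ≠ ⊥
  hAQ : 𝒜 1 ≤ Q.restrictScalars A
  hT : ∀ i, T i ∈ 𝒜 1
  hh : ∀ i, κ (h i) ∈ Q
  hne : ∀ i, h i ≠ 0
  φ1 : ∀ a b, a ≠ b → φ a b (T a) = h b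
  φ2 : ∀ a b, a ≠ b → φ a b (T b) = - h a
  φ3 : ∀ a b j, j ≠ a → j ≠ b → φ a b (T j) = 0
  anti : ∀ a b, ∀ w ∈ 𝒜 1, φ b a w = - φ a b w
  Cr : ∀ w ∈ 𝒜 1, ∀ b, κ (h b) * w = ∑ j ∈ Finset.univ.erase b, κ (φ j b w) * T j
  cop : ∀ a b, a ≠ b → ∀ m n y, h a ^ m ∣ h b ^ n * y → h a ^ m ∣ y
  W : ∀ a b, a ≠ b → ∀ k : Option ι → ℕ, (∀ o, 0 < k o) → ∀ S : Set (Option ι), some a ∉ S →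
    ∀ i, i ∉ S → i ≠ some a → ∀ u, yb T h b i ^ k i * u ∈ Ideal.span ((fun o => yb T h b o ^ k o) '' S) →
      u ∈ UU Q (Ideal.span ((fun o => yb T h b o ^ k o) '' S))
  W' : ∀ a b, a ≠ b → ∀ k : Option ι → ℕ, (∀ o, 0 < k o) → ∀ S : Set (Option ι), some a ∉ S →
    ∀ N, 0 < N → ∀ u, κ (h a) ^ N * u ∈ Ideal.span ((fun o => yb T h b o ^ k o) '' S) →
      T a ^ N * u ∈ Ideal.span ((fun o => yb T h b o ^ k o) '' S) →
      u ∈ UU Q (Ideal.span ((fun o => yb T h b o ^ k o) '' S))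

namespace Sys
variable {𝒜} {Q : Ideal R} {T : ι → R} {h : ι → A} {φ : ι → ι → R →ₐ[A] A} (D : Sys 𝒜 Q T h φ)

/-- span of basic elements -/
def Z (_D : Sys 𝒜 Q T h φ) (b : ι) (S : Set (Option ι)) : Ideal R := Ideal.span (yb T h b '' S)

/-- span of some T -/
def X (_D : Sys 𝒜 Q T h φ) (S : Set ι) : Ideal R := Ideal.span (T '' S)

lemma Z_some (b : ι) (S : Set ι) : D.Z b (some '' S) = D.X S := by
  unfold Z X; rw [Set.image_image]; rfl

include D
lemma ybhom (b : ι) (o : Option ι) : ∃ i, yb T h b o ∈ 𝒜 i := by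
  cases o with
  | none => exact ⟨0, Cut1.alg0 _⟩
  | some j => exact ⟨1, D.hT j⟩

lemma ybQ (b : ι) (o : Option ι) : yb T h b o ∈ Q := by
  cases o with
  | none => exact D.hh b
  | some j => exact D.hAQ (D.hT j)

lemma Zhom (b : ι) (S : Set (Option ι)) : (D.Z b S).IsHomogeneous 𝒜 :=
  Ideal.homogeneous_span 𝒜 _ (by rintro _ ⟨o, _, rfl⟩; exact D.ybhom b o)

lemma Xhom (S : Set ι) : (D.X S).IsHomogeneous 𝒜 :=
  Ideal.homogeneous_span 𝒜 _ (by rintro _ ⟨o, _, rfl⟩; exact ⟨1, D.hT o⟩)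

lemma X_insert (S : Set ι) (j : ι) : D.X (insert j S) = D.X S ⊔ Ideal.span {T j} := by
  unfold X; rw [Set.image_insert_eq, Ideal.span_insert, sup_comm]

lemma Z_insert (b : ι) (S : Set (Option ι)) (j : Option ι) : D.Z b (insert j S) = D.Z b S ⊔ Ideal.span {yb T h b j} := by
  unfold Z; rw [Set.image_insert_eq, Ideal.span_insert, sup_comm]

lemma w2 {a b : ι} (hab : a ≠ b) {S : Set (Option ι)} (hS : some a ∉ S) {p q o : Option ι}
    (hp : p ∉ S) (hq : q ∉ S) (ho : o ∉ S) (hpq : p ≠ q) (hpo : p ≠ o) (hqo : q ≠ o)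
    (hpa : p ≠ some a) (hqa : q ≠ some a) (hoa : o ≠ some a) (α β γ : ℕ) (h1 : 0 < α) (h2 : 0 < β) (h3 : 0 < γ) (u : R)
    (hu : yb T h b o ^ γ * u ∈ D.Z b S ⊔ Ideal.span {yb T h b p ^ α} ⊔ Ideal.span {yb T h b q ^ β}) :
    u ∈ UU Q (D.Z b S ⊔ Ideal.span {yb T h b p ^ α} ⊔ Ideal.span {yb T h b q ^ β}) := by
  classical
  let k : Option ι → ℕ := fun t => if t = p then α else if t = q then β else if t = o then γ else 1
  have e : Ideal.span ((fun o => yb T h b o ^ k o) '' (insert q (insert p S))) =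
      D.Z b S ⊔ Ideal.span {yb T h b p ^ α} ⊔ Ideal.span {yb T h b q ^ β} := by
    rw [Set.image_insert_eq, Set.image_insert_eq, Ideal.span_insert, Ideal.span_insert, sup_comm]
    have e1 : k q = β := by simp [k, hpq.symm]
    have e2 : k p = α := by simp [k]
    rw [e1, e2]
    congr 1
    rw [sup_comm]
    congr 1
    unfold Z
    congr 1
    apply Set.image_congr
    intro t ht
    have : k t = 1 := by
      simp only [k]
      rw [if_neg (by rintro rfl; exact hp ht), if_neg (by rintro rfl; exact hq ht), if_neg (by rintro rfl; exact ho ht)]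
    simp [this]
  rw [← e] at hu ⊢
  refine D.W a b hab k ?_ _ ?_ o ?_ hoa u ?_
  · intro t; simp only [k]; split_ifs <;> omega
  · simp [hS, hpa.symm, hqa.symm]
  · simp [ho, hpo.symm, hqo.symm]
  · have : k o = γ := by simp [k, hpo.symm, hqo.symm]
    rwa [this]

lemma w1 {a b : ι} (hab : a ≠ b) {S : Set (Option ι)} (hS : some a ∉ S) {p o : Option ι}
    (hp : p ∉ S) (ho : o ∉ S) (hpo : p ≠ o)
    (hpa : p ≠ some a) (hoa : o ≠ some a) (α γ : ℕ) (h1 : 0 < α) (h3 : 0 < γ) (u : R)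
    (hu : yb T h b o ^ γ * u ∈ D.Z b S ⊔ Ideal.span {yb T h b p ^ α}) :
    u ∈ UU Q (D.Z b S ⊔ Ideal.span {yb T h b p ^ α}) := by
  classical
  let k : Option ι → ℕ := fun t => if t = p then α else if t = o then γ else 1
  have e : Ideal.span ((fun o => yb T h b o ^ k o) '' (insert p S)) =
      D.Z b S ⊔ Ideal.span {yb T h b p ^ α} := by
    rw [Set.image_insert_eq, Ideal.span_insert, sup_comm]
    have e2 : k p = α := by simp [k]
    rw [e2]
    congr 1
    unfold Z
    congr 1
    apply Set.image_congr
    intro t ht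
    have : k t = 1 := by
      simp only [k]
      rw [if_neg (by rintro rfl; exact hp ht), if_neg (by rintro rfl; exact ho ht)]
    simp [this]
  rw [← e] at hu ⊢
  refine D.W a b hab k ?_ _ ?_ o ?_ hoa u ?_
  · intro t; simp only [k]; split_ifs <;> omega
  · simp [hS, hpa.symm]
  · simp [ho, hpo.symm]
  · have : k o = γ := by simp [k, hpo.symm]
    rwa [this]

lemma w0 {a b : ι} (hab : a ≠ b) {S : Set (Option ι)} (hS : some a ∉ S) {o : Option ι}
    (ho : o ∉ S) (hoa : o ≠ some a) (γ : ℕ) (h3 : 0 < γ) (u : R)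
    (hu : yb T h b o ^ γ * u ∈ D.Z b S) :
    u ∈ UU Q (D.Z b S) := by
  classical
  let k : Option ι → ℕ := fun t => if t = o then γ else 1
  have e : Ideal.span ((fun o => yb T h b o ^ k o) '' S) = D.Z b S := by
    unfold Z
    congr 1
    apply Set.image_congr
    intro t ht
    have : k t = 1 := by
      simp only [k]
      rw [if_neg (by rintro rfl; exact ho ht)]
    simp [this]
  rw [← e] at hu ⊢
  refine D.W a b hab k ?_ _ hS o ho hoa u ?_
  · intro t; simp only [k]; split_ifs <;> omega
  · have : k o = γ := by simp [k]
    rwa [this]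

lemma w'2 {a b : ι} (hab : a ≠ b) {S : Set (Option ι)} (hS : some a ∉ S) {p q : Option ι}
    (hp : p ∉ S) (hq : q ∉ S) (hpq : p ≠ q)
    (hpa : p ≠ some a) (hqa : q ≠ some a) (α β N : ℕ) (h1 : 0 < α) (h2 : 0 < β) (h3 : 0 < N) (u : R)
    (hu : κ (h a) ^ N * u ∈ D.Z b S ⊔ Ideal.span {yb T h b p ^ α} ⊔ Ideal.span {yb T h b q ^ β})
    (hu' : T a ^ N * u ∈ D.Z b S ⊔ Ideal.span {yb T h b p ^ α} ⊔ Ideal.span {yb T h b q ^ β}) :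
    u ∈ UU Q (D.Z b S ⊔ Ideal.span {yb T h b p ^ α} ⊔ Ideal.span {yb T h b q ^ β}) := by
  classical
  let k : Option ι → ℕ := fun t => if t = p then α else if t = q then β else 1
  have e : Ideal.span ((fun o => yb T h b o ^ k o) '' (insert q (insert p S))) =
      D.Z b S ⊔ Ideal.span {yb T h b p ^ α} ⊔ Ideal.span {yb T h b q ^ β} := by
    rw [Set.image_insert_eq, Set.image_insert_eq, Ideal.span_insert, Ideal.span_insert, sup_comm]
    have e1 : k q = β := by simp [k, hpq.symm]
    have e2 : k p = α := by simp [k]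
    rw [e1, e2]
    congr 1
    rw [sup_comm]
    congr 1
    unfold Z
    congr 1
    apply Set.image_congr
    intro t ht
    have : k t = 1 := by
      simp only [k]
      rw [if_neg (by rintro rfl; exact hp ht), if_neg (by rintro rfl; exact hq ht)]
    simp [this]
  rw [← e] at hu hu' ⊢
  refine D.W' a b hab k ?_ _ ?_ N h3 u hu hu'
  · intro t; simp only [k]; split_ifs <;> omega
  · simp [hS, hpa.symm, hqa.symm]

lemma w'0 {a b : ι} (hab : a ≠ b) {S : Set (Option ι)} (hS : some a ∉ S) (N : ℕ) (h3 : 0 < N) (u : R)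
    (hu : κ (h a) ^ N * u ∈ D.Z b S) (hu' : T a ^ N * u ∈ D.Z b S) : u ∈ UU Q (D.Z b S) := by
  have := D.W' a b hab (fun _ => 1) (by simp) S hS N h3 u
  simp only [pow_one] at this
  exact this hu hu'

lemma cut {a b : ι} (hab : a ≠ b) :
    Cut1 𝒜 Q (D.X {j | j ≠ a ∧ j ≠ b}) (T a) (T b) (φ a b) (h b) (- h a) := by
  have hS : some a ∉ some '' {j | j ≠ a ∧ j ≠ b} := by simp
  have hZ := D.Z_some b {j | j ≠ a ∧ j ≠ b}
  have hCr : ∀ a b, a ≠ b → ∀ w ∈ 𝒜 1, κ (h b) * w - κ (φ a b w) * T a ∈ D.X {j | j ≠ a ∧ j ≠ b} := by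
    intro a b hab w hw
    rw [D.Cr w hw b, ← Finset.sum_erase_add _ _ (Finset.mem_erase.2 ⟨hab, Finset.mem_univ a⟩), add_sub_cancel_right]
    refine sum_mem fun j hj => Ideal.mul_mem_left _ _ (Ideal.subset_span ⟨j, ?_, rfl⟩)
    simp at hj
    exact hj
  exact {
    gen := D.gen
    zero := D.zero
    hQ := D.hQ
    hJ := D.Xhom _
    hTa := D.hT a
    hTb := D.hT b
    hTaQ := D.hAQ (D.hT a)
    hTbQ := D.hAQ (D.hT b)
    hAQ := D.hAQ
    φJ := by
      intro x hx
      have : D.X {j | j ≠ a ∧ j ≠ b} ≤ RingHom.ker (φ a b) := by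
        refine Ideal.span_le.2 ?_
        rintro _ ⟨j, hj, rfl⟩
        exact D.φ3 a b j hj.1 hj.2
      exact this hx
    φTa := D.φ1 a b hab
    φTb := D.φ2 a b hab
    hf := D.hne b
    hg := neg_ne_zero.2 (D.hne a)
    hfQ := D.hh b
    LK := hCr a b hab
    LK2 := by
      intro w hw
      have := hCr b a hab.symm w hw
      rw [D.anti a b w hw] at this
      have e : {j | j ≠ a ∧ j ≠ b} = {j | j ≠ b ∧ j ≠ a} := by ext; simp [and_comm]
      rw [e]
      refine comb1 (-1) this ?_
      simp; ring
    cop := by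
      intro m n y hy
      rw [neg_pow] at hy
      refine D.cop b a hab.symm m n y ?_
      rw [mul_assoc] at hy
      rcases neg_one_pow_eq_or A n with e | e <;> rw [e] at hy <;> simpa using hy
    W1 := by
      intro n u hn hu
      rw [← hZ] at hu ⊢
      exact D.w0 hab hS (o := none) (by simp) (by simp) n hn u hu
    W2 := by
      intro n k u hn hk hu
      rw [← hZ] at hu ⊢
      exact D.w1 hab hS (o := none) (p := some b) (by simp) (by simp) (by simp) (by simpa using hab.symm) (by simp) k n hk hn u hu
    W3 := by
      intro N α β u hN hα hβ hu hu'
      rw [← hZ] at hu hu' ⊢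
      refine D.w'2 hab hS (p := none) (q := some b) (by simp) (by simp) (by simp) (by simp) (by simpa using hab.symm) α β N hα hβ hN u ?_ hu'
      rw [map_neg, neg_pow] at hu
      rcases neg_one_pow_eq_or R N with e | e <;> rw [e] at hu <;> simpa [yb] using hu
    W4 := by
      intro n u hn hu
      rw [← hZ] at hu ⊢
      have := D.w1 hab hS (o := some b) (p := none) (by simp) (by simp) (by simp) (by simp) (by simpa using hab.symm) 1 n (by simp) hn u
      simp only [pow_one] at this
      exact this hu }

lemma step {a b : ι} (hab : a ≠ b) {S : Set (Option ι)} (hS : some a ∉ S) {x z y : Option ι}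
    (hx : x ∉ S) (hz : z ∉ S) (hy : y ∉ S) (hxz : x ≠ z) (hxy : x ≠ y) (hzy : z ≠ y)
    (hxa : x ≠ some a) (hza : z ≠ some a) (hya : y ≠ some a) (u α β : R)
    (hu : u ∈ UU Q (D.Z b (insert x (insert z S))))
    (he : yb T h b y * u - yb T h b x * α - yb T h b z * β ∈ D.Z b S)
    (hdec : β ∈ UU Q (D.Z b (insert y (insert x (insert z S)))) →
      β ∈ UU Q (D.Z b (insert x (insert z S))) ⊔ UU Q (D.Z b (insert y (insert z S)))) :
    u ∈ UU Q (D.Z b (insert x S)) ⊔ UU Q (D.Z b (insert z S)) := by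
  simp only [Z_insert] at hu hdec ⊢
  have hu' : u ∈ UU Q (D.Z b S ⊔ Ideal.span {yb T h b x} ⊔ Ideal.span {yb T h b z}) := by
    rwa [sup_right_comm]
  refine step_lemma (y := yb T h b y) (D.ybQ b x) (D.ybQ b z) (D.ybQ b y) ?_ ?_ ?_ ?_ ?_ ?_ ?_ u α β hu' he ?_
  · intro v hv
    have := D.w2 hab hS hx hy hz hxy hxz hzy.symm hxa hya hza 1 1 1 one_pos one_pos one_pos v
    simp only [pow_one] at this
    exact this hv
  · intro v hv
    exact D.w2 hab hS hx hz hy hxz hxy hzy hxa hza hya 2 2 2 two_pos two_pos two_pos v hv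
  · intro v hv
    have := D.w1 hab hS hx hz hxz hxa hza 2 1 two_pos one_pos v
    rw [pow_one] at this
    exact this hv
  · intro v hv
    have := D.w1 hab hS hx hz hxz hxa hza 1 2 one_pos two_pos v
    rw [pow_one] at this
    exact this hv
  · intro v hv
    have := D.w1 hab hS hz hx hxz.symm hza hxa 1 1 one_pos one_pos v
    simp only [pow_one] at this
    exact this hv
  · intro v hv
    have := D.w0 hab hS hx hxa 1 one_pos v
    simp only [pow_one] at this
    exact this hv
  · intro v hv
    have := D.w1 hab hS hx hy hxy hxa hya 1 2 one_pos two_pos v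
    rw [pow_one] at this
    exact this hv
  · intro hb
    have h1 := hdec (UU_mono (sup_le (sup_le (le_sup_of_le_left (le_sup_of_le_left le_sup_left)) (le_sup_of_le_left le_sup_right)) le_sup_right) hb)
    convert h1 using 3
    · rw [sup_right_comm]
    · rw [sup_right_comm]

end Sys
end sys

section sys2
variable {A R ι : Type} [CommRing A] [IsDomain A] [CommRing R] [IsDomain R] [Algebra A R] {𝒜 : ℕ → Submodule A R} [GradedAlgebra 𝒜]
  [Fintype ι] [DecidableEq ι]

local notation "κ" => algebraMap A R

namespace Sys
variable {Q : Ideal R} {T : ι → R} {h0 : ι → A} {φ : ι → ι → R →ₐ[A] A} (D : Sys 𝒜 Q T h0 φ)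
include D

omit [IsDomain R] in
lemma wT {a : ι} {S : Set ι} {k : ι} (haS : a ∉ S) (hk : k ∉ S) (hak : a ≠ k) (u : R)
    (hu : T k * u ∈ D.X S) : u ∈ UU Q (D.X S) := by
  rw [← D.Z_some k] at hu ⊢
  have := D.w0 (b := k) hak (S := some '' S) (by simpa using haS) (o := some k) (by simpa using hk) (by simpa using hak.symm) 1 one_pos u
  simp only [pow_one] at this
  exact this hu

omit [IsDomain R] in
lemma wT' [Nontrivial ι] {a : ι} {S : Set ι} (haS : a ∉ S) (N : ℕ) (hN : 0 < N) (u : R)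
    (hu : κ (h0 a) ^ N * u ∈ D.X S) (hu' : T a ^ N * u ∈ D.X S) : u ∈ UU Q (D.X S) := by
  obtain ⟨b, hb⟩ := exists_ne a
  rw [← D.Z_some b] at hu hu' ⊢
  exact D.w'0 hb.symm (by simpa using haS) N hN u hu hu'

omit [IsDomain R] in
lemma P1aux {a x : ι} (hax : a ≠ x) {n : ℕ} (hn : 2 ≤ n) (E : Finset ι) (hE : ∀ j ∈ E, j ≠ a ∧ j ≠ x) {v : R} (hv : v ∈ 𝒜 (n + 1)) :
    v ∈ UU Q (D.X {j | j ≠ a ∧ j ≠ x ∧ j ∉ E} ⊔ Ideal.span {T x}) →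
    v ∈ Ideal.span {T x} ⊔ UU Q (D.X {j | j ≠ a ∧ j ≠ x ∧ j ∉ E}) := by
  induction E using Finset.induction_on with
  | empty =>
    simp only [Finset.notMem_empty, not_false_eq_true, and_true]
    intro h
    exact (D.cut hax).P1base hn hv h
  | insert z E hz ih =>
    intro h
    have e : {j | j ≠ a ∧ j ≠ x ∧ j ∉ E} = insert z {j | j ≠ a ∧ j ≠ x ∧ j ∉ insert z E} := by
      ext j
      have := hE z (by simp)
      by_cases hj : j = z
      · subst hj; simp [hz, this]
      · simp [hj]
    have ih := ih (fun j hj => hE j (by simp [hj]))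
    rw [e, X_insert] at ih
    have hz' := hE z (by simp)
    set S := {j | j ≠ a ∧ j ≠ x ∧ j ∉ insert z E} with hSd
    have hSa : some a ∉ some '' S := by simp [S]
    have hSx : some x ∉ some '' S := by simp [S]
    have hSz : some z ∉ some '' S := by simp [S]
    refine hstep_lemma (z := T z) (D.hAQ (D.hT x)) (D.hAQ (D.hT z)) ?_ ?_ v h ?_
    · intro u hu
      rw [← D.Z_some x] at hu ⊢
      exact D.w1 hax hSa (p := some x) (o := some z) hSx hSz (by simpa using hz'.2.symm) (by simpa using hax.symm) (by simpa using hz'.1)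
        2 2 two_pos two_pos u hu
    · intro u hu
      exact D.wT (a := a) (by simp [S]) (by simp [S]) hax u hu
    · exact ih (UU_mono (sup_le (le_sup_of_le_left le_sup_left) le_sup_right) h)

lemma P1 {a x : ι} (hax : a ≠ x) {n : ℕ} (hn : 2 ≤ n) {v : R} (hv : v ∈ 𝒜 (n + 1))
    (h : v ∈ UU Q (D.X {x})) : v ∈ D.X {x} := by
  have e : {j | j ≠ a ∧ j ≠ x ∧ j ∉ (Finset.univ.erase a).erase x} = ∅ := by
    ext j; simp; tauto
  have := D.P1aux hax hn ((Finset.univ.erase a).erase x) (by simp; tauto) hv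
  rw [e] at this
  have e0 : D.X ∅ = ⊥ := by simp [X]
  have e1 : D.X {x} = Ideal.span {T x} := by simp [X]
  rw [e0, UU_bot D.hQ0, bot_sup_eq, sup_bot_eq] at this
  rw [e1] at h ⊢
  exact this h

omit [IsDomain R] in
lemma P2 {a : ι} (m : ℕ) : ∀ (S : Set ι) (x z : ι), ({j | j ≠ a ∧ j ≠ x ∧ j ≠ z ∧ j ∉ S}).ncard = m →
    a ≠ x → a ≠ z → a ∉ S → x ∉ S → z ∉ S → x ≠ z → ∀ n, 3 ≤ n → ∀ u ∈ 𝒜 n,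
    u ∈ UU Q (D.X (insert x (insert z S))) → u ∈ UU Q (D.X (insert x S)) ⊔ UU Q (D.X (insert z S)) := by
  have ei : ∀ (b j : ι) (S : Set ι), D.X (insert j S) = D.Z b (insert (some j) (some '' S)) := by
    intro b j S; rw [← Set.image_insert_eq, Z_some]
  induction m with
  | zero =>
    intro S x z hm hax haz haS hxS hzS hxz n hn u hu h
    rw [Set.ncard_eq_zero, Set.eq_empty_iff_forall_notMem] at hm
    have hXe : D.X {j | j ≠ a ∧ j ≠ x} ⊔ Ideal.span {T x} = D.X (insert x (insert z S)) := by
      rw [← X_insert]; congr 1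
      ext j
      have := hm j
      simp at this ⊢
      by_cases h1 : j = x
      · simp [h1]
      · by_cases h2 : j = z
        · simp [h2, haz.symm, hxz.symm]
        · by_cases h3 : j = a
          · simp [h3, hax, haz, haS]
          · simp [h1, h2, h3, this h3 h1 h2]
    have hu1 := h (κ (h0 x)) (D.hh x)
    have hu2 : κ (h0 x) * u ∈ D.X S ⊔ Ideal.span {T x} ⊔ Ideal.span {T z} := by
      rw [X_insert, X_insert] at hu1; rwa [sup_right_comm]
    obtain ⟨k, rfl⟩ : ∃ k, n = k + 1 := ⟨n - 1, by omega⟩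
    obtain ⟨α, hα, β, hβ, he⟩ := hom_coef2 𝒜 (D.Xhom S) (D.hT x) (D.hT z) (n := k) (m := k) (Cut1.algmul _ hu) (by omega) (by omega) hu2
    have := D.step hax (S := some '' S) (by simpa using haS) (x := some x) (z := some z) (y := none)
      (by simpa using hxS) (by simpa using hzS) (by simp) (by simpa using hxz) (by simp) (by simp) (by simpa using hax.symm)
      (by simpa using haz.symm) (by simp) u α β (by rwa [← Set.image_insert_eq, ← Set.image_insert_eq, Z_some]) (by rw [Z_some]; exact he) ?_
    · rwa [← ei, ← ei] at this
    · intro hb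
      rw [Z_insert, ← Set.image_insert_eq, ← Set.image_insert_eq, Z_some, ← hXe] at hb
      rw [← Set.image_insert_eq, ← Set.image_insert_eq, Z_some, ← hXe]
      have hle := (D.cut hax).P2base (n := k) (by omega) hβ hb
      refine (sup_le_sup_left ?_ _ : _ ⊔ Ideal.span {κ (h0 x)} ≤ _) hle
      rw [Z_insert]
      exact le_trans le_sup_right (le_UU _ _)
  | succ m ih =>
    intro S x z hm hax haz haS hxS hzS hxz n hn u hu h
    have hne : ({j | j ≠ a ∧ j ≠ x ∧ j ≠ z ∧ j ∉ S}).Nonempty := by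
      rw [← Set.ncard_pos]; omega
    obtain ⟨y, hya, hyx, hyz, hyS⟩ := hne
    have hu1 := h (T y) (D.hAQ (D.hT y))
    have hu2 : T y * u ∈ D.X S ⊔ Ideal.span {T x} ⊔ Ideal.span {T z} := by
      rw [X_insert, X_insert] at hu1; rwa [sup_right_comm]
    obtain ⟨α, hα, β, hβ, he⟩ := hom_coef2 𝒜 (D.Xhom S) (D.hT x) (D.hT z) (n := n) (m := n) (k := n + 1)
      (Cut1.mulmem (D.hT y) hu) (by omega) (by omega) hu2
    have := D.step hax (S := some '' S) (by simpa using haS) (x := some x) (z := some z) (y := some y)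
      (by simpa using hxS) (by simpa using hzS) (by simpa using hyS) (by simpa using hxz) (by simpa using hyx.symm) (by simpa using hyz.symm) (by simpa using hax.symm)
      (by simpa using haz.symm) (by simpa using hya) u α β (by rwa [← Set.image_insert_eq, ← Set.image_insert_eq, Z_some]) (by rw [Z_some]; exact he) ?_
    · rwa [← ei, ← ei] at this
    · intro hb
      simp only [← Set.image_insert_eq, Z_some] at hb ⊢
      rw [sup_comm]
      refine ih (insert z S) y x ?_ hya.symm hax (by simp [haz, haS]) (by simp [hyz, hyS]) (by simp [hxz, hxS]) hyx n hn β hβ hb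
      have e : {j | j ≠ a ∧ j ≠ x ∧ j ≠ z ∧ j ∉ S} = insert y {j | j ≠ a ∧ j ≠ y ∧ j ≠ x ∧ j ∉ insert z S} := by
        ext j
        by_cases hj : j = y
        · subst hj; simp [hya, hyx, hyz, hyS]
        · simp [hj]
      rw [e, Set.ncard_insert_of_notMem (by simp)] at hm
      omega

lemma P2' {a : ι} (S : Finset ι) (haS : a ∉ S) {n : ℕ} (hn : 3 ≤ n) {u : R} (hu : u ∈ 𝒜 n)
    (h : u ∈ UU Q (D.X S)) : u ∈ D.X S := by
  induction hc : S.card using Nat.strong_induction_on generalizing S u with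
  | _ c ih =>
    rcases S.eq_empty_or_nonempty with rfl | ⟨x, hx⟩
    · have e0 : D.X ((∅ : Finset ι) : Set ι) = ⊥ := by simp [X]
      rw [e0, UU_bot D.hQ0] at h; rwa [e0]
    have hax : a ≠ x := by rintro rfl; exact haS hx
    rcases (S.erase x).eq_empty_or_nonempty with hS | ⟨z, hz⟩
    · obtain rfl : S = {x} := by
        rw [← Finset.insert_erase hx, hS]; rfl
      obtain ⟨k, rfl⟩ : ∃ k, n = k + 1 := ⟨n - 1, by omega⟩
      rw [Finset.coe_singleton] at h ⊢
      exact D.P1 hax (by omega) hu h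
    · obtain ⟨hzx, hzS⟩ := Finset.mem_erase.1 hz
      have haz : a ≠ z := by rintro rfl; exact haS hzS
      set S0 := (S.erase x).erase z with hS0
      have e : S = insert x (insert z S0) := by
        rw [hS0, Finset.insert_erase hz, Finset.insert_erase hx]
      have h1 : x ∉ S0 := by simp [S0]
      have h2 : z ∉ S0 := by simp [S0]
      have haS0 : a ∉ S0 := by simp [S0, haS]
      have := D.P2 (a := a) _ (S0 : Set ι) x z rfl hax haz (by simpa using haS0) (by simpa using h1) (by simpa using h2) hzx.symm n hn u hu
        (by rw [e] at h; simpa using h)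
      obtain ⟨u1, hu1, hu1', u2, hu2, hu2', rfl⟩ := hom_sup 𝒜 (isHomogeneous_UU 𝒜 D.hQ (D.Xhom _)) (isHomogeneous_UU 𝒜 D.hQ (D.Xhom _)) hu this
      have c1 : (insert x S0).card < c := by
        rw [← hc, e, Finset.card_insert_of_notMem h1, Finset.card_insert_of_notMem (by simp [h1, hzx.symm]), Finset.card_insert_of_notMem h2]; omega
      have c2 : (insert z S0).card < c := by
        rw [← hc, e, Finset.card_insert_of_notMem h2, Finset.card_insert_of_notMem (by simp [h1, hzx.symm]), Finset.card_insert_of_notMem h2]; omega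
      have r1 := ih _ c1 (insert x S0) (by simp [hax, haS0]) hu1 (by simpa using hu1') rfl
      have r2 := ih _ c2 (insert z S0) (by simp [haz, haS0]) hu2 (by simpa using hu2') rfl
      refine add_mem (Ideal.span_mono (Set.image_mono ?_) r1) (Ideal.span_mono (Set.image_mono ?_) r2)
      · rw [e]; intro j; simp; tauto
      · rw [e]; intro j; simp; tauto

lemma P3 [Nontrivial ι] {n : ℕ} (hn : 3 ≤ n) {w : R} (hw : w ∈ 𝒜 n) : w ∈ D.X Set.univ := by
  obtain ⟨a, b, hab⟩ := exists_pair_ne ι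
  obtain ⟨m, hm, c, hc⟩ := (D.cut hab).C1 hn ⟨w, hw, rfl⟩
  have hc : φ a b w = _ := hc
  have hm' : T a * m ∈ 𝒜 n := Cut1.mulmem (D.hT a) hm
  have h1 := (D.cut hab).K2 (n := n) (b := 1) (β := c) (sub_mem hw hm') (by omega) (by omega)
    (by rw [map_sub, map_mul, D.φ1 a b hab, hc]; ring)
  have e : D.X {j | j ≠ a ∧ j ≠ b} ⊔ Ideal.span {T b ^ 1} = D.X ((Finset.univ.erase a : Finset ι) : Set ι) := by
    rw [pow_one, ← X_insert]; congr 1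
    ext j; by_cases hj : j = b
    · simp [hj, hab.symm]
    · simp [hj]
  rw [e] at h1
  have h2 := D.P2' (a := a) _ (by simp) hn (sub_mem hw hm') h1
  have h3 : T a * m ∈ D.X Set.univ := Ideal.mul_mem_right _ _ (Ideal.subset_span ⟨a, trivial, rfl⟩)
  have h4 := add_mem (Ideal.span_mono (Set.image_mono (Set.subset_univ _)) h2) h3
  rwa [sub_add_cancel] at h4

end Sys
end sys2

section nsys
variable {A R S ι : Type} [CommRing A] [IsDomain A] [IsLocalRing A] [CommRing R] [IsDomain R] [Algebra A R]
  {𝒜 : ℕ → Submodule A R} [GradedAlgebra 𝒜]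
  [CommRing S] [IsDomain S] [Algebra A S]
  [Fintype ι] [DecidableEq ι]

local notation "κ" => algebraMap A R

/-- combinations `∑ t i * s i` -/
def TL (t : ι → S) (E : Finset ι) (N : Submodule A S) : Submodule A S where
  carrier := {x | ∃ s : ι → S, (∀ i, s i ∈ N) ∧ x = ∑ i ∈ E, t i * s i}
  zero_mem' := ⟨0, fun _ => zero_mem N, by simp⟩
  add_mem' := by
    rintro _ _ ⟨s, hs, rfl⟩ ⟨s', hs', rfl⟩
    exact ⟨s + s', fun i => add_mem (hs i) (hs' i), by simp [mul_add, Finset.sum_add_distrib]⟩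
  smul_mem' := by
    rintro c _ ⟨s, hs, rfl⟩
    exact ⟨c • s, fun i => N.smul_mem c (hs i), by simp [Finset.smul_sum]⟩

omit [IsDomain A] [IsLocalRing A] [IsDomain S] [Fintype ι] [DecidableEq ι] in
lemma mem_TL {t : ι → S} {E : Finset ι} {N : Submodule A S} {x : S} :
    x ∈ TL t E N ↔ ∃ s : ι → S, (∀ i, s i ∈ N) ∧ x = ∑ i ∈ E, t i * s i := Iff.rfl

omit [IsDomain A] [IsLocalRing A] [IsDomain S] [Fintype ι] [DecidableEq ι] in
lemma TL_mono (t : ι → S) (E : Finset ι) {N N' : Submodule A S} (h : N ≤ N') : TL t E N ≤ TL t E N' := by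
  rintro _ ⟨s, hs, rfl⟩; exact ⟨s, fun i => h (hs i), rfl⟩

omit [IsDomain A] [IsLocalRing A] [IsDomain S] [Fintype ι] in
lemma mul_mem_TL {t : ι → S} {E : Finset ι} {N : Submodule A S} {i : ι} (hi : i ∈ E) {x : S} (hx : x ∈ N) :
    t i * x ∈ TL t E N := by
  refine ⟨Pi.single i x, ?_, ?_⟩
  · intro l
    by_cases h : l = i
    · subst h; simpa using hx
    · simp [h]
  · rw [Finset.sum_eq_single i]
    · simp
    · intro l _ h; simp [h]
    · exact fun h => absurd hi h

omit [IsDomain A] [IsLocalRing A] [IsDomain S] [Fintype ι] [DecidableEq ι] in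
lemma TL_subset (t : ι → S) {E E' : Finset ι} (h : E ⊆ E') (N : Submodule A S) : TL t E N ≤ TL t E' N := by
  classical
  rintro _ ⟨s, hs, rfl⟩
  exact sum_mem fun i hi => mul_mem_TL (h hi) (hs i)

/-- the further data -/
structure NSys (Q : Ideal R) (T : ι → R) (h : ι → A) (j : R →ₐ[A] S) (φ : ι → ι → S →ₐ[A] A) (F N : Submodule A S) (p q : A) : Prop where
  D : Sys 𝒜 Q T h (fun a b => (φ a b).comp j)
  hj : Function.Injective j
  hAS : Function.Injective (algebraMap A S)
  hNF : N ≤ F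
  hMN : (𝒜 1).map j.toLinearMap ≤ N
  hpq : Ideal.span {p, q} = maximalIdeal A
  hp : p ≠ 0
  dep : DepthTwo A
  hmQ : ∀ t ∈ maximalIdeal A, κ t ∈ Q
  CrF : ∀ w ∈ F, ∀ b, h b • w = ∑ i ∈ Finset.univ.erase b, φ i b w • j (T i)
  hN1 : ∀ x ∈ N, ∀ t ∈ maximalIdeal A, ∃ y ∈ 𝒜 1, j y = t • x
  hN2 : ∀ x ∈ N, ∀ t ∈ 𝒜 1, ∃ y ∈ 𝒜 2, j y = j t * x
  indep : ∀ c : ι → A, ∑ i, c i • j (T i) ∈ maximalIdeal A • N → ∀ i, c i ∈ maximalIdeal A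
  Inj : ∀ s : ι → S, (∀ i, s i ∈ F) → ∑ i, j (T i) * s i ∈ (𝒜 2).map j.toLinearMap → ∀ i, s i ∈ N
  divF : ∀ s s', s ∈ F → s' ∈ F → q • s = p • s' → ∃ w ∈ F, s = p • w ∧ s' = q • w

namespace NSys
variable {Q : Ideal R} {T : ι → R} {h : ι → A} {j : R →ₐ[A] S} {φ : ι → ι → S →ₐ[A] A} {F N : Submodule A S} {p q : A}
  (H : NSys (𝒜 := 𝒜) Q T h j φ F N p q)
include H

/-- graded pieces of `B` -/
def B (_H : NSys (𝒜 := 𝒜) Q T h j φ F N p q) (n : ℕ) : Submodule A S := if n = 1 then N else (𝒜 n).map j.toLinearMap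

lemma B1 : H.B 1 = N := by simp [B]
lemma B0 : H.B 0 = (𝒜 0).map j.toLinearMap := by simp [B]
lemma Bn {n : ℕ} (hn : 2 ≤ n) : H.B n = (𝒜 n).map j.toLinearMap := by simp [B]; omega
lemma Ble (n : ℕ) : (𝒜 n).map j.toLinearMap ≤ H.B n := by
  by_cases hn : n = 1
  · subst hn; rw [H.B1]; exact H.hMN
  · simp [B, hn]

lemma smul_cancel {a : A} (ha : a ≠ 0) {x y : S} (h : a • x = a • y) : x = y := by
  rw [Algebra.smul_def, Algebra.smul_def] at h
  exact mul_left_cancel₀ (by simpa using (map_ne_zero_iff _ H.hAS).2 ha) h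

/-- t -/
local notation "jT" => fun i => j (T i)

lemma XtoTL {E : Finset ι} {n : ℕ} {r : R} (hr : r ∈ 𝒜 (n + 1)) (hX : r ∈ H.D.X (E : Set ι)) :
    j r ∈ TL jT E ((𝒜 n).map j.toLinearMap) := by
  unfold Sys.X at hX
  obtain ⟨c, hc⟩ : ∃ c : ι → R, ∑ i ∈ E, c i • T i = r := by
    obtain ⟨c, hc⟩ := (Submodule.mem_span_image_finset_iff_exists_fun R).1 hX
    refine ⟨fun i => if h : i ∈ E then c ⟨i, h⟩ else 0, ?_⟩
    rw [← hc, ← Finset.sum_coe_sort]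
    exact Finset.sum_congr rfl fun i _ => by simp
  refine ⟨fun i => j (pr 𝒜 n (c i)), fun i => ⟨_, pr_mem 𝒜 n _, rfl⟩, ?_⟩
  have h1 : r = ∑ i ∈ E, T i * pr 𝒜 n (c i) := by
    rw [← pr_same 𝒜 hr, ← hc]
    have : ∀ (G : Finset ι), pr 𝒜 (n + 1) (∑ i ∈ G, c i • T i) = ∑ i ∈ G, T i * pr 𝒜 n (c i) := by
      intro G
      induction G using Finset.induction_on with
      | empty => simp [pr]
      | insert a G ha ih =>
        rw [Finset.sum_insert ha, Finset.sum_insert ha, pr_add, ih, smul_eq_mul, mul_comm (c a), add_comm n 1,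
          pr_mul 𝒜 (H.D.hT a)]
    exact this E
  rw [h1]; simp

lemma TLtoX {E : Finset ι} {n : ℕ} {r : R} (hX : j r ∈ TL jT E ((𝒜 n).map j.toLinearMap)) :
    r ∈ H.D.X (E : Set ι) := by
  obtain ⟨s, hs, he⟩ := hX
  choose c hc hc' using hs
  have hc' : ∀ i, j (c i) = s i := hc'
  have : r = ∑ i ∈ E, T i * c i := H.hj (by simp [he, hc'])
  rw [this]
  exact sum_mem fun i hi => Ideal.mul_mem_right _ _ (Ideal.subset_span ⟨i, hi, rfl⟩)

lemma hX_all {k : ι} {E : Finset ι} (hE : ∀ i, i ∉ E → i = k) {w : R} {n : ℕ} (hw : w ∈ 𝒜 (n + 1)) :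
    κ (h k) * w ∈ H.D.X (E : Set ι) := by
  rw [H.D.gen n] at hw
  refine Submodule.mul_induction_on hw ?_ ?_
  · intro x hx y _
    rw [← mul_assoc, H.D.Cr x hx k, Finset.sum_mul]
    refine sum_mem fun i hi => ?_
    refine Ideal.mul_mem_right _ _ (Ideal.mul_mem_left _ _ (Ideal.subset_span ⟨i, ?_, rfl⟩))
    by_contra hi'
    exact (Finset.mem_erase.1 hi).1 (hE i (by simpa using hi'))
  · intro x y hx hy
    rw [mul_add]; exact add_mem hx hy

lemma toUU [Nontrivial ι] {k : ι} {E : Finset ι} (hk : k ∉ E) {w : R} {n : ℕ} (hw : w ∈ 𝒜 (n + 1)) (hX : T k * w ∈ H.D.X (E : Set ι)) :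
    w ∈ UU Q (H.D.X (E : Set ι)) := by
  by_cases hE : ∀ i, i ∉ E → i = k
  · exact H.D.wT' (a := k) (by simpa using hk) 1 one_pos w (by simpa using H.hX_all hE hw) (by simpa using hX)
  · push Not at hE
    obtain ⟨a, ha, hak⟩ := hE
    exact H.D.wT (a := a) (by simpa using ha) (by simpa using hk) hak w hX

lemma mN_le {e : A} (ht : e ∈ maximalIdeal A) {x : S} (hx : x ∈ N) : e • x ∈ (𝒜 1).map j.toLinearMap := by
  obtain ⟨y, hy, he⟩ := H.hN1 x hx e ht
  exact ⟨y, hy, he⟩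

/-- `Ch1` -/
lemma Ch1 [Nontrivial ι] {k : ι} {E : Finset ι} (hk : k ∉ E) {y : S} (hy : y ∈ N) (hyE : j (T k) * y ∈ TL jT E N) :
    ∃ c : ι → A, y = ∑ i ∈ E, c i • j (T i) := by
  obtain ⟨n, hn, he⟩ := hyE
  have key : ∀ s ∈ maximalIdeal A, ∀ s' ∈ maximalIdeal A, ∃ c : ι → A, (s' * s) • y = ∑ i ∈ E, c i • j (T i) := by
    intro s hs s' hs'
    obtain ⟨ys, hys, hys'⟩ := H.hN1 y hy s hs
    have h1 : T k * ys ∈ H.D.X (E : Set ι) := by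
      refine H.TLtoX (n := 1) ⟨fun i => s • n i, fun i => H.mN_le hs (hn i), ?_⟩
      rw [map_mul, hys', mul_smul_comm, he, Finset.smul_sum]
      simp
    have h2 := H.toUU hk (n := 0) hys h1 (κ s') (H.hmQ s' hs')
    obtain ⟨c, hc, hc'⟩ := H.XtoTL (n := 0) (Cut1.algmul _ hys) h2
    have : ∀ i, ∃ a : A, c i = algebraMap A S a := by
      intro i
      obtain ⟨r, hr, hr'⟩ := hc i
      obtain ⟨a, rfl⟩ := H.D.zero r hr
      exact ⟨a, by rw [← hr']; simp⟩
    choose a ha using this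
    refine ⟨a, ?_⟩
    rw [map_mul, hys', AlgHom.commutes, ← Algebra.smul_def, smul_smul] at hc'
    rw [hc']
    exact Finset.sum_congr rfl fun i _ => by rw [ha i, mul_comm, Algebra.smul_def]
  have hφ : ∀ i ∈ Finset.univ.erase k, ∀ c : ι → A, φ i k (∑ l ∈ E, c l • j (T l)) = if i ∈ E then c i * h k else 0 := by
    intro i hi c
    have hik := (Finset.mem_erase.1 hi).1
    rw [map_sum]
    have : ∀ l ∈ E, φ i k (c l • j (T l)) = if l = i then c i * h k else 0 := by
      intro l hl
      have hlk : l ≠ k := by rintro rfl; exact hk hl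
      rw [map_smul]
      split_ifs with hli
      · subst hli
        have := H.D.φ1 l k hik
        simp at this; rw [this]; rfl
      · have := H.D.φ3 i k l hli hlk
        simp at this; rw [this]; simp
    rw [Finset.sum_congr rfl this, Finset.sum_ite_eq']
  have hdiv : ∀ i ∈ Finset.univ.erase k, ∃ c : A, φ i k y = c * h k ∧ (i ∉ E → c = 0) := by
    intro i hi
    by_cases hiE : i ∈ E
    · have : h k ∣ φ i k y := by
        refine H.dep _ _ (H.D.hne k) fun s hs => H.dep _ _ (H.D.hne k) fun s' hs' => ?_
        obtain ⟨c, hc⟩ := key s hs s' hs'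
        have := congrArg (φ i k) hc
        rw [hφ i hi c, map_smul, if_pos hiE, smul_eq_mul] at this
        exact ⟨c i, by linear_combination this⟩
      obtain ⟨c, hc⟩ := this
      exact ⟨c, by rw [hc, mul_comm], fun h => absurd hiE h⟩
    · refine ⟨0, ?_, fun _ => rfl⟩
      have hpm : p ∈ maximalIdeal A := H.hpq ▸ Ideal.subset_span (by simp)
      obtain ⟨c, hc⟩ := key p hpm p hpm
      have := congrArg (φ i k) hc
      rw [hφ i hi c, map_smul, if_neg hiE, smul_eq_mul] at this
      rw [zero_mul]
      exact (mul_eq_zero.1 this).resolve_left (mul_ne_zero H.hp H.hp)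
  have : ∀ i, ∃ c : A, i ≠ k → (φ i k y = c * h k ∧ (i ∉ E → c = 0)) := by
    intro i
    by_cases hik : i = k
    · exact ⟨0, fun h => absurd hik h⟩
    · obtain ⟨c, hc⟩ := hdiv i (by simp [hik])
      exact ⟨c, fun _ => hc⟩
  choose c hc using this
  refine ⟨c, H.smul_cancel (H.D.hne k) ?_⟩
  rw [H.CrF y (H.hNF hy) k, Finset.smul_sum]
  have hsub : E ⊆ Finset.univ.erase k := by
    intro i hi; simp; rintro rfl; exact hk hi
  rw [Finset.sum_subset hsub (f := fun i => h k • c i • j (T i))]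
  · refine Finset.sum_congr rfl fun i hi => ?_
    rw [(hc i (Finset.mem_erase.1 hi).1).1, smul_smul, mul_comm]
  · intro i hi hiE
    simp [(hc i (Finset.mem_erase.1 hi).1).2 hiE]

/-- Peel -/
lemma Peel [Nontrivial ι] (E : Finset ι) : ∀ w : S, p • w ∈ TL jT E N → q • w ∈ TL jT E N → w ∈ TL jT E F := by
  induction E using Finset.induction_on with
  | empty =>
    intro w h1 _
    obtain ⟨s, _, h2⟩ := h1
    have : w = 0 := H.smul_cancel H.hp (by simpa using h2)
    rw [this]; exact zero_mem _
  | insert k E hk ih =>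
    rintro w ⟨α, hα, hpw⟩ ⟨β, hβ, hqw⟩
    rw [Finset.sum_insert hk] at hpw hqw
    have hpm : p ∈ maximalIdeal A := H.hpq ▸ Ideal.subset_span (by simp)
    have hqm : q ∈ maximalIdeal A := H.hpq ▸ Ideal.subset_span (by simp)
    have h0 : q • p • w = p • q • w := smul_comm _ _ _
    rw [hpw, hqw] at h0
    have h1 : j (T k) * (q • α k - p • β k) ∈ TL jT E N := by
      refine ⟨fun i => p • β i - q • α i, fun i => sub_mem (N.smul_mem _ (hβ i)) (N.smul_mem _ (hα i)), ?_⟩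
      simp only [smul_add, Finset.smul_sum] at h0
      simp only [mul_sub, mul_smul_comm, Finset.sum_sub_distrib]
      linear_combination h0
    obtain ⟨c, hc⟩ := H.Ch1 hk (sub_mem (N.smul_mem q (hα k)) (N.smul_mem p (hβ k))) h1
    have hcm : ∀ i ∈ E, c i ∈ maximalIdeal A := by
      intro i hi
      have := H.indep (fun i => if i ∈ E then c i else 0) (by
        have e : ∑ i, (if i ∈ E then c i else 0) • j (T i) = q • α k - p • β k := by
          rw [hc]; simp [ite_smul, Finset.sum_ite_mem]
        rw [e]
        exact sub_mem (Submodule.smul_mem_smul hqm (hα k)) (Submodule.smul_mem_smul hpm (hβ k))) i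
      simpa [hi] using this
    have : ∀ i, ∃ a b : A, i ∈ E → c i = q * a - p * b := by
      intro i
      by_cases hi : i ∈ E
      · have := hcm i hi
        rw [← H.hpq] at this
        obtain ⟨x, y, hxy⟩ := Ideal.mem_span_pair.1 this
        exact ⟨y, -x, fun _ => by rw [← hxy]; ring⟩
      · exact ⟨0, 0, fun h => absurd h hi⟩
    choose a b hab using this
    have hTN : ∀ i, j (T i) ∈ N := fun i => H.hMN ⟨T i, H.D.hT i, rfl⟩
    have h2 : q • (α k - ∑ i ∈ E, a i • j (T i)) = p • (β k - ∑ i ∈ E, b i • j (T i)) := by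
      have h3 : ∑ i ∈ E, c i • j (T i) = q • ∑ i ∈ E, a i • j (T i) - p • ∑ i ∈ E, b i • j (T i) := by
        rw [Finset.smul_sum, Finset.smul_sum, ← Finset.sum_sub_distrib]
        refine Finset.sum_congr rfl fun i hi => ?_
        rw [hab i hi, sub_smul, mul_smul, mul_smul]
      rw [h3] at hc
      rw [smul_sub, smul_sub]
      linear_combination hc
    obtain ⟨s, hs, hs1, hs2⟩ := H.divF _ _
      (H.hNF (sub_mem (hα k) (sum_mem fun i _ => N.smul_mem _ (hTN i))))
      (H.hNF (sub_mem (hβ k) (sum_mem fun i _ => N.smul_mem _ (hTN i)))) h2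
    have hsw : ∀ (a : ι → A) (i : ι), j (T k) * (a i • j (T i)) = j (T i) * (a i • j (T k)) := by
      intro a i; rw [mul_smul_comm, mul_smul_comm, mul_comm]
    have h4 : w - j (T k) * s ∈ TL jT E F := by
      refine ih _ ⟨fun i => α i + a i • j (T k), fun i => add_mem (hα i) (N.smul_mem _ (hTN k)), ?_⟩
        ⟨fun i => β i + b i • j (T k), fun i => add_mem (hβ i) (N.smul_mem _ (hTN k)), ?_⟩
      · rw [smul_sub, hpw, ← mul_smul_comm, ← hs1]
        simp only [mul_add, Finset.sum_add_distrib, mul_sub, Finset.mul_sum]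
        rw [Finset.sum_congr rfl fun i _ => hsw a i]
        ring
      · rw [smul_sub, hqw, ← mul_smul_comm, ← hs2]
        simp only [mul_add, Finset.sum_add_distrib, mul_sub, Finset.mul_sum]
        rw [Finset.sum_congr rfl fun i _ => hsw b i]
        ring
    have := add_mem (TL_subset _ (Finset.subset_insert k E) _ h4) (mul_mem_TL (t := jT) (Finset.mem_insert_self k E) hs)
    simpa using this

lemma TLN {E : Finset ι} {w : S} (hw : w ∈ (𝒜 2).map j.toLinearMap) (h : w ∈ TL jT E F) : w ∈ TL jT E N := by
  obtain ⟨s, hs, he⟩ := h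
  have h1 := H.Inj (fun i => if i ∈ E then s i else 0) (fun i => by
    split_ifs; exacts [hs i, zero_mem _]) (by
      have : ∑ i, j (T i) * (if i ∈ E then s i else 0) = w := by
        rw [he]; simp [mul_ite, Finset.sum_ite_mem]
      rw [this]; exact hw)
  rw [he]
  refine sum_mem fun i hi => mul_mem_TL (t := jT) hi ?_
  simpa [hi] using h1 i

lemma P4 [Nontrivial ι] {E : Finset ι} {w : R} (hw : w ∈ 𝒜 2) (h : w ∈ UU Q (H.D.X (E : Set ι))) : j w ∈ TL jT E N := by
  have key : ∀ s ∈ maximalIdeal A, s • j w ∈ TL jT E N := by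
    intro s hs
    have h1 := H.XtoTL (n := 1) (Cut1.algmul s hw) (h (κ s) (H.hmQ s hs))
    rw [map_mul, AlgHom.commutes, ← Algebra.smul_def] at h1
    exact TL_mono _ _ H.hMN h1
  exact H.TLN ⟨w, hw, rfl⟩ (H.Peel E _ (key p (H.hpq ▸ Ideal.subset_span (by simp))) (key q (H.hpq ▸ Ideal.subset_span (by simp))))

lemma P5 [Nontrivial ι] {w : R} (hw : w ∈ 𝒜 2) : j w ∈ TL jT Finset.univ N := by
  obtain ⟨a, b, hab⟩ := exists_pair_ne ι
  have C := H.D.cut hab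
  have hI : φ a b (j w) ∈ C.I' 2 := ⟨w, hw, rfl⟩
  obtain ⟨u, hu, he⟩ := C.I'_mono (show 1 ≤ 2 by omega) hI
  have he : φ a b (j u) = φ a b (j w) := he
  have hu3 := C.L3 (a := 1) (b := 1) hu (by simpa [he] using hI) (by omega) (by omega) (by omega) (by omega)
  have key : ∀ y ∈ maximalIdeal A, y • j w ∈ TL jT Finset.univ N := by
    intro y hy
    obtain ⟨m, hm, c, hc, h4⟩ := hom_coef2 𝒜 C.hJ (Cut1.algpow0 (h b) 1) (Cut1.powmem C.hTb 1) (k := 1) (n := 1) (m := 0)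
      (Cut1.algmul y hu) (by omega) (by omega) (hu3 (κ y) (H.hmQ y hy))
    have h5 := C.φJ _ h4
    have e1 := H.D.φ1 a b hab
    have e2 := H.D.φ2 a b hab
    simp at e1 e2
    simp [e2, he] at h5
    have h6 : κ y * w - T a * m ∈ UU Q (H.D.X {j | j ≠ a ∧ j ≠ b} ⊔ Ideal.span {T b ^ 1}) := by
      refine C.K2 (n := 2) (β := φ a b (j c)) (sub_mem (Cut1.algmul y hw) (Cut1.mulmem (H.D.hT a) hm)) one_pos (by omega) ?_
      simp [e1]
      linear_combination h5
    have e : H.D.X {j | j ≠ a ∧ j ≠ b} ⊔ Ideal.span {T b ^ 1} = H.D.X ((Finset.univ.erase a : Finset ι) : Set ι) := by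
      rw [pow_one, ← H.D.X_insert]; congr 1
      ext j; by_cases hj : j = b
      · simp [hj, hab.symm]
      · simp [hj]
    rw [e] at h6
    have h7 := TL_subset _ (Finset.subset_univ _) _ (H.P4 (sub_mem (Cut1.algmul y hw) (Cut1.mulmem (H.D.hT a) hm)) h6)
    have h8 := mul_mem_TL (t := jT) (Finset.mem_univ a) (H.hMN ⟨m, hm, rfl⟩)
    have h9 := add_mem h7 h8
    simp at h9
    rwa [← Algebra.smul_def] at h9
  exact H.TLN ⟨w, hw, rfl⟩ (H.Peel _ _ (key p (H.hpq ▸ Ideal.subset_span (by simp))) (key q (H.hpq ▸ Ideal.subset_span (by simp))))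

/-- Ch -/
lemma Ch [Nontrivial ι] {k : ι} {E : Finset ι} (hk : k ∉ E) (n : ℕ) {w : S} (hw : w ∈ H.B (n + 1))
    (hwE : j (T k) * w ∈ TL jT E (H.B (n + 1))) : w ∈ TL jT E (H.B n) := by
  rcases Nat.eq_zero_or_pos n with rfl | hn
  · rw [zero_add, H.B1] at hw hwE
    obtain ⟨c, rfl⟩ := H.Ch1 hk hw hwE
    refine sum_mem fun i hi => ?_
    rw [Algebra.smul_def, mul_comm]
    exact mul_mem_TL (t := jT) hi (H.Ble 0 ⟨κ (c i), Cut1.alg0 _, by simp⟩)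
  · rw [H.Bn (by omega)] at hw hwE
    obtain ⟨r, hr, rfl⟩ := hw
    have h1 := H.toUU hk hr (H.TLtoX (r := T k * r) (n := n + 1) (by rw [map_mul]; exact hwE))
    rcases Nat.lt_or_ge n 2 with h2 | h2
    · obtain rfl : n = 1 := by omega
      rw [H.B1]
      exact H.P4 hr h1
    · rw [H.Bn h2]
      exact H.XtoTL hr (H.D.P2' (a := k) E hk (by omega) hr h1)

lemma Bgen [Nontrivial ι] (n : ℕ) : H.B (n + 2) ≤ TL jT Finset.univ (H.B (n + 1)) := by
  rw [H.Bn (by omega)]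
  rintro _ ⟨r, hr, rfl⟩
  rcases Nat.eq_zero_or_pos n with rfl | hn
  · rw [zero_add, H.B1]; exact H.P5 hr
  · rw [H.Bn (by omega)]
    have := H.D.P3 (show 3 ≤ n + 2 by omega) hr
    exact H.XtoTL hr (by simpa using this)

lemma MB (n : ℕ) {x : R} (hx : x ∈ 𝒜 1) {b : S} (hb : b ∈ H.B n) : j x * b ∈ H.B (n + 1) := by
  by_cases hn : n = 1
  · subst hn
    rw [H.B1] at hb
    obtain ⟨y, hy, he⟩ := H.hN2 b hb x hx
    exact H.Ble 2 ⟨y, hy, he⟩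
  · have : H.B n = (𝒜 n).map j.toLinearMap := by simp [B, hn]
    rw [this] at hb
    obtain ⟨r, hr, rfl⟩ := hb
    exact H.Ble _ ⟨x * r, Cut1.mulmem hx hr, by simp⟩

/-- E -/
lemma EE [Nontrivial ι] {d : ℕ} (o : Fin d ≃ ι) (n : ℕ) : ∀ (m k : ℕ), k + m = d →
    ∀ x ∈ maximalIdeal A • H.B (n + 1), x ∈ TL jT (Finset.univ.filter fun i => (o.symm i : ℕ) < k) (H.B n) →
      x ∈ TL jT (Finset.univ.filter fun i => (o.symm i : ℕ) < k) (maximalIdeal A • H.B n) := by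
  induction n with
  | zero =>
    rintro m k hkm x hx ⟨s, hs, he⟩
    set E := (Finset.univ.filter fun i => (o.symm i : ℕ) < k) with hE
    have : ∀ i, ∃ a : A, s i = algebraMap A S a := by
      intro i
      obtain ⟨r, hr, hr'⟩ := H.B0 ▸ hs i
      obtain ⟨a, rfl⟩ := H.D.zero r hr
      exact ⟨a, by rw [← hr']; simp⟩
    choose a ha using this
    have h1 := H.indep (fun i => if i ∈ E then a i else 0) (by
      have e : ∑ i, (if i ∈ E then a i else 0) • j (T i) = x := by
        rw [he]; simp only [ite_smul, zero_smul, Finset.sum_ite_mem, Finset.univ_inter]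
        exact Finset.sum_congr rfl fun i _ => by rw [ha i, mul_comm, Algebra.smul_def]
      rw [e]; rwa [zero_add, H.B1] at hx)
    rw [he]
    refine sum_mem fun i hi => mul_mem_TL (t := jT) hi ?_
    have h2 := h1 i
    simp only [if_pos hi] at h2
    rw [ha i, Algebra.algebraMap_eq_smul_one]
    exact Submodule.smul_mem_smul h2 (H.Ble 0 ⟨1, by simpa using Cut1.alg0 (𝒜 := 𝒜) (1 : A), by simp⟩)
  | succ n ihn =>
    intro m
    induction m with
    | zero =>
      intro k hk x hx _
      have e : (Finset.univ.filter fun i => (o.symm i : ℕ) < k) = Finset.univ := by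
        ext i; simp; have := (o.symm i).2; omega
      rw [e]
      refine Submodule.smul_induction_on hx ?_ fun _ _ => add_mem
      intro c hc y hy
      obtain ⟨s, hs, rfl⟩ := H.Bgen n hy
      exact ⟨fun i => c • s i, fun i => Submodule.smul_mem_smul hc (hs i), by simp [Finset.smul_sum]⟩
    | succ m ihm =>
      intro k hk x hx hxE
      have hkd : k < d := by omega
      set l := o ⟨k, hkd⟩ with hl
      have hins : (Finset.univ.filter fun i => (o.symm i : ℕ) < k + 1) = insert l (Finset.univ.filter fun i => (o.symm i : ℕ) < k) := by
        ext i
        have : i = l ↔ (o.symm i : ℕ) = k := by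
          rw [hl, ← Equiv.symm_apply_eq, Fin.ext_iff]
        simp [this]; omega
      have hlE : l ∉ (Finset.univ.filter fun i => (o.symm i : ℕ) < k) := by simp [hl]
      have h1 := ihm (k + 1) (by omega) x hx (TL_subset _ (by rw [hins]; exact Finset.subset_insert _ _) _ hxE)
      rw [hins] at h1
      set E := (Finset.univ.filter fun i => (o.symm i : ℕ) < k) with hE
      obtain ⟨μ, hμ, he⟩ := h1
      rw [Finset.sum_insert hlE] at he
      have hsub : maximalIdeal A • H.B (n + 1) ≤ H.B (n + 1) := Submodule.smul_le_right
      have h2 : ∑ i ∈ E, j (T i) * μ i ∈ TL jT E (maximalIdeal A • H.B (n + 1)) := ⟨μ, hμ, rfl⟩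
      have h3 : j (T l) * μ l ∈ TL jT E (H.B (n + 1)) := by
        have := sub_mem hxE (TL_mono _ _ hsub h2)
        rwa [he, add_sub_cancel_right] at this
      have h4 := H.Ch hlE n (hsub (hμ l)) h3
      have h5 := ihn (m + 1) k hk (μ l) (hμ l) h4
      obtain ⟨ν, hν, hν'⟩ := h5
      rw [he]
      refine add_mem ?_ h2
      rw [hν', Finset.mul_sum]
      refine sum_mem fun i hi => ?_
      rw [mul_left_comm]
      refine mul_mem_TL (t := jT) hi ?_
      refine Submodule.smul_induction_on (hν i) ?_ ?_
      · intro c hc y hy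
        rw [mul_smul_comm]
        exact Submodule.smul_mem_smul hc (H.MB n (H.D.hT l) hy)
      · intro x y hx hy
        rw [mul_add]; exact add_mem hx hy

/-- weak regularity, graded form -/
lemma reg [Nontrivial ι] {d : ℕ} (o : Fin d ≃ ι) (n : ℕ) (k : ℕ) (hk : k < d) (c : S) (hc : c ∈ H.B n)
    (hcE : j (T (o ⟨k, hk⟩)) * c ∈ TL jT (Finset.univ.filter fun i => (o.symm i : ℕ) < k) (H.B n) ⊔ maximalIdeal A • H.B (n + 1)) :
    (n = 0 ∧ c ∈ maximalIdeal A • H.B 0) ∨ ∃ n', n = n' + 1 ∧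
      c ∈ TL jT (Finset.univ.filter fun i => (o.symm i : ℕ) < k) (H.B n') ⊔ maximalIdeal A • H.B n := by
  obtain ⟨x, hx, y, hy, hxy⟩ := Submodule.mem_sup.1 hcE
  set l := o ⟨k, hk⟩ with hl
  have hins : (Finset.univ.filter fun i => (o.symm i : ℕ) < k + 1) = insert l (Finset.univ.filter fun i => (o.symm i : ℕ) < k) := by
    ext i
    have : i = l ↔ (o.symm i : ℕ) = k := by
      rw [hl, ← Equiv.symm_apply_eq, Fin.ext_iff]
    simp [this]; omega
  have hlE : l ∉ (Finset.univ.filter fun i => (o.symm i : ℕ) < k) := by simp [hl]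
  have hy2 : y ∈ TL jT (Finset.univ.filter fun i => (o.symm i : ℕ) < k + 1) (H.B n) := by
    rw [hins]
    have : y = j (T l) * c - x := by rw [← hxy]; ring
    rw [this]
    exact sub_mem (mul_mem_TL (t := jT) (Finset.mem_insert_self _ _) hc) (TL_subset _ (Finset.subset_insert _ _) _ hx)
  have h1 := H.EE o n (d - (k + 1)) (k + 1) (by omega) y hy hy2
  rw [hins] at h1
  set E := (Finset.univ.filter fun i => (o.symm i : ℕ) < k) with hE
  obtain ⟨μ, hμ, he⟩ := h1
  rw [Finset.sum_insert hlE] at he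
  have hsub : maximalIdeal A • H.B n ≤ H.B n := Submodule.smul_le_right
  have h3 : j (T l) * (c - μ l) ∈ TL jT E (H.B n) := by
    have h2 : ∑ i ∈ E, j (T i) * μ i ∈ TL jT E (H.B n) := ⟨μ, fun i => hsub (hμ i), rfl⟩
    have := add_mem hx h2
    convert this using 1
    rw [mul_sub, ← hxy, he]; ring
  cases n with
  | zero =>
    left
    refine ⟨rfl, ?_⟩
    have hc' : c - μ l ∈ H.B 0 := sub_mem hc (hsub (hμ l))
    obtain ⟨s, hs, he'⟩ := h3
    have hB0 : ∀ z ∈ H.B 0, ∃ a : A, z = algebraMap A S a := by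
      intro z hz
      obtain ⟨r, hr, hr'⟩ := H.B0 ▸ hz
      obtain ⟨a, rfl⟩ := H.D.zero r hr
      exact ⟨a, by rw [← hr']; simp⟩
    obtain ⟨a0, ha0⟩ := hB0 _ hc'
    choose a ha using fun i => hB0 _ (hs i)
    have h5 := H.indep (fun i => if i = l then a0 else if i ∈ E then - a i else 0) (by
      have e : ∑ i, (if i = l then a0 else if i ∈ E then - a i else 0) • j (T i) = 0 := by
        rw [← Finset.add_sum_erase _ _ (Finset.mem_univ l), if_pos rfl]
        have : ∑ i ∈ Finset.univ.erase l, (if i = l then a0 else if i ∈ E then - a i else 0) • j (T i) = ∑ i ∈ E, - (j (T i) * s i) := by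
          rw [← Finset.sum_subset (show E ⊆ Finset.univ.erase l from fun i hi => by simp; rintro rfl; exact hlE hi)]
          · refine Finset.sum_congr rfl fun i hi => ?_
            rw [if_neg (by rintro rfl; exact hlE hi), if_pos hi, ha i, neg_smul, Algebra.smul_def, mul_comm]
          · intro i hi hiE
            rw [if_neg (Finset.mem_erase.1 hi).1, if_neg hiE, zero_smul]
        rw [this, Finset.sum_neg_distrib, ← he', ha0, Algebra.smul_def]; ring
      rw [e]; exact zero_mem _) l
    simp only [if_pos] at h5
    have : c = (c - μ l) + μ l := by ring
    rw [this]
    refine add_mem ?_ (hμ l)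
    rw [ha0, Algebra.algebraMap_eq_smul_one]
    exact Submodule.smul_mem_smul h5 (H.Ble 0 ⟨1, by simpa using Cut1.alg0 (𝒜 := 𝒜) (1 : A), by simp⟩)
  | succ n' =>
    right
    refine ⟨n', rfl, ?_⟩
    have := H.Ch hlE n' (sub_mem hc (hsub (hμ l))) h3
    exact Submodule.mem_sup.2 ⟨_, this, _, hμ l, by ring⟩

end NSys
end nsys

section grading
variable (A : Type) [CommRing A] (r : ℕ) (M : Submodule A (Fin r → A))

lemma emb_hom (v : Fin r → A) : (emb A r v).IsHomogeneous 1 := by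
  rw [emb, Fintype.linearCombination_apply]
  refine IsHomogeneous.sum _ _ _ fun i _ => ?_
  rw [MvPolynomial.smul_eq_C_mul]
  simpa using (isHomogeneous_C _ _).mul (isHomogeneous_X A i)

lemma sub1_hom {x : MvPolynomial (Fin r) A} (hx : x ∈ sub1 A r M) : x.IsHomogeneous 1 := by
  obtain ⟨v, _, rfl⟩ := hx
  exact emb_hom A r v

lemma sub1_pow_hom (n : ℕ) : ∀ x ∈ sub1 A r M ^ n, x.IsHomogeneous n := by
  induction n with
  | zero =>
    intro x hx
    rw [pow_zero] at hx
    obtain ⟨a, rfl⟩ := Submodule.mem_one.1 hx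
    exact isHomogeneous_C _ _
  | succ n ih =>
    intro x hx
    rw [pow_succ] at hx
    refine Submodule.mul_induction_on hx (fun a ha b hb => (ih a ha).mul (sub1_hom A r M hb)) fun a b ha hb => ha.add hb

lemma sub1_pow_le (n : ℕ) : ∀ x ∈ sub1 A r M ^ n, x ∈ reesAlg A r M := by
  induction n with
  | zero =>
    intro x hx
    rw [pow_zero] at hx
    obtain ⟨a, rfl⟩ := Submodule.mem_one.1 hx
    exact Subalgebra.algebraMap_mem _ a
  | succ n ih =>
    intro x hx
    rw [pow_succ] at hx
    refine Submodule.mul_induction_on hx (fun a ha b hb => mul_mem (ih a ha) (Algebra.subset_adjoin hb)) fun a b ha hb => add_mem ha hb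

lemma hc_mem {x : MvPolynomial (Fin r) A} (hx : x ∈ reesAlg A r M) (n : ℕ) :
    homogeneousComponent n x ∈ sub1 A r M ^ n := by
  have single : ∀ (m : ℕ) (y : MvPolynomial (Fin r) A), y ∈ sub1 A r M ^ m → ∀ n, homogeneousComponent n y ∈ sub1 A r M ^ n := by
    intro m y hy n
    rw [homogeneousComponent_of_mem ((mem_homogeneousSubmodule _ _).2 (sub1_pow_hom A r M m y hy))]
    split_ifs with h
    · rwa [h]
    · exact zero_mem _
  induction hx using Algebra.adjoin_induction generalizing n with
  | mem x hx => exact single 1 x (by rwa [pow_one]) n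
  | algebraMap a => exact single 0 _ (by rw [pow_zero]; exact Submodule.mem_one.2 ⟨a, rfl⟩) n
  | add x y _ _ hx hy => rw [map_add]; exact add_mem (hx n) (hy n)
  | mul x y _ _ hx hy =>
    rw [← sum_homogeneousComponent x, ← sum_homogeneousComponent y, Finset.sum_mul_sum, map_sum]
    refine sum_mem fun i _ => ?_
    rw [map_sum]
    refine sum_mem fun j _ => ?_
    refine single (i + j) _ ?_ n
    rw [pow_add]; exact Submodule.mul_mem_mul (hx i) (hy j)

/-- grading of the Rees algebra -/
noncomputable def gr (n : ℕ) : Submodule A ↥(reesAlg A r M) :=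
  (homogeneousSubmodule (Fin r) A n).comap (reesAlg A r M).val.toLinearMap

lemma mem_gr {n : ℕ} {x : ↥(reesAlg A r M)} : x ∈ gr A r M n ↔ (x : MvPolynomial (Fin r) A).IsHomogeneous n := Iff.rfl

lemma mem_gr' {n : ℕ} {x : ↥(reesAlg A r M)} : x ∈ gr A r M n ↔ (x : MvPolynomial (Fin r) A) ∈ sub1 A r M ^ n := by
  constructor
  · intro h
    have := hc_mem A r M x.2 n
    rwa [homogeneousComponent_of_mem ((mem_homogeneousSubmodule _ _).2 (mem_gr A r M |>.1 h)), if_pos rfl] at this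
  · exact sub1_pow_hom A r M n x

/-- component -/
noncomputable def grc (x : ↥(reesAlg A r M)) (n : ℕ) : ↥(reesAlg A r M) :=
  ⟨homogeneousComponent n (x : MvPolynomial (Fin r) A), sub1_pow_le A r M n _ (hc_mem A r M x.2 n)⟩

lemma grc_mem (x : ↥(reesAlg A r M)) (n : ℕ) : grc A r M x n ∈ gr A r M n :=
  homogeneousComponent_isHomogeneous n _

lemma of_sum_apply (s : Finset ℕ) (y : ∀ n, ↥(gr A r M n)) (n : ℕ) :
    (∑ i ∈ s, DirectSum.of (fun n => ↥(gr A r M n)) i (y i)) n = if n ∈ s then y n else 0 := by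
  classical
  induction s using Finset.induction_on with
  | empty => simp
  | insert a s ha ih =>
    rw [Finset.sum_insert ha, DirectSum.add_apply, ih]
    by_cases h : n = a
    · subst h; simp [ha]
    · rw [DirectSum.of_eq_of_ne _ _ _ h]; simp [h]

noncomputable instance : GradedAlgebra (gr A r M) where
  one_mem := isHomogeneous_one _ _
  mul_mem := fun _ _ _ _ hx hy => IsHomogeneous.mul hx hy
  decompose' x := ∑ n ∈ Finset.range ((x : MvPolynomial (Fin r) A).totalDegree + 1),
    DirectSum.of (fun n => ↥(gr A r M n)) n ⟨grc A r M x n, grc_mem A r M x n⟩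
  left_inv x := by
    classical
    apply Subtype.ext
    conv_rhs => rw [← sum_homogeneousComponent (x : MvPolynomial (Fin r) A)]
    simp [DirectSum.coeAddMonoidHom_of, grc]
  right_inv x := by
    classical
    have key : ∀ n, homogeneousComponent n ((DirectSum.coeAddMonoidHom (gr A r M) x : ↥(reesAlg A r M)) : MvPolynomial (Fin r) A) = ((x n : ↥(reesAlg A r M)) : MvPolynomial (Fin r) A) := by
      intro n
      induction x using DirectSum.induction_on with
      | zero => simp
      | of i y =>
        rw [DirectSum.coeAddMonoidHom_of, homogeneousComponent_of_mem ((mem_homogeneousSubmodule _ _).2 ((mem_gr A r M).1 y.2))]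
        split_ifs with h
        · subst h; simp
        · rw [DirectSum.of_eq_of_ne _ _ _ h]; simp
      | add x y hx hy =>
        rw [map_add]
        simp only [AddMemClass.coe_add, map_add, DirectSum.add_apply] at hx hy ⊢
        rw [hx, hy]
    ext n : 2
    apply Subtype.ext
    rw [of_sum_apply A r M _ (fun n => ⟨grc A r M (DirectSum.coeAddMonoidHom (gr A r M) x) n, grc_mem A r M _ n⟩)]
    split_ifs with h
    · exact key n
    · rw [eq_comm]
      rw [← key n, homogeneousComponent_eq_zero]
      · rfl
      · simpa using h

lemma gr_gen (n : ℕ) : gr A r M (n + 1) = gr A r M 1 * gr A r M n := by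
  have hmap : ∀ n, (gr A r M n).map (reesAlg A r M).val.toLinearMap = sub1 A r M ^ n := by
    intro n
    ext x
    constructor
    · rintro ⟨y, hy, rfl⟩; exact (mem_gr' A r M).1 hy
    · intro hx; exact ⟨⟨x, sub1_pow_le A r M n x hx⟩, (mem_gr' A r M).2 hx, rfl⟩
  have hinj : Function.Injective (Submodule.map (reesAlg A r M).val.toLinearMap) :=
    Submodule.map_injective_of_injective Subtype.val_injective
  apply hinj
  rw [Submodule.map_mul, hmap, hmap, hmap, pow_one, pow_succ']

lemma gr_zero (x : ↥(reesAlg A r M)) (hx : x ∈ gr A r M 0) : ∃ c : A, x = algebraMap A _ c := by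
  have := (mem_gr' A r M).1 hx
  rw [pow_zero] at this
  obtain ⟨a, ha⟩ := Submodule.mem_one.1 this
  exact ⟨a, Subtype.ext ha.symm⟩

lemma cc_hom {n : ℕ} (hn : n ≠ 0) {x : MvPolynomial (Fin r) A} (hx : x.IsHomogeneous n) : constantCoeff x = 0 := by
  rw [constantCoeff_eq]
  exact hx.coeff_eq_zero (by simpa using hn.symm)

variable [IsLocalRing A]

lemma mem_gradedMax {x : ↥(reesAlg A r M)} : x ∈ gradedMax A r M ↔ constantCoeff (x : MvPolynomial (Fin r) A) ∈ maximalIdeal A := Iff.rfl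

lemma pr0 (x : ↥(reesAlg A r M)) : pr (gr A r M) 0 x = algebraMap A _ (constantCoeff (x : MvPolynomial (Fin r) A)) := by
  obtain ⟨c, hc⟩ := gr_zero A r M _ (pr_mem (gr A r M) 0 x)
  rw [hc]; congr 1
  conv_rhs => rw [pr_sum (gr A r M) x]
  rw [AddSubmonoidClass.coe_finsetSum, map_sum]
  have h1 : ∀ i, constantCoeff ((pr (gr A r M) i x : ↥(reesAlg A r M)) : MvPolynomial (Fin r) A) = if i = 0 then c else 0 := by
    intro i
    split_ifs with h
    · subst h; rw [hc]; simp [MvPolynomial.algebraMap_eq]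
    · exact cc_hom A r h (pr_mem (gr A r M) i x)
  rw [Finset.sum_congr rfl fun i _ => h1 i, Finset.sum_ite_eq']
  split_ifs with h
  · rfl
  · have : pr (gr A r M) 0 x = 0 := by
      simpa [pr] using h
    rw [hc] at this
    have := congrArg (fun z : ↥(reesAlg A r M) => constantCoeff (z : MvPolynomial (Fin r) A)) this
    simpa [MvPolynomial.algebraMap_eq] using this

lemma gr_le_Q {n : ℕ} (hn : n ≠ 0) {x : ↥(reesAlg A r M)} (hx : x ∈ gr A r M n) : x ∈ gradedMax A r M := by
  rw [mem_gradedMax, cc_hom A r hn ((mem_gr A r M).1 hx)]; exact zero_mem _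

lemma gradedMax_hom : (gradedMax A r M).IsHomogeneous (gr A r M) := by
  intro i x hx
  change pr (gr A r M) i x ∈ _
  by_cases hi : i = 0
  · subst hi
    rw [pr0]
    rw [mem_gradedMax] at hx ⊢
    simpa [MvPolynomial.algebraMap_eq] using hx
  · exact gr_le_Q A r M hi (pr_mem _ _ _)

lemma pr0_unit {x : ↥(reesAlg A r M)} (hx : x ∉ gradedMax A r M) : IsUnit (pr (gr A r M) 0 x) := by
  rw [pr0]
  rw [mem_gradedMax] at hx
  exact ((IsLocalRing.notMem_maximalIdeal.1 hx)).map _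

end grading

section weak
/-- the weak sequence property before localization -/
lemma weak_aux {R : Type} [CommRing R] (Q : Ideal R) [Q.IsPrime] (hB : IsBuchsbaumLocalRing (Localization.AtPrime Q))
    (e : ℕ) (he : ringKrullDim (Localization.AtPrime Q) = e) (x : Fin e → R) (hx : ∀ i, x i ∈ Q)
    (hrad : Q ≤ (Ideal.span (Set.range x)).radical) (i : Fin e) (u : R) (hu : x i * u ∈ Ideal.span (x '' {j | j < i}))
    (t : R) (ht : t ∈ Q) : ∃ s ∉ Q, s * (t * u) ∈ Ideal.span (x '' {j | j < i}) := by
  set f := algebraMap R (Localization.AtPrime Q) with hf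
  have hspan : ∀ E : Set (Fin e), Ideal.span ((fun j => f (x j)) '' E) = (Ideal.span (x '' E)).map f := by
    intro E; rw [Ideal.map_span, Set.image_image]
  have hmax : maximalIdeal (Localization.AtPrime Q) = Q.map f := (Localization.AtPrime.map_eq_maximalIdeal (I := Q)).symm
  have h1 := hB e he (fun j => f (x j)) (fun j => by rw [hmax]; exact Ideal.mem_map_of_mem _ (hx j)) (by
    have : Set.range (fun j => f (x j)) = (fun j => f (x j)) '' Set.univ := by simp
    rw [this, hspan, hmax, Set.image_univ]
    rw [Ideal.map_le_iff_le_comap]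
    intro z hz
    obtain ⟨n, hn⟩ := hrad hz
    exact ⟨n, by rw [← map_pow]; exact Ideal.mem_map_of_mem _ hn⟩) i
  have h2 : f u ∈ (Ideal.span ((fun j => f (x j)) '' {j | j < i})).colon (Ideal.span {f (x i)} : Set _) := by
    rw [Submodule.mem_colon]
    intro z hz
    obtain ⟨w, rfl⟩ := Ideal.mem_span_singleton'.1 hz
    rw [smul_eq_mul, mul_left_comm, ← map_mul]
    refine Ideal.mul_mem_left _ _ ?_
    rw [hspan, mul_comm]; exact Ideal.mem_map_of_mem _ hu
  have h3 := (Submodule.mem_colon.1 (h1 h2)) (f t) (by rw [hmax]; exact Ideal.mem_map_of_mem _ ht)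
  rw [hspan, smul_eq_mul, ← map_mul, IsLocalization.algebraMap_mem_map_algebraMap_iff Q.primeCompl] at h3
  obtain ⟨s, hs, h⟩ := h3
  exact ⟨s, hs, by rwa [mul_comm t u]⟩

lemma exists_order {ι : Type} [Fintype ι] {e : ℕ} (he : Fintype.card ι = e) (S : Set ι) (i : ι) (hi : i ∉ S) :
    ∃ σ : Fin e ≃ ι, σ '' {j | j < σ.symm i} = S := by
  classical
  let l : List ι := S.toFinset.toList ++ i :: (Finset.univ \ insert i S.toFinset).toList
  have hn : l.Nodup := by
    simp only [l, List.nodup_append, List.nodup_cons, Finset.nodup_toList, Finset.mem_toList]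
    simp
    refine fun a ha => ⟨?_, ?_⟩
    · rintro rfl; exact hi ha
    · rintro b hb hb2 rfl; exact hb2 ha
  have hall : ∀ x, x ∈ l := by
    intro x; simp [l]; tauto
  have hlen : l.length = e := by
    rw [← he, ← Fintype.card_fin l.length]
    exact Fintype.card_congr (hn.getEquivOfForallMemList l hall)
  let σ := (finCongr hlen.symm).trans (hn.getEquivOfForallMemList l hall)
  have hσ : ∀ j : Fin e, σ j = l[(j:ℕ)]'(by rw [hlen]; exact j.2) := by
    intro j; simp [σ]
  have hlt : S.toFinset.toList.length < e := by rw [← hlen]; simp [l]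
  have hi2 : σ.symm i = ⟨S.toFinset.toList.length, hlt⟩ := by
    rw [Equiv.symm_apply_eq, hσ]
    simp [l]
  refine ⟨σ, ?_⟩
  rw [hi2]
  ext x
  constructor
  · rintro ⟨j, hj, rfl⟩
    have hj : (j : ℕ) < S.toFinset.toList.length := hj
    rw [hσ]
    simp only [l]
    rw [List.getElem_append_left hj]
    have := List.getElem_mem hj
    rw [Finset.mem_toList, Set.mem_toFinset] at this
    exact this
  · intro hx
    have hx : x ∈ S.toFinset.toList := by simpa using hx
    obtain ⟨k, hk, he⟩ := List.getElem_of_mem hx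
    refine ⟨⟨k, hk.trans hlt⟩, hk, ?_⟩
    rw [hσ]; simp only [l]
    rw [List.getElem_append_left hk, he]

lemma weak {R ι : Type} [CommRing R] [Fintype ι] (Q : Ideal R) [Q.IsPrime] (hB : IsBuchsbaumLocalRing (Localization.AtPrime Q))
    (he : ringKrullDim (Localization.AtPrime Q) = (Fintype.card ι : ℕ)) (x : ι → R) (hx : ∀ i, x i ∈ Q)
    (hrad : Q ≤ (Ideal.span (Set.range x)).radical) (S : Set ι) (i : ι) (hi : i ∉ S) (u : R) (hu : x i * u ∈ Ideal.span (x '' S))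
    (t : R) (ht : t ∈ Q) : ∃ s ∉ Q, s * (t * u) ∈ Ideal.span (x '' S) := by
  obtain ⟨σ, hσ⟩ := exists_order rfl S i hi
  have e1 : (fun j => x (σ j)) '' {j | j < σ.symm i} = x '' S := by
    rw [← hσ, Set.image_image]
  rw [← e1]
  refine weak_aux Q hB _ he (fun j => x (σ j)) (fun j => hx _) ?_ (σ.symm i) u ?_ t ht
  · have : Set.range (fun j => x (σ j)) = Set.range x := σ.surjective.range_comp x
    rwa [this]
  · rw [e1]; simpa using hu

end weak

section dets
variable {A : Type} [CommRing A] {r : ℕ} (τ : Fin (r + 1) → Fin r → A)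

/-- the matrix `[v | τ]` -/
def NM (v : Fin (r + 1) → A) : Matrix (Fin (r + 1)) (Fin (r + 1)) A := fun i => Fin.cons (v i) (τ i)

/-- the signed minors -/
def hdet (i : Fin (r + 1)) : A := (NM τ (Pi.single i 1)).det

lemma NM_det (v : Fin (r + 1) → A) : (NM τ v).det = ∑ i, v i * hdet τ i := by
  have e : ∀ w, (NM τ w).det = ∑ i : Fin (r+1), (-1) ^ (i : ℕ) * w i * (Matrix.det (fun (a b : Fin r) => τ (i.succAbove a) b)) := by
    intro w
    rw [Matrix.det_succ_column_zero]
    rfl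
  have e2 : ∀ i, hdet τ i = (-1) ^ (i : ℕ) * (Matrix.det (fun (a b : Fin r) => τ (i.succAbove a) b)) := by
    intro i
    rw [hdet, e, Finset.sum_eq_single i]
    · simp
    · intro b _ hb; simp [hb]
    · simp
  rw [e]
  exact Finset.sum_congr rfl fun i _ => by rw [e2]; ring

lemma hdet_eq (i : Fin (r + 1)) : hdet τ i = (-1) ^ (i : ℕ) * (Matrix.det (fun (a b : Fin r) => τ (i.succAbove a) b)) := by
  rw [hdet, Matrix.det_succ_column_zero, Finset.sum_eq_single i]
  · simp [NM]; rfl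
  · intro b _ hb; simp [hb, NM]
  · simp

lemma hdet_rel : ∑ i, hdet τ i • τ i = 0 := by
  ext c
  have : (NM τ (fun i => τ i c)).det = 0 := by
    refine Matrix.det_zero_of_column_eq (i := 0) (j := Fin.succ c) (Fin.succ_ne_zero c).symm fun k => ?_
    simp [NM]
  rw [NM_det] at this
  simp only [Finset.sum_apply, Pi.smul_apply, smul_eq_mul, Pi.zero_apply]
  rw [← this]
  exact Finset.sum_congr rfl fun i _ => mul_comm _ _

/-- `Φ i j w` -/
def Phi (i j : Fin (r + 1)) : (Fin r → A) →ₗ[A] A where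
  toFun w := ((NM τ (Pi.single j 1)).updateRow i (Fin.cons 0 w)).det
  map_add' w w' := by
    rw [← Matrix.det_updateRow_add]
    congr 2
    ext k; refine Fin.cases ?_ (fun k => ?_) k <;> simp
  map_smul' c w := by
    simp only [RingHom.id_apply, smul_eq_mul]
    rw [← Matrix.det_updateRow_smul]
    congr 2
    ext k; refine Fin.cases ?_ (fun k => ?_) k <;> simp

lemma Phi_apply (i j : Fin (r + 1)) (w : Fin r → A) :
    Phi τ i j w = ((NM τ (Pi.single j 1)).updateRow i (Fin.cons 0 w)).det := rfl

lemma Phi_cr0 (w : Fin r → A) (k : Fin (r + 1)) :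
    (∑ i, Phi τ i k w • (NM τ (Pi.single k 1)) i) = hdet τ k • (Fin.cons 0 w : Fin (r + 1) → A) := by
  have h := Matrix.mulVec_cramer ((NM τ (Pi.single k 1)).transpose) (Fin.cons 0 w)
  rw [Matrix.det_transpose] at h
  rw [hdet, ← h]
  ext c
  rw [Matrix.mulVec, dotProduct]
  simp only [Finset.sum_apply, Pi.smul_apply, smul_eq_mul, Matrix.transpose_apply, Matrix.cramer_transpose_apply, Phi_apply]
  exact Finset.sum_congr rfl fun i _ => mul_comm _ _

lemma Phi_diag (w : Fin r → A) (k : Fin (r + 1)) : Phi τ k k w = 0 := by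
  have := congrFun (Phi_cr0 τ w k) 0
  simp only [Finset.sum_apply, Pi.smul_apply, smul_eq_mul, NM, Fin.cons_zero, mul_zero] at this
  rw [Finset.sum_eq_single k] at this
  · simpa using this
  · intro b _ hb; simp [hb]
  · simp

lemma Phi_cr (w : Fin r → A) (k : Fin (r + 1)) :
    hdet τ k • w = ∑ i ∈ Finset.univ.erase k, Phi τ i k w • τ i := by
  have h1 : ∑ i ∈ Finset.univ.erase k, Phi τ i k w • τ i = ∑ i, Phi τ i k w • τ i := by
    rw [← Finset.add_sum_erase _ _ (Finset.mem_univ k), Phi_diag, zero_smul, zero_add]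
  rw [h1]
  ext c
  have := congrFun (Phi_cr0 τ w k) (Fin.succ c)
  simp only [Finset.sum_apply, Pi.smul_apply, smul_eq_mul, NM, Fin.cons_succ] at this ⊢
  rw [this]

lemma Phi_self {i j : Fin (r + 1)} (hij : i ≠ j) : Phi τ i j (τ i) = hdet τ j := by
  rw [Phi_apply, hdet]
  congr 1
  ext a c
  by_cases ha : a = i
  · subst ha
    rw [Matrix.updateRow_self]
    refine Fin.cases ?_ (fun c => ?_) c <;> simp [NM, hij]
  · rw [Matrix.updateRow_ne ha]

lemma Phi_other {i j k : Fin (r + 1)} (hki : k ≠ i) (hkj : k ≠ j) : Phi τ i j (τ k) = 0 := by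
  rw [Phi_apply]
  refine Matrix.det_zero_of_row_eq hki ?_
  rw [Matrix.updateRow_ne hki, Matrix.updateRow_self]
  ext c; refine Fin.cases ?_ (fun c => ?_) c <;> simp [NM, hkj]

lemma Phi_anti (i j : Fin (r + 1)) (w : Fin r → A) : Phi τ j i w = - Phi τ i j w := by
  by_cases hij : i = j
  · subst hij; simp [Phi_diag]
  set N0 : Matrix (Fin (r + 1)) (Fin (r + 1)) A := NM τ 0 with hN0
  have e1 : ∀ i j : Fin (r+1), i ≠ j → Phi τ i j w = ((N0.updateRow j (Fin.cons 1 (τ j))).updateRow i (Fin.cons 0 w)).det := by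
    intro i j hij
    rw [Phi_apply]; congr 1
    ext a c
    by_cases ha : a = i
    · subst ha; simp
    · rw [Matrix.updateRow_ne ha, Matrix.updateRow_ne ha]
      by_cases hb : a = j
      · subst hb; rw [Matrix.updateRow_self]; simp [NM]
      · rw [Matrix.updateRow_ne hb]; simp [NM, N0, hb]
  have e2 : Phi τ j i w = ((N0.updateRow i (Fin.cons 1 (τ i))).updateRow j (Fin.cons 0 w)).det := e1 j i (Ne.symm hij)
  have e3 : ((N0.updateRow i (Fin.cons 1 (τ i))).updateRow j (Fin.cons 0 w)).det = - ((N0.updateRow j (Fin.cons 1 (τ i))).updateRow i (Fin.cons 0 w)).det := by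
    change Matrix.detRowAlternating _ = - Matrix.detRowAlternating _
    have := (Matrix.detRowAlternating (R := A) (n := Fin (r + 1))).map_swap ((N0.updateRow j (Fin.cons 1 (τ i))).updateRow i (Fin.cons 0 w)) hij
    rw [← this]
    congr 1
    ext a c
    change ((N0.updateRow i (Fin.cons 1 (τ i))).updateRow j (Fin.cons 0 w)) a c = ((N0.updateRow j (Fin.cons 1 (τ i))).updateRow i (Fin.cons 0 w)) (Equiv.swap i j a) c
    by_cases ha : a = i
    · subst ha; rw [Equiv.swap_apply_left, Matrix.updateRow_ne hij, Matrix.updateRow_self, Matrix.updateRow_ne (Ne.symm hij), Matrix.updateRow_self]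
    · by_cases hb : a = j
      · subst hb; rw [Equiv.swap_apply_right, Matrix.updateRow_self, Matrix.updateRow_self]
      · rw [Equiv.swap_apply_of_ne_of_ne ha hb, Matrix.updateRow_ne hb, Matrix.updateRow_ne ha, Matrix.updateRow_ne ha, Matrix.updateRow_ne hb]
  rw [e2, e1 i j hij, e3]
  have hcomm : ∀ u, (N0.updateRow j u).updateRow i (Fin.cons 0 w) = (N0.updateRow i (Fin.cons 0 w)).updateRow j u := by
    intro u
    exact Function.update_comm (Ne.symm hij) _ _ _
  rw [hcomm, hcomm]
  have hs : (Fin.cons 1 (τ j) : Fin (r + 1) → A) = Fin.cons 1 (τ i) + Fin.cons 0 (τ j - τ i) := by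
    ext c; refine Fin.cases ?_ (fun c => ?_) c <;> simp
  rw [hs, Matrix.det_updateRow_add]
  have h0 : ((N0.updateRow i (Fin.cons 0 w)).updateRow j (Fin.cons 0 (τ j - τ i))).det = 0 := by
    refine Matrix.det_eq_zero_of_column_eq_zero 0 fun a => ?_
    by_cases hb : a = j
    · subst hb; simp
    · rw [Matrix.updateRow_ne hb]
      by_cases ha : a = i
      · subst ha; simp
      · rw [Matrix.updateRow_ne ha]; simp [N0, NM]
  rw [h0, add_zero]

/-- the algebra map -/
noncomputable def phiAlg (i j : Fin (r + 1)) : MvPolynomial (Fin r) A →ₐ[A] A :=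
  MvPolynomial.aeval fun k => Phi τ i j (Pi.single k 1)

lemma phiAlg_emb (i j : Fin (r + 1)) (w : Fin r → A) : phiAlg τ i j (emb A r w) = Phi τ i j w := by
  rw [emb, Fintype.linearCombination_apply, map_sum]
  conv_rhs => rw [pi_eq_sum_univ' w, map_sum]
  refine Finset.sum_congr rfl fun k _ => ?_
  rw [map_smul, map_smul, phiAlg, aeval_X]

/-- the change of basis -/
def chg (P : Matrix (Fin (r + 1)) (Fin (r + 1)) A) : Fin (r + 1) → Fin r → A := fun a => ∑ k, P a k • τ k

lemma hdet_chg (P Q : Matrix (Fin (r + 1)) (Fin (r + 1)) A) (hPQ : P * Q.transpose = 1) (i : Fin (r + 1)) :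
    hdet (chg τ P) i = P.det * ∑ k, Q i k * hdet τ k := by
  have : NM (chg τ P) (Pi.single i 1) = P * NM τ (fun k => Q i k) := by
    ext a c
    refine Fin.cases ?_ (fun c => ?_) c
    · have := congrFun (congrFun hPQ a) i
      simp only [Matrix.mul_apply, Matrix.transpose_apply, Matrix.one_apply] at this
      simp [NM, Matrix.mul_apply, this, Pi.single_apply]
    · simp [NM, Matrix.mul_apply, chg]
  rw [hdet, this, Matrix.det_mul, NM_det]

lemma chg_chg (P P' : Matrix (Fin (r + 1)) (Fin (r + 1)) A) (h : P' * P = 1) : chg (chg τ P) P' = τ := by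
  ext a c
  have : ∀ k, (P' * P) a k = if a = k then 1 else 0 := by
    intro k; rw [h, Matrix.one_apply]
  simp only [Matrix.mul_apply] at this
  simp only [chg, Finset.smul_sum, smul_smul]
  rw [Finset.sum_comm]
  simp [← Finset.sum_smul, ← Finset.sum_mul, this]
  rw [Finset.sum_eq_single a]
  · simp
  · intro b _ hb; simp [Ne.symm hb]
  · simp

end dets

section build
variable {A : Type} [CommRing A] {r : ℕ} {M : Submodule A (Fin r → A)}

/-- element of degree one -/
noncomputable def TT (τ : Fin (r + 1) → Fin r → A) (hτ : ∀ i, τ i ∈ M) (i : Fin (r + 1)) : ↥(reesAlg A r M) :=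
  ⟨emb A r (τ i), Algebra.subset_adjoin ⟨τ i, hτ i, rfl⟩⟩

lemma TT_mem (τ : Fin (r + 1) → Fin r → A) (hτ : ∀ i, τ i ∈ M) (i : Fin (r + 1)) : TT τ hτ i ∈ gr A r M 1 :=
  emb_hom A r _

lemma gr1_emb {x : ↥(reesAlg A r M)} (hx : x ∈ gr A r M 1) : ∃ w ∈ M, emb A r w = (x : MvPolynomial (Fin r) A) := by
  have := (mem_gr' A r M).1 hx
  rw [pow_one] at this
  exact this

lemma TT_rel (τ : Fin (r + 1) → Fin r → A) (hτ : ∀ i, τ i ∈ M) :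
    ∑ i, algebraMap A ↥(reesAlg A r M) (hdet τ i) * TT τ hτ i = 0 := by
  apply Subtype.ext
  rw [AddSubmonoidClass.coe_finsetSum]
  have := congrArg (emb A r) (hdet_rel τ)
  rw [map_sum, map_zero] at this
  rw [ZeroMemClass.coe_zero, ← this]
  refine Finset.sum_congr rfl fun i _ => ?_
  rw [map_smul, Algebra.smul_def]; rfl

lemma emb_cr (τ : Fin (r + 1) → Fin r → A) (w : Fin r → A) (b : Fin (r + 1)) :
    hdet τ b • emb A r w = ∑ j ∈ Finset.univ.erase b, Phi τ j b w • emb A r (τ j) := by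
  rw [← map_smul, Phi_cr, map_sum]
  exact Finset.sum_congr rfl fun i _ => by rw [map_smul]

variable [IsDomain A] [IsLocalRing A] [IsNoetherianRing A]

/-- reduction hypothesis -/
def Redn (τ : Fin (r + 1) → Fin r → A) (hτ : ∀ i, τ i ∈ M) : Prop :=
  ∃ n : ℕ, ∀ x ∈ gr A r M (n + 1), x ∈ Ideal.span (Set.range (TT τ hτ))

omit [IsDomain A] [IsNoetherianRing A] in
lemma Q_le_prime {P : Ideal ↥(reesAlg A r M)} (hP : P.IsPrime)
    (hm : ∀ t ∈ maximalIdeal A, algebraMap A _ t ∈ P) (hM : ∀ x ∈ gr A r M 1, x ∈ P) : gradedMax A r M ≤ P := by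
  intro x hx
  rw [pr_sum (gr A r M) x]
  refine sum_mem fun i _ => ?_
  cases i with
  | zero =>
    rw [pr0]; exact hm _ hx
  | succ n =>
    have := pr_mem (gr A r M) (n + 1) x
    rw [gr_gen] at this
    refine Submodule.mul_induction_on this (fun a ha b _ => P.mul_mem_right _ (hM a ha)) fun a b => add_mem

omit [IsDomain A] [IsNoetherianRing A] in
lemma gr1_le_prime {τ : Fin (r + 1) → Fin r → A} {hτ : ∀ i, τ i ∈ M} (hred : Redn τ hτ) {P : Ideal ↥(reesAlg A r M)} (hP : P.IsPrime)
    (hT : ∀ i, TT τ hτ i ∈ P) : ∀ x ∈ gr A r M 1, x ∈ P := by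
  intro x hx
  obtain ⟨n, hn⟩ := hred
  refine hP.mem_of_pow_mem (n + 1) ?_
  have h1 : x ^ (n + 1) ∈ gr A r M (n + 1) := by
    have := SetLike.pow_mem_graded (A := gr A r M) (n + 1) hx
    simpa using this
  have h2 : Ideal.span (Set.range (TT τ hτ)) ≤ P := by
    rw [Ideal.span_le]; rintro _ ⟨i, rfl⟩; exact hT i
  exact h2 (hn _ h1)

/-- the parameters -/
noncomputable def xx (τ : Fin (r + 1) → Fin r → A) (hτ : ∀ i, τ i ∈ M) (a b : Fin (r + 1)) (k : Option (Fin (r + 1)) → ℕ) (N : ℕ)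
    (o : Option (Fin (r + 1))) : ↥(reesAlg A r M) :=
  if o = some a then algebraMap A _ (hdet τ a) ^ N - TT τ hτ a ^ N else yb (TT τ hτ) (hdet τ) b o ^ k o

omit [IsNoetherianRing A] in
lemma weak_xx (hB : IsBuchsbaumLocalRing (Localization.AtPrime (gradedMax A r M)))
    (he : ringKrullDim (Localization.AtPrime (gradedMax A r M)) = (r + 2 : ℕ))
    (τ : Fin (r + 1) → Fin r → A) (hτ : ∀ i, τ i ∈ M) (hred : Redn τ hτ)
    (hhm : ∀ i, hdet τ i ∈ maximalIdeal A)
    (hrad : ∀ a b, a ≠ b → maximalIdeal A ≤ (Ideal.span {hdet τ a, hdet τ b}).radical)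
    (a b : Fin (r + 1)) (hab : a ≠ b) (k : Option (Fin (r + 1)) → ℕ) (hk : ∀ o, 0 < k o) (N : ℕ) (hN : 0 < N)
    (S : Set (Option (Fin (r + 1)))) (hS : some a ∉ S) (i : Option (Fin (r + 1))) (hi : i ∉ S)
    (u : ↥(reesAlg A r M)) (hu : xx τ hτ a b k N i * u ∈ Ideal.span ((fun o => yb (TT τ hτ) (hdet τ) b o ^ k o) '' S)) :
    u ∈ UU (gradedMax A r M) (Ideal.span ((fun o => yb (TT τ hτ) (hdet τ) b o ^ k o) '' S)) := by
  have hTQ : ∀ j, TT τ hτ j ∈ gradedMax A r M := fun j => gr_le_Q A r M one_ne_zero (TT_mem τ hτ j)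
  have hhQ : ∀ j, algebraMap A _ (hdet τ j) ∈ gradedMax A r M := by
    intro j; rw [mem_gradedMax]; simpa [MvPolynomial.algebraMap_eq] using hhm j
  have e1 : (xx τ hτ a b k N) '' S = (fun o => yb (TT τ hτ) (hdet τ) b o ^ k o) '' S := by
    apply Set.image_congr
    intro o ho
    rw [xx, if_neg (by rintro rfl; exact hS ho)]
  intro t ht
  rw [← e1] at hu
  obtain ⟨s, hs, h⟩ := weak (gradedMax A r M) hB (by rw [he]; congr 1; simp) (xx τ hτ a b k N) (by
    intro o
    rw [xx]
    split_ifs with h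
    · exact sub_mem (Ideal.pow_mem_of_mem _ (hhQ a) N hN) (Ideal.pow_mem_of_mem _ (hTQ a) N hN)
    · refine Ideal.pow_mem_of_mem _ ?_ _ (hk o)
      cases o with
      | none => exact hhQ b
      | some j => exact hTQ j) (by
    rw [Ideal.radical_eq_sInf]
    refine le_sInf ?_
    rintro P ⟨hPx, hP⟩
    have hx : ∀ o, xx τ hτ a b k N o ∈ P := fun o => hPx (Ideal.subset_span ⟨o, rfl⟩)
    have hb : algebraMap A _ (hdet τ b) ∈ P := by
      have := hx none
      rw [xx, if_neg (by simp)] at this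
      exact hP.mem_of_pow_mem _ this
    have hT : ∀ j, j ≠ a → TT τ hτ j ∈ P := by
      intro j hj
      have := hx (some j)
      rw [xx, if_neg (by simpa using hj)] at this
      exact hP.mem_of_pow_mem _ this
    have haT : algebraMap A _ (hdet τ a) * TT τ hτ a ∈ P := by
      have h1 := TT_rel τ hτ
      rw [← Finset.add_sum_erase _ _ (Finset.mem_univ a)] at h1
      rw [eq_neg_of_add_eq_zero_left h1]
      exact neg_mem (sum_mem fun j hj => P.mul_mem_left _ (hT j (Finset.mem_erase.1 hj).1))
    have hd := hx (some a)
    rw [xx, if_pos rfl] at hd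
    have hboth : algebraMap A _ (hdet τ a) ∈ P ∧ TT τ hτ a ∈ P := by
      rcases hP.mem_or_mem haT with h | h
      · refine ⟨h, hP.mem_of_pow_mem N ?_⟩
        have := sub_mem (Ideal.pow_mem_of_mem _ h N hN) hd
        simpa using this
      · refine ⟨hP.mem_of_pow_mem N ?_, h⟩
        have := add_mem (Ideal.pow_mem_of_mem _ h N hN) hd
        simpa using this
    refine Q_le_prime hP ?_ (gr1_le_prime hred hP fun j => ?_)
    · intro t ht
      obtain ⟨n, hn⟩ := hrad a b hab ht
      refine hP.mem_of_pow_mem n ?_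
      rw [← map_pow]
      obtain ⟨y, z, hyz⟩ := Ideal.mem_span_pair.1 hn
      rw [← hyz, map_add, map_mul, map_mul]
      exact add_mem (P.mul_mem_left _ hboth.1) (P.mul_mem_left _ hb)
    · by_cases hj : j = a
      · rw [hj]; exact hboth.2
      · exact hT j hj) S i hi u hu t ht
  rw [e1] at h
  refine graded_cancel (gr A r M) ?_ s (pr0_unit A r M hs) _ h
  refine Ideal.homogeneous_span _ _ ?_
  rintro _ ⟨o, ho, rfl⟩
  cases o with
  | none => exact ⟨0, by
      change algebraMap A _ (hdet τ b) ^ k none ∈ gr A r M 0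
      simpa using SetLike.pow_mem_graded (A := gr A r M) (k none) (Cut1.alg0 (hdet τ b))⟩
  | some j => exact ⟨_, SetLike.pow_mem_graded (A := gr A r M) (k (some j)) (TT_mem τ hτ j)⟩

/-- the algebra maps on the Rees algebra -/
noncomputable def phiR (M : Submodule A (Fin r → A)) (τ : Fin (r + 1) → Fin r → A) (a b : Fin (r + 1)) : ↥(reesAlg A r M) →ₐ[A] A :=
  (phiAlg τ a b).comp (reesAlg A r M).val

lemma build_sys (dep : DepthTwo A) (hB : IsBuchsbaumLocalRing (Localization.AtPrime (gradedMax A r M)))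
    (he : ringKrullDim (Localization.AtPrime (gradedMax A r M)) = (r + 2 : ℕ))
    (τ : Fin (r + 1) → Fin r → A) (hτ : ∀ i, τ i ∈ M) (hred : Redn τ hτ)
    (hhm : ∀ i, hdet τ i ∈ maximalIdeal A) (hne : ∀ i, hdet τ i ≠ 0)
    (hrad : ∀ a b, a ≠ b → maximalIdeal A ≤ (Ideal.span {hdet τ a, hdet τ b}).radical) :
    Sys (gr A r M) (gradedMax A r M) (TT τ hτ) (hdet τ) (fun a b => (phiAlg τ a b).comp (reesAlg A r M).val) where
  gen := gr_gen A r M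
  zero := gr_zero A r M
  hQ := gradedMax_hom A r M
  hQ0 := by
    intro h
    have h1 : algebraMap A ↥(reesAlg A r M) (hdet τ 0) ∈ gradedMax A r M := by
      rw [mem_gradedMax]; simpa [MvPolynomial.algebraMap_eq] using hhm 0
    rw [h, Ideal.mem_bot] at h1
    have h2 := congrArg (fun z : ↥(reesAlg A r M) => constantCoeff (z : MvPolynomial (Fin r) A)) h1
    exact hne 0 (by simpa [MvPolynomial.algebraMap_eq] using h2)
  hAQ := fun x hx => gr_le_Q A r M one_ne_zero hx
  hT := TT_mem τ hτ
  hh := fun i => by rw [mem_gradedMax]; simpa [MvPolynomial.algebraMap_eq] using hhm i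
  hne := hne
  φ1 := fun a b hab => by
    change phiAlg τ a b (emb A r (τ a)) = _
    rw [phiAlg_emb, Phi_self τ hab]
  φ2 := fun a b hab => by
    change phiAlg τ a b (emb A r (τ b)) = _
    rw [phiAlg_emb, Phi_anti, Phi_self τ hab.symm]
  φ3 := fun a b j hja hjb => by
    change phiAlg τ a b (emb A r (τ j)) = _
    rw [phiAlg_emb, Phi_other τ hja hjb]
  anti := fun a b w hw => by
    obtain ⟨v, _, hv⟩ := gr1_emb hw
    change phiAlg τ b a (w : MvPolynomial (Fin r) A) = - phiAlg τ a b (w : MvPolynomial (Fin r) A)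
    rw [← hv, phiAlg_emb, phiAlg_emb, Phi_anti]
  Cr := fun w hw b => by
    obtain ⟨v, _, hv⟩ := gr1_emb hw
    apply Subtype.ext
    rw [AddSubmonoidClass.coe_finsetSum]
    have := emb_cr τ v b
    rw [Algebra.smul_def, hv] at this
    refine this.trans (Finset.sum_congr rfl fun j _ => ?_)
    rw [Algebra.smul_def]
    change _ = algebraMap A _ (phiAlg τ j b (w : MvPolynomial (Fin r) A)) * emb A r (τ j)
    rw [← hv, phiAlg_emb]
  cop := fun a b hab m n y hy => dep.coprime_pow (hrad a b hab) (hne a) m n hy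
  W := fun a b hab k hk S hS i hi hia u hu => by
    refine weak_xx hB he τ hτ hred hhm hrad a b hab k hk 1 one_pos S hS i hi u ?_
    rwa [xx, if_neg hia]
  W' := fun a b hab k hk S hS N hN u hu hu2 => by
    refine weak_xx hB he τ hτ hred hhm hrad a b hab k hk N hN S hS (some a) hS u ?_
    rw [xx, if_pos rfl, sub_mul]
    exact sub_mem hu hu2

end build

section sel
open scoped Matrix
variable {A : Type} [CommRing A] [IsDomain A] [IsLocalRing A] [IsNoetherianRing A]

lemma dim2_max (hdim : ringKrullDim A = 2) {P P' : Ideal A} (hP : P.IsPrime) (hP' : P'.IsPrime) (h0 : P ≠ ⊥) (hlt : P < P') :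
    P' = maximalIdeal A := by
  by_contra hne
  have h3 : P' < maximalIdeal A := lt_of_le_of_ne (IsLocalRing.le_maximalIdeal hP'.ne_top) hne
  let a0 : PrimeSpectrum A := ⟨⊥, Ideal.isPrime_bot⟩
  let a1 : PrimeSpectrum A := ⟨P, hP⟩
  let a2 : PrimeSpectrum A := ⟨P', hP'⟩
  let a3 : PrimeSpectrum A := ⟨maximalIdeal A, inferInstance⟩
  have l1 : a0 < a1 := (bot_lt_iff_ne_bot.2 h0 : (⊥ : Ideal A) < P)
  have l2 : a1 < a2 := hlt
  have l3 : a2 < a3 := h3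
  let s : LTSeries (PrimeSpectrum A) := LTSeries.mk 3 ![a0, a1, a2, a3] (by
    rw [Fin.strictMono_iff_lt_succ]
    intro i
    fin_cases i
    · exact l1
    · exact l2
    · exact l3)
  have := Order.LTSeries.length_le_krullDim s
  have h4 : ringKrullDim A = Order.krullDim (PrimeSpectrum A) := rfl
  rw [← h4, hdim] at this
  have hs : s.length = 3 := rfl
  rw [hs] at this
  exact absurd this (by decide)

omit [IsDomain A] in
lemma dim2_minprime (hdim : ringKrullDim A = 2) {a : A} {P : Ideal A} (hP : P ∈ (Ideal.span {a}).minimalPrimes) : P ≠ maximalIdeal A := by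
  rintro rfl
  have h1 := Ideal.height_le_one_of_isPrincipal_of_mem_minimalPrimes (Ideal.span {a}) _ hP
  have h2 := IsLocalRing.maximalIdeal_height_eq_ringKrullDim (R := A)
  rw [hdim] at h2
  have h3 : (maximalIdeal A).height = 2 := WithBot.coe_injective h2
  rw [h3] at h1
  exact absurd h1 (by decide)

lemma rad_pair (hdim : ringKrullDim A = 2) {a b : A} (ha : a ≠ 0) (h : ∀ P ∈ (Ideal.span {a}).minimalPrimes, b ∉ P) :
    maximalIdeal A ≤ (Ideal.span {a, b}).radical := by
  rw [Ideal.radical_eq_sInf]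
  refine le_sInf ?_
  rintro P ⟨hPx, hP⟩
  have ha' : a ∈ P := hPx (Ideal.subset_span (by simp))
  have hb' : b ∈ P := hPx (Ideal.subset_span (by simp))
  obtain ⟨P', hP', hle⟩ := Ideal.exists_minimalPrimes_le (I := Ideal.span {a}) (J := P) (by rwa [Ideal.span_singleton_le_iff_mem])
  have : P' < P := lt_of_le_of_ne hle (by rintro rfl; exact h _ hP' hb')
  rw [← dim2_max hdim hP'.1.1 hP (by
    rintro rfl
    exact ha (by simpa using hP'.1.2 (Ideal.mem_span_singleton_self a))) this]

lemma exists_lams (hdim : ringKrullDim A = 2) {Λ : Set A} (hΛ : UnitDiff Λ) (hinf : Λ.Infinite) {n : ℕ} (h : Fin n → A)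
    (hh : maximalIdeal A ≤ (Ideal.span (Set.range h)).radical) (B0 : Set A) (hB0 : (B0 ∩ Λ).Finite) :
    ∃ l : ℕ → A, (∀ i, l i ∈ Λ ∧ l i ∉ B0) ∧ (∀ i j, i < j → l i ≠ l j) ∧ (∀ i, ∑ k : Fin n, l i ^ (k : ℕ) * h k ≠ 0) ∧
      ∀ i j, i < j → maximalIdeal A ≤ (Ideal.span {∑ k : Fin n, l i ^ (k : ℕ) * h k, ∑ k : Fin n, l j ^ (k : ℕ) * h k}).radical := by
  classical
  set H : A → A := fun l => ∑ k : Fin n, l ^ (k : ℕ) * h k with hH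
  have key : ∀ P : Ideal A, P.IsPrime → P ≠ maximalIdeal A → ¬ ∀ i, h i ∈ P := by
    intro P hP hne hall
    apply hne
    have : Ideal.span (Set.range h) ≤ P := by rw [Ideal.span_le]; rintro _ ⟨i, rfl⟩; exact hall i
    have h2 : maximalIdeal A ≤ P := hh.trans ((Ideal.radical_mono this).trans (by rw [hP.radical]))
    exact ((IsLocalRing.maximalIdeal.isMaximal A).eq_of_le hP.ne_top h2).symm
  have hbot : (⊥ : Ideal A) ≠ maximalIdeal A := by
    intro h0
    have : IsField A := IsLocalRing.isField_iff_maximalIdeal_eq.2 h0.symm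
    have := ringKrullDim_eq_zero_of_isField this
    rw [hdim] at this
    exact absurd this (by decide)
  obtain ⟨l, hl1, hl2⟩ := exists_seq_of_forall_finset_exists (fun l => l ∈ Λ ∧ l ∉ B0 ∧ H l ≠ 0)
    (fun a b => a ≠ b ∧ ∀ P ∈ (Ideal.span {H a}).minimalPrimes, H b ∉ P) (by
    intro s hs
    have hfin : ((B0 ∩ Λ) ∪ {l ∈ Λ | H l ∈ (⊥ : Ideal A)} ∪ (s : Set A) ∪ ⋃ a ∈ s, ⋃ P ∈ (Ideal.span {H a}).minimalPrimes, {l ∈ Λ | H l ∈ P}).Finite := by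
      refine ((hB0.union ?_).union s.finite_toSet).union ?_
      · exact avoid_prime hΛ ⊥ h (key ⊥ Ideal.isPrime_bot hbot)
      · refine Set.Finite.biUnion s.finite_toSet fun a _ => ?_
        refine Set.Finite.biUnion (Ideal.finite_minimalPrimes_of_isNoetherianRing A _) fun P hP => ?_
        haveI := hP.1.1
        exact avoid_prime hΛ P h (key P hP.1.1 (dim2_minprime hdim hP))
    obtain ⟨y, hy, hyn⟩ := hinf.exists_notMem_finite hfin
    simp only [Set.mem_union, Set.mem_iUnion, not_or, not_exists] at hyn
    obtain ⟨⟨⟨y1, y2⟩, y3⟩, y4⟩ := hyn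
    refine ⟨y, ⟨hy, fun h => y1 ⟨h, hy⟩, fun h => y2 ⟨hy, by simpa using h⟩⟩, fun x hx => ⟨?_, ?_⟩⟩
    · rintro rfl; exact y3 hx
    · intro P hP h; exact y4 x hx P hP ⟨hy, h⟩)
  exact ⟨l, fun i => ⟨(hl1 i).1, (hl1 i).2.1⟩, fun i j hij => (hl2 i j hij).1, fun i => (hl1 i).2.2,
    fun i j hij => rad_pair hdim (hl1 i).2.2 (hl2 i j hij).2⟩

lemma exists_chg (hdim : ringKrullDim A = 2) {Λ : Set A} (hΛ : UnitDiff Λ) (hinf : Λ.Infinite) {r : ℕ} (τ : Fin (r + 1) → Fin r → A)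
    (hh : maximalIdeal A ≤ (Ideal.span (Set.range (hdet τ))).radical) (B0 : Set A) (hB0 : (B0 ∩ Λ).Finite) :
    ∃ P Q : Matrix (Fin (r + 1)) (Fin (r + 1)) A, P * Qᵀ = 1 ∧ Qᵀ * P = 1 ∧ (∀ i, hdet (chg τ P) i ≠ 0) ∧
      (∀ a b, a ≠ b → maximalIdeal A ≤ (Ideal.span {hdet (chg τ P) a, hdet (chg τ P) b}).radical) ∧
      ∀ i, ∃ l ∈ Λ, l ∉ B0 ∧ ∃ u : A, IsUnit u ∧ hdet (chg τ P) i = u * ∑ k : Fin (r + 1), l ^ (k : ℕ) * hdet τ k := by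
  classical
  obtain ⟨l, h1, h2, h3, h4⟩ := exists_lams hdim hΛ hinf (hdet τ) hh B0 hB0
  let Q : Matrix (Fin (r + 1)) (Fin (r + 1)) A := Matrix.vandermonde fun i : Fin (r + 1) => l i
  have hQ : IsUnit Q.det := by
    rw [Matrix.det_vandermonde]
    refine IsUnit.prod_univ_iff.2 fun i => ?_
    rw [IsUnit.prod_iff]
    intro j hj
    have hij : (i : ℕ) < j := by simpa using hj
    exact hΛ _ (h1 _).1 _ (h1 _).1 (h2 _ _ hij).symm
  let P := (Q⁻¹)ᵀ
  have e1 : P * Qᵀ = 1 := by rw [← Matrix.transpose_mul, Matrix.mul_nonsing_inv _ hQ, Matrix.transpose_one]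
  have e2 : Qᵀ * P = 1 := by rw [← Matrix.transpose_mul, Matrix.nonsing_inv_mul _ hQ, Matrix.transpose_one]
  have hPd : IsUnit P.det := by
    have := congrArg Matrix.det e1
    rw [Matrix.det_mul, Matrix.det_one] at this
    exact IsUnit.of_mul_eq_one _ this
  have hd : ∀ i : Fin (r + 1), hdet (chg τ P) i = P.det * ∑ k : Fin (r + 1), l i ^ (k : ℕ) * hdet τ k := by
    intro i
    rw [hdet_chg τ P Q e1 i]
    rfl
  have hrr : ∀ x y : A, Ideal.span {P.det * x, P.det * y} = Ideal.span {x, y} := by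
    intro x y
    obtain ⟨v, hv⟩ := hPd.exists_left_inv
    refine le_antisymm ?_ ?_ <;> rw [Ideal.span_le] <;> rintro z (rfl | rfl)
    · exact Ideal.mul_mem_left _ _ (Ideal.subset_span (by simp))
    · exact Ideal.mul_mem_left _ _ (Ideal.subset_span (by simp))
    · have := Ideal.mul_mem_left (Ideal.span {P.det * z, P.det * y}) v (Ideal.subset_span (by simp : P.det * z ∈ _))
      rwa [← mul_assoc, hv, one_mul] at this
    · have := Ideal.mul_mem_left (Ideal.span {P.det * x, P.det * z}) v (Ideal.subset_span (by simp : P.det * z ∈ _))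
      rwa [← mul_assoc, hv, one_mul] at this
  refine ⟨P, Q, e1, e2, ?_, ?_, ?_⟩
  · intro i; rw [hd]; exact mul_ne_zero hPd.ne_zero (h3 i)
  · intro a b hab
    rw [hd, hd, hrr]
    rcases lt_or_gt_of_ne hab with h | h
    · exact h4 a b h
    · rw [Set.pair_comm]; exact h4 b a h
  · intro i
    exact ⟨l i, (h1 i).1, (h1 i).2, _, hPd, hd i⟩

variable {r : ℕ} {M : Submodule A (Fin r → A)}
omit [IsDomain A] [IsLocalRing A] [IsNoetherianRing A] in
lemma chg_mem {τ : Fin (r + 1) → Fin r → A} (hτ : ∀ i, τ i ∈ M) (P : Matrix (Fin (r + 1)) (Fin (r + 1)) A) (i) : chg τ P i ∈ M :=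
  sum_mem fun k _ => M.smul_mem _ (hτ k)

omit [IsDomain A] [IsLocalRing A] [IsNoetherianRing A] in
lemma TT_chg {τ : Fin (r + 1) → Fin r → A} (hτ : ∀ i, τ i ∈ M) (P : Matrix (Fin (r + 1)) (Fin (r + 1)) A) (i) :
    TT (chg τ P) (chg_mem hτ P) i = ∑ k, P i k • TT τ hτ k := by
  apply Subtype.ext
  rw [AddSubmonoidClass.coe_finsetSum]
  change emb A r (∑ k, P i k • τ k) = ∑ k, P i k • emb A r (τ k)
  rw [map_sum]
  exact Finset.sum_congr rfl fun k _ => by rw [map_smul]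

omit [IsDomain A] [IsLocalRing A] [IsNoetherianRing A] in
lemma TT_unchg {τ : Fin (r + 1) → Fin r → A} (hτ : ∀ i, τ i ∈ M) (P Q : Matrix (Fin (r + 1)) (Fin (r + 1)) A) (h : Qᵀ * P = 1) (i) :
    TT τ hτ i = ∑ k, Q k i • TT (chg τ P) (chg_mem hτ P) k := by
  have h1 := TT_chg (chg_mem hτ P) (Qᵀ) i
  have h2 : chg (chg τ P) Qᵀ = τ := chg_chg τ P Qᵀ h
  have h3 : TT (chg (chg τ P) Qᵀ) (chg_mem (chg_mem hτ P) Qᵀ) i = TT τ hτ i := by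
    apply Subtype.ext
    change emb A r (chg (chg τ P) Qᵀ i) = emb A r (τ i)
    rw [h2]
  rw [← h3, h1]; rfl

omit [IsDomain A] [IsLocalRing A] [IsNoetherianRing A] in
lemma Redn_chg {τ : Fin (r + 1) → Fin r → A} {hτ : ∀ i, τ i ∈ M} (P Q : Matrix (Fin (r + 1)) (Fin (r + 1)) A) (h : Qᵀ * P = 1)
    (hred : Redn τ hτ) : Redn (chg τ P) (chg_mem hτ P) := by
  obtain ⟨n, hn⟩ := hred
  refine ⟨n, fun x hx => ?_⟩
  have : Ideal.span (Set.range (TT τ hτ)) ≤ Ideal.span (Set.range (TT (chg τ P) (chg_mem hτ P))) := by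
    rw [Ideal.span_le]
    rintro _ ⟨i, rfl⟩
    rw [TT_unchg hτ P Q h i]
    refine sum_mem fun k _ => ?_
    rw [Algebra.smul_def]
    exact Ideal.mul_mem_left _ _ (Ideal.subset_span ⟨k, rfl⟩)
  exact this (hn x hx)
end sel

section val

lemma integral_of_val {A S : Type} [CommRing A] [CommRing S] [IsDomain S] [Algebra A S] (R0 : Subalgebra A S) (s : S)
    (h : ∀ V : ValuationSubring (FractionRing S), (∀ x ∈ R0, algebraMap S (FractionRing S) x ∈ V) → algebraMap S (FractionRing S) s ∈ V) :
    IsIntegral R0 s := by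
  have hinj : Function.Injective (algebraMap S (FractionRing S)) := IsFractionRing.injective S _
  rw [← isIntegral_algebraMap_iff (A := S) (B := FractionRing S) hinj]
  by_contra hs
  let C : Subring (FractionRing S) := (integralClosure R0 (FractionRing S)).toSubring
  haveI : IsIntegrallyClosedIn C (FractionRing S) := by
    rw [Subring.isIntegrallyClosedIn_iff]
    intro x hx
    exact isIntegral_trans (R := R0) (A := integralClosure R0 (FractionRing S)) x hx
  obtain ⟨V, hV, hsV⟩ := Subring.exists_le_valuationSubring_of_isIntegrallyClosedIn (R := C) (x := algebraMap S (FractionRing S) s) hs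
  apply hsV
  apply h V
  intro x hx
  apply hV
  exact isIntegral_algebraMap (R := R0) (A := FractionRing S) (x := ⟨x, hx⟩)

lemma val_ideal {A K : Type} [CommRing A] [IsNoetherianRing A] [Field K] [Algebra A K] (V : ValuationSubring K)
    (hV : ∀ a : A, algebraMap A K a ∈ V) (I : Ideal A) (f g : A) (hf : f ∈ I) (hfA : algebraMap A K f ≠ 0)
    (hfg : algebraMap A K f / algebraMap A K g ∈ V) (hg0 : algebraMap A K g ≠ 0)
    (hI : I ^ 3 ≤ Ideal.span {f, g} * I ^ 2) : ∀ z ∈ I, algebraMap A K z / algebraMap A K g ∈ V := by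
  intro z hz
  let N : Submodule V K := Submodule.span V (algebraMap A K '' (I ^ 2 : Ideal A))
  have hN : ∀ y ∈ I ^ 2, algebraMap A K y ∈ N := fun y hy => Submodule.subset_span ⟨y, hy, rfl⟩
  have hint : IsIntegral V (algebraMap A K z / algebraMap A K g) := by
    refine isIntegral_of_smul_mem_submodule (M := K) N ?_ ?_ _ ?_
    · intro h0
      have := hN (f ^ 2) (Ideal.pow_mem_pow hf 2)
      rw [h0, Submodule.mem_bot, map_pow] at this
      exact pow_ne_zero 2 hfA this
    · obtain ⟨s, hs⟩ := (isNoetherian_def.1 (inferInstance : IsNoetherian A A) (I ^ 2))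
      classical
      refine ⟨s.image (algebraMap A K), ?_⟩
      apply le_antisymm
      · rw [Submodule.span_le]
        intro x hx
        obtain ⟨y, hy, rfl⟩ := Finset.mem_image.1 (Finset.mem_coe.1 hx)
        exact hN y (hs ▸ Submodule.subset_span hy)
      · rw [Submodule.span_le]
        rintro _ ⟨y, hy, rfl⟩
        replace hy : y ∈ Submodule.span A (s : Set A) := by rw [hs]; exact hy
        induction hy using Submodule.span_induction with
        | mem x hx => exact Submodule.subset_span (by simpa using ⟨x, hx, rfl⟩)
        | zero => rw [map_zero]; exact zero_mem _
        | add x y _ _ hx hy => rw [map_add]; exact add_mem hx hy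
        | smul a x _ hx =>
          rw [smul_eq_mul, map_mul]
          exact Submodule.smul_mem _ (⟨algebraMap A K a, hV a⟩ : V) hx
    · intro n hn
      induction hn using Submodule.span_induction with
      | mem x hx =>
        obtain ⟨y, hy, rfl⟩ := hx
        have h3 : z * y ∈ Ideal.span {f, g} * I ^ 2 := hI (by rw [pow_succ']; exact Ideal.mul_mem_mul hz hy)
        have h4 : ∀ w ∈ Ideal.span {f, g} * I ^ 2, algebraMap A K w / algebraMap A K g ∈ N := by
          intro w hw
          refine Submodule.mul_induction_on hw ?_ ?_
          · intro c hc y hy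
            obtain ⟨a, b, rfl⟩ := Ideal.mem_span_pair.1 hc
            have : algebraMap A K ((a * f + b * g) * y) / algebraMap A K g =
              (⟨_, hfg⟩ : V) • algebraMap A K (a * y) + algebraMap A K (b * y) := by
              change _ = (algebraMap A K f / algebraMap A K g) * _ + _
              rw [map_mul, map_add, map_mul, map_mul, map_mul, map_mul]
              field_simp
            rw [this]
            exact add_mem (Submodule.smul_mem _ _ (hN _ (Ideal.mul_mem_left _ _ hy))) (hN _ (Ideal.mul_mem_left _ _ hy))
          · intro x y hx hy
            rw [map_add, add_div]; exact add_mem hx hy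
        have := h4 _ h3
        rw [map_mul] at this
        rwa [smul_eq_mul, div_mul_eq_mul_div]
      | zero => rw [smul_zero]; exact zero_mem _
      | add x y _ _ hx hy => rw [smul_add]; exact add_mem hx hy
      | smul a x _ hx => rw [smul_comm]; exact Submodule.smul_mem _ _ hx
  obtain ⟨y, hy⟩ := IsIntegrallyClosed.isIntegral_iff.1 hint
  rw [← hy]; exact y.2

/-- generic minimal valuation -/
lemma val_min {A K : Type} [CommRing A] [Field K] [Algebra A K] {Λ : Set A} (hΛ : UnitDiff Λ) (V : ValuationSubring K)
    (hV : ∀ a : A, algebraMap A K a ∈ V) {n : ℕ} (h : Fin n → A) (h0 : ∃ k, algebraMap A K (h k) ≠ 0) :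
    ∃ B0 : Set A, (B0 ∩ Λ).Finite ∧ ∀ l l', l ∈ Λ → l' ∈ Λ → l ∉ B0 → l' ∉ B0 →
      algebraMap A K (∑ k : Fin n, l ^ (k : ℕ) * h k) / algebraMap A K (∑ k : Fin n, l' ^ (k : ℕ) * h k) ∈ V := by
  classical
  obtain ⟨k1, hk1⟩ := h0
  obtain ⟨k0, -, hk0⟩ := Finset.exists_max_image Finset.univ (fun k => V.valuation (algebraMap A K (h k))) ⟨k1, Finset.mem_univ _⟩
  set e := algebraMap A K (h k0) with he
  have he0 : e ≠ 0 := by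
    intro h0
    have := hk0 k1 (Finset.mem_univ _)
    rw [h0, map_zero] at this
    exact hk1 ((map_eq_zero _).1 (le_zero_iff.1 this))
  have hx : ∀ k, algebraMap A K (h k) / e ∈ V := by
    intro k
    rw [← V.valuation_le_one_iff, map_div₀]
    have hpos : 0 < V.valuation e := zero_lt_iff.2 ((map_ne_zero _).2 he0)
    exact (div_le_one₀ hpos).2 (hk0 k (Finset.mem_univ _))
  let x : Fin n → V := fun k => ⟨_, hx k⟩
  let g0 : A →+* V := (algebraMap A K).codRestrict V.toSubring hV
  let g : A →+* ResidueField V := (residue V).comp g0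
  refine ⟨{l | ∑ k : Fin n, g l ^ (k : ℕ) * residue V (x k) = 0}, ?_, ?_⟩
  · have := avoid_field hΛ g (fun k => residue V (x k)) (by
      intro hall
      have h1 : x k0 = 1 := Subtype.ext (div_self he0)
      have := hall k0
      rw [h1, map_one] at this
      exact one_ne_zero this)
    refine this.subset ?_
    rintro l ⟨h1, h2⟩
    exact ⟨h2, h1⟩
  · have key : ∀ l, ¬ (∑ k : Fin n, g l ^ (k : ℕ) * residue V (x k) = 0) → ∃ u : V, IsUnit u ∧
        algebraMap A K (∑ k : Fin n, l ^ (k : ℕ) * h k) = u * e := by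
      intro l hl
      refine ⟨∑ k : Fin n, g0 l ^ (k : ℕ) * x k, ?_, ?_⟩
      · rw [← residue_ne_zero_iff_isUnit, map_sum]
        simpa [g] using hl
      · rw [map_sum, AddSubmonoidClass.coe_finsetSum, Finset.sum_mul]
        refine Finset.sum_congr rfl fun k _ => ?_
        rw [map_mul, map_pow]
        change _ = algebraMap A K l ^ (k : ℕ) * (algebraMap A K (h k) / e) * e
        field_simp
    intro l l' _ _ hl hl'
    obtain ⟨u, hu, h1⟩ := key l hl
    obtain ⟨u', hu', h2⟩ := key l' hl'
    rw [h1, h2]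
    obtain ⟨v, hv⟩ := hu'.exists_right_inv
    have hv' : (u' : K) * v = 1 := congrArg Subtype.val hv
    have hu0 : (u' : K) ≠ 0 := left_ne_zero_of_mul_eq_one hv'
    have : (u : K) * e / (u' * e) = u * v := by
      rw [mul_div_mul_right _ _ he0, div_eq_iff hu0, mul_assoc, mul_comm (v : K), hv', mul_one]
    rw [this]
    exact V.mul_mem _ _ u.2 v.2
end val

section inj
open scoped Matrix
variable {A : Type} [CommRing A] {r : ℕ} {M : Submodule A (Fin r → A)}

lemma gr_pow (n : ℕ) : gr A r M n = gr A r M 1 ^ n := by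
  induction n with
  | zero =>
    rw [pow_zero]
    apply le_antisymm
    · intro x hx
      obtain ⟨c, rfl⟩ := gr_zero A r M x hx
      exact Submodule.mem_one.2 ⟨c, rfl⟩
    · intro x hx
      obtain ⟨c, rfl⟩ := Submodule.mem_one.1 hx
      exact SetLike.algebraMap_mem_graded (gr A r M) c
  | succ n ih => rw [gr_gen, ih, pow_succ']

/-- the ideal `I` -/
noncomputable def Iab (M : Submodule A (Fin r → A)) (τ : Fin (r + 1) → Fin r → A) (a b : Fin (r + 1)) : Ideal A :=
  (gr A r M 1).map ((phiAlg τ a b).comp (reesAlg A r M).val).toLinearMap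

lemma Iab_pow (τ : Fin (r + 1) → Fin r → A) (a b : Fin (r + 1)) (n : ℕ) {z : A} :
    z ∈ Iab M τ a b ^ n ↔ ∃ w ∈ gr A r M n, phiAlg τ a b (w : MvPolynomial (Fin r) A) = z := by
  have : Iab M τ a b ^ n = (gr A r M n).map ((phiAlg τ a b).comp (reesAlg A r M).val).toLinearMap := by
    rw [gr_pow, Submodule.map_pow]; rfl
  rw [this]; rfl

variable [IsDomain A] [IsLocalRing A] [IsNoetherianRing A]

lemma X_univ_coef {τ : Fin (r + 1) → Fin r → A} {hτ : ∀ i, τ i ∈ M} {n : ℕ} {w : ↥(reesAlg A r M)} (hw : w ∈ gr A r M (n + 1))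
    (h : w ∈ Ideal.span (Set.range (TT τ hτ))) : ∃ c : Fin (r + 1) → ↥(reesAlg A r M), (∀ i, c i ∈ gr A r M n) ∧ w = ∑ i, c i * TT τ hτ i := by
  obtain ⟨c, hc⟩ := (Ideal.mem_span_range_iff_exists_fun).1 h
  refine ⟨fun i => pr (gr A r M) n (c i), fun i => pr_mem _ _ _, ?_⟩
  have := congrArg (pr (gr A r M) (n + 1)) hc
  rw [pr_same _ hw] at this
  rw [← this]
  refine (map_sum ((GradedRing.proj (gr A r M) (n + 1))) _ _).trans ?_
  refine Finset.sum_congr rfl fun i _ => ?_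
  change pr (gr A r M) (n + 1) _ = _
  rw [mul_comm, add_comm n 1, pr_mul (gr A r M) (TT_mem τ hτ i), mul_comm]

/-- single valuation step -/
lemma inj_val (hr : 0 < r) (dep : DepthTwo A) {τ : Fin (r + 1) → Fin r → A} {hτ : ∀ i, τ i ∈ M}
    (D : Sys (gr A r M) (gradedMax A r M) (TT τ hτ) (hdet τ) (fun a b => (phiAlg τ a b).comp (reesAlg A r M).val))
    (hrad : ∀ a b, a ≠ b → maximalIdeal A ≤ (Ideal.span {hdet τ a, hdet τ b}).radical)
    (V : ValuationSubring (FractionRing (MvPolynomial (Fin r) A)))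
    (hV : ∀ x ∈ reesAlg A r M, algebraMap _ (FractionRing (MvPolynomial (Fin r) A)) x ∈ V)
    (hmin : ∀ a b, algebraMap A (FractionRing (MvPolynomial (Fin r) A)) (hdet τ a) / algebraMap A _ (hdet τ b) ∈ V)
    (s : Fin (r + 1) → Fin r → A) (hs : ∑ i, emb A r (τ i) * emb A r (s i) ∈ sub1 A r M ^ 2) (a : Fin (r + 1)) :
    algebraMap _ (FractionRing (MvPolynomial (Fin r) A)) (emb A r (s a)) ∈ V := by
  classical
  haveI : Nontrivial (Fin (r + 1)) := Fin.nontrivial_iff_two_le.2 (by omega)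
  set K := FractionRing (MvPolynomial (Fin r) A)
  set ρ := algebraMap A K with hρ
  have hρ' : ∀ x, ρ x = algebraMap (MvPolynomial (Fin r) A) K (algebraMap A _ x) := fun x => IsScalarTower.algebraMap_apply _ _ _ x
  have hinj : Function.Injective ρ := by
    intro x y hxy
    rw [hρ', hρ'] at hxy
    exact MvPolynomial.C_injective _ _ (IsFractionRing.injective (MvPolynomial (Fin r) A) K hxy)
  have hVA : ∀ x : A, ρ x ∈ V := by
    intro x; rw [hρ']; exact hV _ ((reesAlg A r M).algebraMap_mem x)
  have h0 : ∀ i, ρ (hdet τ i) ≠ 0 := fun i => (map_ne_zero_iff _ hinj).2 (D.hne i)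
  have key : ∀ b, b ≠ a → ρ (Phi τ a b (s a)) / ρ (hdet τ a) ∈ V := by
    intro b hba
    have hab := hba.symm
    have hIred : ∀ n, 2 ≤ n → Iab M τ a b ^ (n + 1) ≤ Ideal.span {hdet τ b, hdet τ a} * Iab M τ a b ^ n := by
      intro n hn z hz
      obtain ⟨w, hw, rfl⟩ := (Iab_pow τ a b _).1 hz
      have h1 : w ∈ Ideal.span (Set.range (TT τ hτ)) := by
        have := D.P3 (n := n + 1) (by omega) hw
        rwa [Sys.X, Set.image_univ] at this
      obtain ⟨c, hc, rfl⟩ := X_univ_coef hw h1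
      have : phiAlg τ a b ((∑ i, c i * TT τ hτ i : ↥(reesAlg A r M)) : MvPolynomial (Fin r) A)
          = ∑ i, phiAlg τ a b (c i : MvPolynomial (Fin r) A) * phiAlg τ a b (TT τ hτ i : MvPolynomial (Fin r) A) := by
        rw [AddSubmonoidClass.coe_finsetSum, map_sum]
        exact Finset.sum_congr rfl fun i _ => by rw [MulMemClass.coe_mul, map_mul]
      rw [this]
      refine sum_mem fun i _ => ?_
      rw [mul_comm (phiAlg τ a b (c i : MvPolynomial (Fin r) A))]
      refine Ideal.mul_mem_mul ?_ ((Iab_pow τ a b n).2 ⟨_, hc i, rfl⟩)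
      by_cases hia : i = a
      · rw [hia]
        have := D.φ1 a b hab
        change phiAlg τ a b (TT τ hτ a : MvPolynomial (Fin r) A) = _ at this
        rw [this]; exact Ideal.subset_span (by simp)
      by_cases hib : i = b
      · rw [hib]
        have := D.φ2 a b hab
        change phiAlg τ a b (TT τ hτ b : MvPolynomial (Fin r) A) = _ at this
        rw [this]; exact neg_mem (Ideal.subset_span (by simp))
      · have := D.φ3 a b i hia hib
        change phiAlg τ a b (TT τ hτ i : MvPolynomial (Fin r) A) = _ at this
        rw [this]; exact zero_mem _
    have hfI : hdet τ b ∈ Iab M τ a b := by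
      rw [← pow_one (Iab M τ a b)]
      exact (Iab_pow τ a b 1).2 ⟨_, TT_mem τ hτ a, D.φ1 a b hab⟩
    have hgI : hdet τ a ∈ Iab M τ a b := by
      rw [← pow_one (Iab M τ a b)]
      refine (Iab_pow τ a b 1).2 ⟨-TT τ hτ b, neg_mem (TT_mem τ hτ b), ?_⟩
      have := D.φ2 a b hab
      change phiAlg τ a b (TT τ hτ b : MvPolynomial (Fin r) A) = _ at this
      rw [NegMemClass.coe_neg, map_neg, this, neg_neg]
    refine Chain.chain (K := K) (Iab M τ a b) (hdet τ b) (hdet τ a) (Phi τ a b (s a)) (Phi τ a b (s b)) hfI hgI (h0 b) (h0 a) hIred ?_ ?_ V hVA ?_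
    · rintro x ⟨k, z, hz⟩ ⟨k', z', hz'⟩
      have h1 : hdet τ b ^ k * z' = hdet τ a ^ k' * z := by
        apply hinj
        rw [map_mul, map_mul, map_pow, map_pow, ← hz, ← hz']; ring
      obtain ⟨y, hy⟩ := dep.coprime_pow (hrad b a hba) (D.hne b) k k' ⟨z', h1.symm⟩
      refine ⟨y, mul_left_cancel₀ (pow_ne_zero k (h0 b)) ?_⟩
      rw [hz, hy, map_mul, map_pow]
    · have h2 : ∑ i, emb A r (τ i) * emb A r (s i) ∈ reesAlg A r M := sub1_pow_le A r M 2 _ hs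
      refine (Iab_pow τ a b 2).2 ⟨⟨_, h2⟩, (mem_gr' A r M).2 hs, ?_⟩
      change phiAlg τ a b (∑ i, emb A r (τ i) * emb A r (s i)) = _
      rw [map_sum]
      have e1 : ∀ i, phiAlg τ a b (emb A r (τ i) * emb A r (s i)) = Phi τ a b (τ i) * Phi τ a b (s i) := by
        intro i; rw [map_mul, phiAlg_emb, phiAlg_emb]
      simp only [e1]
      rw [← Finset.add_sum_erase _ _ (Finset.mem_univ a), ← Finset.add_sum_erase _ _ (Finset.mem_erase.2 ⟨hba, Finset.mem_univ b⟩),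
        Finset.sum_eq_zero, Phi_self τ hab, Phi_anti τ b a (τ b), Phi_self τ hba]
      · ring
      · intro i hi
        simp only [Finset.mem_erase] at hi
        rw [Phi_other τ hi.2.1 hi.1, zero_mul]
    · exact val_ideal V hVA _ _ _ hfI (h0 b) (hmin b a) (h0 a) (hIred 2 le_rfl)
  have h3 := congrArg (algebraMap (MvPolynomial (Fin r) A) K) (emb_cr τ (s a) a)
  rw [Algebra.smul_def, map_mul, ← hρ', map_sum] at h3
  have h4 : algebraMap (MvPolynomial (Fin r) A) K (emb A r (s a)) =
      ∑ j ∈ Finset.univ.erase a, - (ρ (Phi τ a j (s a)) / ρ (hdet τ a)) * algebraMap _ K (emb A r (τ j)) := by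
    apply mul_left_cancel₀ (h0 a)
    rw [h3, Finset.mul_sum]
    refine Finset.sum_congr rfl fun j _ => ?_
    rw [Algebra.smul_def, map_mul, ← hρ', Phi_anti τ a j, map_neg]
    have := h0 a
    have e3 : ρ (hdet τ a) * (ρ (Phi τ a j (s a)) / ρ (hdet τ a)) = ρ (Phi τ a j (s a)) := mul_div_cancel₀ _ this
    linear_combination (algebraMap (MvPolynomial (Fin r) A) K (emb A r (τ j))) * e3
  rw [h4]
  refine sum_mem fun j hj => ?_
  refine V.mul_mem _ _ (V.neg_mem _ (key j (Finset.mem_erase.1 hj).1)) (hV _ (TT τ hτ j).2)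

theorem inj_main (hdim : ringKrullDim A = 2) (hr : 0 < r) (dep : DepthTwo A) {Λ : Set A} (hΛ : UnitDiff Λ) (hinf : Λ.Infinite)
    (hB : IsBuchsbaumLocalRing (Localization.AtPrime (gradedMax A r M)))
    (he : ringKrullDim (Localization.AtPrime (gradedMax A r M)) = (r + 2 : ℕ))
    {τ : Fin (r + 1) → Fin r → A} {hτ : ∀ i, τ i ∈ M} (hred : Redn τ hτ)
    (hhm : ∀ i, hdet τ i ∈ maximalIdeal A) (hne : ∀ i, hdet τ i ≠ 0)
    (hh : maximalIdeal A ≤ (Ideal.span (Set.range (hdet τ))).radical)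
    (s : Fin (r + 1) → Fin r → A) (hs : ∑ i, emb A r (τ i) * emb A r (s i) ∈ sub1 A r M ^ 2) (a : Fin (r + 1)) :
    IsIntegral (reesAlg A r M) (emb A r (s a)) := by
  classical
  apply integral_of_val
  intro V hV
  set K := FractionRing (MvPolynomial (Fin r) A)
  set ρ := algebraMap A K with hρ
  have hρ' : ∀ x, ρ x = algebraMap (MvPolynomial (Fin r) A) K (algebraMap A _ x) := fun x => IsScalarTower.algebraMap_apply _ _ _ x
  have hinj : Function.Injective ρ := by
    intro x y hxy
    rw [hρ', hρ'] at hxy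
    exact MvPolynomial.C_injective _ _ (IsFractionRing.injective (MvPolynomial (Fin r) A) K hxy)
  have hVA : ∀ x : A, ρ x ∈ V := by
    intro x; rw [hρ']; exact hV _ ((reesAlg A r M).algebraMap_mem x)
  obtain ⟨B0, hB0, hval⟩ := val_min hΛ V hVA (hdet τ) ⟨0, (map_ne_zero_iff _ hinj).2 (hne 0)⟩
  obtain ⟨P, Q, hPQ, hQP, hne', hrad', hl⟩ := exists_chg hdim hΛ hinf τ hh B0 hB0
  have hhm' : ∀ i, hdet (chg τ P) i ∈ maximalIdeal A := by
    intro i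
    obtain ⟨l, -, -, u, -, hu⟩ := hl i
    rw [hu]
    exact Ideal.mul_mem_left _ _ (sum_mem fun k _ => Ideal.mul_mem_left _ _ (hhm k))
  have D := build_sys dep hB he (chg τ P) (chg_mem hτ P) (Redn_chg P Q hQP hred) hhm' hne' hrad'
  have hmin : ∀ a b, ρ (hdet (chg τ P) a) / ρ (hdet (chg τ P) b) ∈ V := by
    intro a b
    obtain ⟨l, h1, h2, u, -, hu⟩ := hl a
    obtain ⟨l', h1', h2', u', hu'', hu'⟩ := hl b
    obtain ⟨v, hv⟩ := hu''.exists_right_inv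
    have hv1 : ρ u' * ρ v = 1 := by rw [← map_mul, hv, map_one]
    have hu0 : ρ u' ≠ 0 := left_ne_zero_of_mul_eq_one hv1
    have : ρ (hdet (chg τ P) a) / ρ (hdet (chg τ P) b) = ρ u * ρ v *
       (ρ (∑ k : Fin (r + 1), l ^ (k : ℕ) * hdet τ k) / ρ (∑ k : Fin (r + 1), l' ^ (k : ℕ) * hdet τ k)) := by
      rw [hu, hu', map_mul, map_mul, mul_div_mul_comm]
      congr 1
      rw [div_eq_iff hu0, mul_assoc, mul_comm (ρ v), hv1, mul_one]
    rw [this]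
    exact V.mul_mem _ _ (V.mul_mem _ _ (hVA _) (hVA _)) (hval l l' h1 h1' h2 h2')
  let s' : Fin (r + 1) → Fin r → A := fun k => ∑ i, Q k i • s i
  have hs' : ∑ k, emb A r (chg τ P k) * emb A r (s' k) ∈ sub1 A r M ^ 2 := by
    have : ∑ k, emb A r (chg τ P k) * emb A r (s' k) = ∑ i, emb A r (τ i) * emb A r (s i) := by
      have e1 : ∀ i, emb A r (τ i) = ∑ k, Q k i • emb A r (chg τ P k) := by
        intro i
        have := congrArg Subtype.val (TT_unchg hτ P Q hQP i)
        rw [AddSubmonoidClass.coe_finsetSum] at this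
        exact this
      simp only [s', map_sum, map_smul]
      simp only [e1, Finset.mul_sum, Finset.sum_mul]
      rw [Finset.sum_comm]
      refine Finset.sum_congr rfl fun i _ => Finset.sum_congr rfl fun k _ => ?_
      rw [Algebra.smul_def, Algebra.smul_def]; ring
    rw [this]; exact hs
  have hV' := inj_val hr dep D hrad' V hV hmin s' hs'
  have h5 : emb A r (s a) = ∑ k, P k a • emb A r (s' k) := by
    rw [← Fintype.linearCombination_apply]
    have : s a = ∑ k, P k a • s' k := by
      simp only [s', Finset.smul_sum, smul_smul]
      rw [Finset.sum_comm]
      have e2 : ∀ i, ∑ k, P k a * Q k i = if i = a then 1 else 0 := by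
        intro i
        have := congrFun (congrFun hQP i) a
        rw [Matrix.mul_apply, Matrix.one_apply] at this
        rw [← this]
        exact Finset.sum_congr rfl fun k _ => by rw [mul_comm]; rfl
      simp only [← Finset.sum_smul, e2]
      simp
    conv_lhs => rw [this, map_sum]
    rw [Fintype.linearCombination_apply]
    exact Finset.sum_congr rfl fun k _ => by rw [map_smul]
  rw [h5, map_sum]
  refine sum_mem fun k _ => ?_
  rw [Algebra.smul_def, map_mul, ← hρ']
  exact V.mul_mem _ _ (hVA _) (hV' k)
end inj

section nsys
variable {A : Type} [CommRing A] {r : ℕ} {M : Submodule A (Fin r → A)}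

lemma emb_inj : Function.Injective (emb A r) := by
  intro v w h
  ext i
  have e : ∀ v : Fin r → A, coeff (Finsupp.single i 1) (emb A r v) = v i := by
    classical
    intro v
    rw [emb, Fintype.linearCombination_apply, coeff_sum, Finset.sum_eq_single i]
    · simp
    · intro j _ hj
      rw [coeff_smul, coeff_X', if_neg, smul_zero]
      intro h
      exact hj (by simpa using (Finsupp.single_left_inj one_ne_zero).1 h)
    · simp
  rw [← e v, ← e w, h]

lemma mem_freeSub {x : MvPolynomial (Fin r) A} : x ∈ freeSub A r ↔ ∃ w, emb A r w = x := by
  constructor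
  · rintro ⟨w, _, rfl⟩; exact ⟨w, rfl⟩
  · rintro ⟨w, rfl⟩; exact ⟨w, trivial, rfl⟩

lemma mem_barPow {x : MvPolynomial (Fin r) A} : x ∈ barPow A r M 1 ↔ x ∈ freeSub A r ∧ IsIntegral (reesAlg A r M) x := by
  rw [barPow, pow_one]; rfl

variable [IsDomain A] [IsLocalRing A] [IsNoetherianRing A]

lemma RR_le (hr : 0 < r) {τ : Fin (r + 1) → Fin r → A} {hτ : ∀ i, τ i ∈ M}
    (D : Sys (gr A r M) (gradedMax A r M) (TT τ hτ) (hdet τ) (fun a b => (phiAlg τ a b).comp (reesAlg A r M).val))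
    {x : MvPolynomial (Fin r) A} (hx : x ∈ ratliffRush A r (freeSub A r) (sub1 A r M)) :
    ∀ t ∈ gradedMax A r M, (t : MvPolynomial (Fin r) A) * x ∈ reesAlg A r M := by
  classical
  let Kx : Submodule A (MvPolynomial (Fin r) A) :=
    { carrier := {x | ∀ t ∈ gradedMax A r M, (t : MvPolynomial (Fin r) A) * x ∈ reesAlg A r M}
      add_mem' := fun {x y} hx hy t ht => by rw [mul_add]; exact add_mem (hx t ht) (hy t ht)
      zero_mem' := fun t _ => by rw [mul_zero]; exact zero_mem _
      smul_mem' := fun c x hx t ht => by rw [mul_smul_comm]; exact Subalgebra.smul_mem _ (hx t ht) c }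
  have : ratliffRush A r (freeSub A r) (sub1 A r M) ≤ Kx := by
    refine iSup_le fun l => ?_
    rintro x ⟨hxF, hx⟩ t ht
    obtain ⟨w, rfl⟩ := mem_freeSub.1 hxF
    let a : Fin (r + 1) := 0
    let b : Fin (r + 1) := Fin.last r
    have hab : a ≠ b := by
      intro h
      have := congrArg Fin.val h
      simp [a, b] at this; omega
    let u : ↥(reesAlg A r M) := ∑ j ∈ Finset.univ.erase b, Phi τ j b w • TT τ hτ j
    have hu : (u : MvPolynomial (Fin r) A) = hdet τ b • emb A r w := by
      rw [emb_cr, AddSubmonoidClass.coe_finsetSum]; rfl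
    have hTl : (TT τ hτ b ^ (l + 1) : ↥(reesAlg A r M)) ∈ gr A r M (l + 1) := Cut1.powmem (TT_mem τ hτ b) (l + 1)
    have hTx : emb A r w * ((TT τ hτ b ^ (l + 1) : ↥(reesAlg A r M)) : MvPolynomial (Fin r) A) ∈ sub1 A r M ^ (l + 2) :=
      Submodule.mem_div_iff_forall_mul_mem.1 hx _ ((mem_gr' A r M).1 hTl)
    let v : ↥(reesAlg A r M) := ⟨_, sub1_pow_le A r M _ _ hTx⟩
    have huv : TT τ hτ b ^ (l + 1) * u = algebraMap A _ (hdet τ b) * v := by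
      apply Subtype.ext
      rw [MulMemClass.coe_mul, hu, MulMemClass.coe_mul, Algebra.smul_def]
      change _ = algebraMap A _ (hdet τ b) * (emb A r w * _)
      ring
    let k : Option (Fin (r + 1)) → ℕ := fun o => if o = some b then l + 1 else 1
    have hspan : Ideal.span ((fun o => yb (TT τ hτ) (hdet τ) b o ^ k o) '' {none}) = Ideal.span {algebraMap A ↥(reesAlg A r M) (hdet τ b)} := by
      rw [Set.image_singleton]
      congr 2
      simp [k, yb]
    have := D.W a b hab k (fun o => by simp only [k]; split_ifs <;> omega) {none} (by simp) (some b) (by simp) (by simpa using hab.symm) u (by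
      rw [hspan]
      have e : yb (TT τ hτ) (hdet τ) b (some b) ^ k (some b) = TT τ hτ b ^ (l + 1) := by simp [k, yb]
      rw [e, huv]
      exact Ideal.mul_mem_right _ _ (Ideal.mem_span_singleton_self _))
    rw [hspan] at this
    obtain ⟨c, hc⟩ := Ideal.mem_span_singleton.1 (this t ht)
    have hc' := congrArg Subtype.val hc
    rw [MulMemClass.coe_mul, hu, MulMemClass.coe_mul] at hc'
    have h2 : (t : MvPolynomial (Fin r) A) * emb A r w = c := by
      have h0 : algebraMap A (MvPolynomial (Fin r) A) (hdet τ b) ≠ 0 := by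
        rw [MvPolynomial.algebraMap_eq, Ne, MvPolynomial.C_eq_zero]; exact D.hne b
      apply mul_left_cancel₀ h0
      rw [Algebra.smul_def] at hc'
      change _ = algebraMap A (MvPolynomial (Fin r) A) (hdet τ b) * (c : MvPolynomial (Fin r) A) at hc'
      rw [← hc']; ring
    rw [h2]; exact c.2
  exact this hx

theorem build_nsys (hdim : ringKrullDim A = 2) (hr : 0 < r) (dep : DepthTwo A) {Λ : Set A} (hΛ : UnitDiff Λ) (hinf : Λ.Infinite)
    {p q : A} (hpq : Ideal.span {p, q} = maximalIdeal A) (hpp : (Ideal.span {p}).IsPrime) (hp0 : p ≠ 0) (hqp : q ∉ Ideal.span {p})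
    (hB : IsBuchsbaumLocalRing (Localization.AtPrime (gradedMax A r M)))
    (he : ringKrullDim (Localization.AtPrime (gradedMax A r M)) = (r + 2 : ℕ))
    (h1 : ratliffRush A r (freeSub A r) (sub1 A r M) = barPow A r M 1)
    (hG : ∀ f : Fin r → ↥(reesAlg A r M), (∀ i, f i ∈ gradedMax A r M) → ¬ gradedMax A r M ≤ (Ideal.map (algebraMap A _) (maximalIdeal A) ⊔ Ideal.span (Set.range f)).radical)
    {τ : Fin (r + 1) → Fin r → A} {hτ : ∀ i, τ i ∈ M} (hred : Redn τ hτ)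
    (hhm : ∀ i, hdet τ i ∈ maximalIdeal A) (hne : ∀ i, hdet τ i ≠ 0)
    (hrad : ∀ a b, a ≠ b → maximalIdeal A ≤ (Ideal.span {hdet τ a, hdet τ b}).radical)
    (hh : maximalIdeal A ≤ (Ideal.span (Set.range (hdet τ))).radical) :
    NSys (𝒜 := gr A r M) (gradedMax A r M) (TT τ hτ) (hdet τ) (reesAlg A r M).val (phiAlg τ) (freeSub A r) (barPow A r M 1) p q := by
  classical
  have D := build_sys dep hB he τ hτ hred hhm hne hrad
  have hmQ : ∀ t ∈ maximalIdeal A, algebraMap A ↥(reesAlg A r M) t ∈ gradedMax A r M := by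
    intro t ht
    rw [mem_gradedMax]; simpa [MvPolynomial.algebraMap_eq] using ht
  have hRR : ∀ x ∈ barPow A r M 1, ∀ t ∈ gradedMax A r M, (t : MvPolynomial (Fin r) A) * x ∈ reesAlg A r M := by
    intro x hx
    rw [← h1] at hx
    exact RR_le hr D hx
  have hNhom : ∀ x ∈ barPow A r M 1, x.IsHomogeneous 1 := by
    intro x hx
    obtain ⟨w, rfl⟩ := mem_freeSub.1 (mem_barPow.1 hx).1
    exact emb_hom A r w
  have hN1 : ∀ x ∈ barPow A r M 1, ∀ t ∈ maximalIdeal A, ∃ y ∈ gr A r M 1, (reesAlg A r M).val y = t • x := by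
    intro x hx t ht
    have h := hRR x hx _ (hmQ t ht)
    refine ⟨⟨_, h⟩, ?_, ?_⟩
    · rw [mem_gr]
      have := (MvPolynomial.isHomogeneous_C (Fin r) t).mul (hNhom x hx)
      rwa [zero_add] at this
    · rw [Algebra.smul_def]; rfl
  have hN2 : ∀ x ∈ barPow A r M 1, ∀ t ∈ gr A r M 1, ∃ y ∈ gr A r M 2, (reesAlg A r M).val y = (reesAlg A r M).val t * x := by
    intro x hx t ht
    have h := hRR x hx _ (gr_le_Q A r M one_ne_zero ht)
    exact ⟨⟨_, h⟩, (mem_gr A r M).2 (((mem_gr A r M).1 ht).mul (hNhom x hx)), rfl⟩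
  refine { D := D, hj := Subtype.val_injective, hAS := ?_, hNF := fun x hx => (mem_barPow.1 hx).1, hMN := ?_, hpq := hpq, hp := hp0, dep := dep, hmQ := hmQ, CrF := ?_, hN1 := hN1, hN2 := hN2, indep := ?_, Inj := ?_, divF := ?_ }
  · rw [MvPolynomial.algebraMap_eq]; exact MvPolynomial.C_injective _ _
  · rintro _ ⟨y, hy, rfl⟩
    obtain ⟨w, hw, h⟩ := gr1_emb hy
    exact mem_barPow.2 ⟨mem_freeSub.2 ⟨w, h⟩, isIntegral_algebraMap (R := reesAlg A r M) (x := y)⟩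
  · intro w hw b
    obtain ⟨v, rfl⟩ := mem_freeSub.1 hw
    rw [emb_cr]
    refine Finset.sum_congr rfl fun i _ => ?_
    rw [phiAlg_emb]; rfl
  · intro c hc k
    by_contra hk
    set x : ↥(reesAlg A r M) := ∑ i, c i • TT τ hτ i with hxdef
    have hx1 : x ∈ gr A r M 1 := sum_mem fun i _ => (gr A r M 1).smul_mem _ (TT_mem τ hτ i)
    have hxv : (x : MvPolynomial (Fin r) A) = ∑ i, c i • (reesAlg A r M).val (TT τ hτ i) := by
      rw [hxdef, AddSubmonoidClass.coe_finsetSum]; rfl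
    have hx2 : x * x ∈ Ideal.map (algebraMap A ↥(reesAlg A r M)) (maximalIdeal A) := by
      have key : ∀ z ∈ maximalIdeal A • barPow A r M 1, ∃ y ∈ Ideal.map (algebraMap A ↥(reesAlg A r M)) (maximalIdeal A), (y : MvPolynomial (Fin r) A) = x * z := by
        intro z hz
        refine Submodule.smul_induction_on hz ?_ ?_
        · intro t ht n hn
          refine ⟨algebraMap A _ t * ⟨_, hRR n hn x (gr_le_Q A r M one_ne_zero hx1)⟩, Ideal.mul_mem_right _ _ (Ideal.mem_map_of_mem _ ht), ?_⟩
          rw [MulMemClass.coe_mul, Algebra.smul_def]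
          change algebraMap A _ t * (x * n) = _
          ring
        · rintro y z ⟨y', hy, e1⟩ ⟨z', hz, e2⟩
          exact ⟨y' + z', add_mem hy hz, by rw [AddMemClass.coe_add, e1, e2, mul_add]⟩
      obtain ⟨y, hy, e⟩ := key _ hc
      rw [← hxv] at e
      have : y = x * x := Subtype.ext e
      rwa [← this]
    refine hG (fun i => TT τ hτ (k.succAbove i)) (fun i => gr_le_Q A r M one_ne_zero (TT_mem τ hτ _)) ?_
    rw [Ideal.radical_eq_sInf]
    refine le_sInf ?_
    rintro P ⟨hPx, hP⟩
    have hm : ∀ t ∈ maximalIdeal A, algebraMap A _ t ∈ P := fun t ht => hPx (Ideal.mem_sup_left (Ideal.mem_map_of_mem _ ht))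
    have hT : ∀ i, i ≠ k → TT τ hτ i ∈ P := by
      intro i hi
      obtain ⟨i', rfl⟩ := Fin.exists_succAbove_eq hi
      exact hPx (Ideal.mem_sup_right (Ideal.subset_span ⟨i', rfl⟩))
    refine Q_le_prime hP hm (gr1_le_prime hred hP fun i => ?_)
    by_cases hi : i = k
    · subst hi
      have hxP : x ∈ P := (hP.mem_or_mem (hPx (Ideal.mem_sup_left hx2))).elim id id
      rw [hxdef, ← Finset.add_sum_erase _ _ (Finset.mem_univ i)] at hxP
      have h3 : c i • TT τ hτ i ∈ P := by
        refine (Submodule.add_mem_iff_left P ?_).1 hxP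
        refine sum_mem fun l hl => ?_
        rw [Algebra.smul_def]
        exact P.mul_mem_left _ (hT l (Finset.mem_erase.1 hl).1)
      obtain ⟨v, hv⟩ := (IsLocalRing.notMem_maximalIdeal.1 hk).exists_left_inv
      have h4 : v • (c i • TT τ hτ i) ∈ P := by rw [Algebra.smul_def v]; exact P.mul_mem_left _ h3
      rwa [smul_smul, hv, one_smul] at h4
    · exact hT i hi
  · intro s hs hsum i
    choose w hw using fun i => mem_freeSub.1 (hs i)
    obtain ⟨y, hy, hye⟩ := hsum
    refine mem_barPow.2 ⟨hs i, ?_⟩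
    rw [← hw i]
    refine inj_main hdim hr dep hΛ hinf hB he hred hhm hne hh w ?_ i
    have h5 := (mem_gr' A r M).1 hy
    have h6 : (y : MvPolynomial (Fin r) A) = ∑ i, emb A r (τ i) * emb A r (w i) := by
      refine Eq.trans hye ?_
      refine Finset.sum_congr rfl fun i _ => ?_
      rw [hw i]; rfl
    rwa [← h6]
  · intro s s' hs hs' h
    obtain ⟨w, rfl⟩ := mem_freeSub.1 hs
    obtain ⟨w', rfl⟩ := mem_freeSub.1 hs'
    rw [← map_smul, ← map_smul] at h
    have h := emb_inj h
    have key : ∀ i, ∃ v, w i = p * v := by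
      intro i
      have h7 : q * w i = p * w' i := congrFun h i
      have h8 : q * w i ∈ Ideal.span {p} := by rw [h7]; exact Ideal.mul_mem_right _ _ (Ideal.mem_span_singleton_self _)
      exact Ideal.mem_span_singleton.1 ((hpp.mem_or_mem h8).resolve_left hqp)
    choose v hv using key
    have e1 : w = p • v := funext hv
    have e2 : w' = q • v := by
      ext i
      apply mul_left_cancel₀ hp0
      have h7 : q * w i = p * w' i := congrFun h i
      rw [← h7, hv, Pi.smul_apply, smul_eq_mul]; ring
    exact ⟨emb A r v, mem_freeSub.2 ⟨v, rfl⟩, by rw [e1, map_smul], by rw [e2, map_smul]⟩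
end nsys

section fin
open RingTheory.Sequence

lemma mem_map_of_surj {R G : Type} [CommRing R] [CommRing G] (f : R →+* G) (hf : Function.Surjective f)
    {ι : Type} (x : ι → R) (S : Set ι) {a : R} (ha : f a ∈ Ideal.span ((fun i => f (x i)) '' S)) :
    a ∈ Ideal.span (x '' S) ⊔ RingHom.ker f := by
  have : Ideal.span ((fun i => f (x i)) '' S) = (Ideal.span (x '' S)).map f := by
    rw [Ideal.map_span, Set.image_image]
  rw [this] at ha
  rw [← Ideal.comap_map_of_surjective' f hf]
  exact ha

lemma ofList_take {R : Type} [CommRing R] {d : ℕ} (x : Fin d → R) (i : Fin d) :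
    Ideal.ofList ((List.ofFn x).take i) = Ideal.span (x '' {j | j < i}) := by
  unfold Ideal.ofList
  congr 1
  ext y
  simp only [Set.mem_setOf_eq, Set.mem_image, List.mem_take_iff_getElem, List.length_ofFn, List.getElem_ofFn]
  constructor
  · rintro ⟨k, hk, rfl⟩
    exact ⟨⟨k, by omega⟩, by rw [Fin.lt_def]; change k < (i : ℕ); omega, rfl⟩
  · rintro ⟨j, hj, rfl⟩
    exact ⟨j, by have h1 := Fin.lt_def.1 hj; have h2 := i.2; have h3 := j.2; omega, rfl⟩

lemma final_cm {R : Type} [CommRing R] [IsNoetherianRing R] (Q : Ideal R) [Q.IsPrime] {G : Type} [CommRing G] [IsLocalRing G]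
    (f : Localization.AtPrime Q →+* G) (hf : Function.Surjective f) (J : Ideal R)
    (hker : RingHom.ker f = J.map (algebraMap R (Localization.AtPrime Q)))
    {Λ : Set (Localization.AtPrime Q)} (hΛ : UnitDiff Λ) (hinf : Λ.Infinite)
    (C : Type) [AddCommGroup C] [Module R C] [Module.Finite R C] (hJC : ∀ a ∈ J, ∀ c : C, a • c = 0)
    (Y : Set R) (hY : Q ≤ J ⊔ Ideal.span Y) (e : C)
    (μ : ∀ y ∈ Y, ∃ g : C →+ G, (∀ (a : R) c, g (a • c) = f (algebraMap R _ a) * g c) ∧ g e = f (algebraMap R _ y))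
    (d : ℕ) (ts : List R) (hts : ∀ t ∈ ts, t ∈ Q) (hlen : ts.length = d) (hreg : IsWeaklyRegular C ts)
    (x : Fin d → G) (hx : ∀ i, x i ∈ maximalIdeal G) (hrad : maximalIdeal G ≤ (Ideal.span (Set.range x)).radical)
    (i : Fin d) (a : G) (ha : a * x i ∈ Ideal.span (x '' {j | j < i})) (y : G) (hy : y ∈ maximalIdeal G) :
    y * a ∈ Ideal.span (x '' {j | j < i}) := by
  classical
  let L := Localization.AtPrime Q
  letI : Algebra L G := f.toAlgebra
  letI : Algebra R G := (f.comp (algebraMap R L)).toAlgebra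
  haveI : IsScalarTower R L G := IsScalarTower.of_algebraMap_eq fun _ => rfl
  haveI : IsNoetherianRing L := IsLocalization.isNoetherianRing Q.primeCompl L inferInstance
  have hfl : ∀ z ∈ maximalIdeal L, f z ∈ maximalIdeal G := by
    intro z hz h
    haveI : IsLocalHom f := hf.isLocalHom
    exact hz (isUnit_of_map_unit f _ h)
  have hfl' : ∀ z, f z ∈ maximalIdeal G → z ∈ maximalIdeal L := fun z hz h => hz (h.map f)
  choose xt hxt using fun i => hf (x i)
  obtain ⟨at', rfl⟩ := hf a
  let CQ := LocalizedModule Q.primeCompl C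
  have hreg1 : IsWeaklyRegular CQ (ts.map (algebraMap R L)) :=
    hreg.of_isLocalizedModule L Q.primeCompl (LocalizedModule.mkLinearMap Q.primeCompl C)
  have hann : RingHom.ker f ≤ Module.annihilator L CQ := by
    rw [hker, Ideal.map_le_iff_le_comap]
    intro z hz
    rw [Ideal.mem_comap, Module.mem_annihilator]
    intro c
    induction c using LocalizedModule.induction_on with
    | h m s =>
      rw [algebraMap_smul, LocalizedModule.smul'_mk, hJC z hz, LocalizedModule.zero_mk]
  haveI : Module.Finite L CQ := Module.Finite.of_isLocalizedModule Q.primeCompl (LocalizedModule.mkLinearMap Q.primeCompl C)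
  have hxx : x = fun i => f (xt i) := funext fun i => (hxt i).symm
  have hofn : Ideal.ofList (List.ofFn xt) = Ideal.span (xt '' Set.univ) := by
    unfold Ideal.ofList
    congr 1
    ext z; simp [List.mem_ofFn, eq_comm]
  have hxs : IsWeaklyRegular CQ (List.ofFn xt) := by
    refine cm_lemma hΛ hinf d CQ (ts.map (algebraMap R L)) (List.ofFn xt) (by simpa using hlen) (by simp) ?_ ?_ hreg1 ?_
    · intro t ht
      obtain ⟨t', ht', rfl⟩ := List.mem_map.1 ht
      exact (IsLocalization.AtPrime.to_map_mem_maximal_iff L Q t').2 (hts t' ht')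
    · intro t ht
      obtain ⟨k, rfl⟩ := (List.mem_ofFn' _ _).1 ht
      exact hfl' _ (by rw [hxt]; exact hx k)
    · intro z hz
      obtain ⟨n, hn⟩ := hrad (hfl z hz)
      refine ⟨n, ?_⟩
      rw [hofn]
      refine sup_le_sup_left hann _ (mem_map_of_surj f hf xt Set.univ ?_)
      rw [map_pow, Set.image_univ, ← hxx]; exact hn
  have hreg2 := hxs.regular_mod_prev i (by simp)
  rw [isSMulRegular_quotient_iff_mem_of_smul_mem, ofList_take, List.getElem_ofFn] at hreg2
  let ee : CQ := LocalizedModule.mkLinearMap Q.primeCompl C e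
  have h1 : at' • ee ∈ (Ideal.span (xt '' {j | j < i}) • ⊤ : Submodule L CQ) := by
    refine hreg2 _ ?_
    rw [smul_smul]
    have h2 : xt i * at' ∈ Ideal.span (xt '' {j | j < i}) ⊔ RingHom.ker f := by
      refine mem_map_of_surj f hf xt _ ?_
      rw [map_mul, hxt, mul_comm, ← hxx]; exact ha
    obtain ⟨u, hu, v, hv, huv⟩ := Submodule.mem_sup.1 h2
    change (xt i * at') • ee ∈ _
    rw [← huv, add_smul, Module.mem_annihilator.1 (hann hv), add_zero]
    exact Submodule.smul_mem_smul hu trivial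
  have hunit : ∀ s : Q.primeCompl, IsUnit (algebraMap R (Module.End R G) s) := by
    intro s
    have hs : IsUnit (algebraMap R G s) := (IsLocalization.map_units L s).map f
    rw [Module.End.isUnit_iff]
    obtain ⟨v, hv⟩ := hs.exists_left_inv
    constructor
    · intro a b hab
      change (s : R) • a = (s : R) • b at hab
      rw [Algebra.smul_def, Algebra.smul_def] at hab
      exact hs.mul_left_cancel hab
    · intro b
      refine ⟨v * b, ?_⟩
      change (s : R) • (v * b) = b
      rw [Algebra.smul_def, ← mul_assoc, mul_comm _ v, hv, one_mul]
  have key : ∀ y ∈ Y, f (algebraMap R L y) * f at' ∈ Ideal.span (x '' {j | j < i}) := by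
    intro y hy
    obtain ⟨g, hg, hge⟩ := μ y hy
    have hg' : ∀ (a : R) (c : C), g (a • c) = a • g c := by
      intro a c
      rw [hg, Algebra.smul_def]; rfl
    let gl : C →ₗ[R] G := { toFun := g, map_add' := map_add g, map_smul' := hg' }
    let gL : CQ →ₗ[L] G := (IsLocalizedModule.lift Q.primeCompl (LocalizedModule.mkLinearMap Q.primeCompl C) gl hunit).extendScalarsOfIsLocalization Q.primeCompl L
    have hgL : gL ee = f (algebraMap R L y) := by
      rw [← hge]
      exact IsLocalizedModule.lift_apply Q.primeCompl (LocalizedModule.mkLinearMap Q.primeCompl C) gl hunit e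
    have h3 : ∀ c ∈ (Ideal.span (xt '' {j | j < i}) • ⊤ : Submodule L CQ), gL c ∈ Ideal.span (x '' {j | j < i}) := by
      intro c hc
      refine Submodule.smul_induction_on hc ?_ ?_
      · intro u hu n _
        rw [map_smul, Algebra.smul_def]
        refine Ideal.mul_mem_right _ _ ?_
        have : f u ∈ (Ideal.span (xt '' {j | j < i})).map f := Ideal.mem_map_of_mem _ hu
        rw [Ideal.map_span, Set.image_image, ← hxx] at this
        exact this
      · intro u v hu hv; rw [map_add]; exact add_mem hu hv
    have h4 := h3 _ h1
    rw [map_smul, hgL, Algebra.smul_def, mul_comm] at h4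
    exact h4
  obtain ⟨yt, rfl⟩ := hf y
  have hyt := hfl' _ hy
  have h5 : yt ∈ (J ⊔ Ideal.span Y).map (algebraMap R L) := by
    rw [← IsLocalization.AtPrime.map_eq_maximalIdeal Q L] at hyt
    exact Ideal.map_mono hY hyt
  rw [Ideal.map_sup, ← hker, Ideal.map_span] at h5
  obtain ⟨u, hu, v, hv, rfl⟩ := Submodule.mem_sup.1 h5
  rw [map_add, (RingHom.mem_ker).1 hu, zero_add]
  refine Submodule.span_induction ?_ ?_ ?_ ?_ hv
  · rintro _ ⟨y, hy, rfl⟩; exact key y hy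
  · simp
  · intro a b _ _ ha hb; rw [map_add, add_mul]; exact add_mem ha hb
  · intro c a _ ha; rw [smul_eq_mul, map_mul, mul_assoc]; exact Ideal.mul_mem_left _ _ ha
end fin

section fib
open RingTheory.Sequence
variable {A : Type} [CommRing A] {r : ℕ} {M : Submodule A (Fin r → A)}

lemma rees_noeth [IsNoetherianRing A] : IsNoetherianRing ↥(reesAlg A r M) := by
  obtain ⟨s, hs⟩ : (sub1 A r M).FG := (IsNoetherian.noetherian M).map _
  have h : reesAlg A r M = Algebra.adjoin A (s : Set (MvPolynomial (Fin r) A)) := by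
    rw [reesAlg, ← hs, Algebra.adjoin_span]
  have : Algebra.FiniteType A ↥(reesAlg A r M) :=
    (Subalgebra.fg_iff_finiteType _).1 ⟨s, h.symm⟩
  exact Algebra.FiniteType.isNoetherianRing A _

variable [IsDomain A] [IsLocalRing A]
  {d : ℕ} {Q : Ideal ↥(reesAlg A r M)} {T : Fin d → ↥(reesAlg A r M)} {h : Fin d → A} {φ : Fin d → Fin d → MvPolynomial (Fin r) A →ₐ[A] A}
  {F N : Submodule A (MvPolynomial (Fin r) A)} {p q : A}

local notation "𝒮" => homogeneousSubmodule (Fin r) A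
local notation "SS" => MvPolynomial (Fin r) A
attribute [local instance] MvPolynomial.gradedAlgebra

namespace Fib

section gen
variable {R B : Type} [CommRing R] [AddCommGroup B] [Module R B]
omit [IsDomain A] [IsLocalRing A]
lemma mk_mem (I J : Ideal R) (b : B) :
    ((J • ⊤ : Submodule R B).mkQ b ∈ (I • ⊤ : Submodule R (B ⧸ (J • ⊤ : Submodule R B)))) ↔ b ∈ ((I ⊔ J) • ⊤ : Submodule R B) := by
  have e : (I • ⊤ : Submodule R (B ⧸ (J • ⊤ : Submodule R B))) = (I • ⊤ : Submodule R B).map (J • ⊤ : Submodule R B).mkQ := by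
    rw [Submodule.map_smul'', Submodule.map_top, Submodule.range_mkQ]
  rw [e, ← Submodule.mem_comap, Submodule.comap_map_mkQ, Submodule.sup_smul, sup_comm]

lemma wr_quot {d : ℕ} (T : Fin d → R) (J : Ideal R)
    (H : ∀ (k : ℕ) (hk : k < d) (b : B), T ⟨k, hk⟩ • b ∈ ((Ideal.span (T '' {i | (i : ℕ) < k}) ⊔ J) • ⊤ : Submodule R B) → b ∈ ((Ideal.span (T '' {i | (i : ℕ) < k}) ⊔ J) • ⊤ : Submodule R B)) :
    IsWeaklyRegular (B ⧸ (J • ⊤ : Submodule R B)) (List.ofFn T) := by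
  constructor
  intro k hk
  rw [List.length_ofFn] at hk
  rw [isSMulRegular_quotient_iff_mem_of_smul_mem]
  rw [List.getElem_ofFn]
  have e1 : Ideal.ofList ((List.ofFn T).take k) = Ideal.span (T '' {i | (i : ℕ) < k}) := ofList_take T ⟨k, hk⟩
  rw [e1]
  intro c hc
  obtain ⟨b, rfl⟩ := Submodule.mkQ_surjective _ c
  rw [← map_smul] at hc
  rw [mk_mem] at hc ⊢
  exact H k hk b hc

lemma final_cm2 [IsNoetherianRing R] (Q : Ideal R) [Q.IsPrime] {G : Type} [CommRing G] [IsLocalRing G]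
    (f : Localization.AtPrime Q →+* G) (hf : Function.Surjective f) (J : Ideal R)
    (hker : RingHom.ker f = J.map (algebraMap R (Localization.AtPrime Q)))
    {Λ : Set (Localization.AtPrime Q)} (hΛ : UnitDiff Λ) (hinf : Λ.Infinite)
    [Module.Finite R B]
    (Y : Set R) (hY : Q ≤ J ⊔ Ideal.span Y) (e : B)
    (μ : ∀ y ∈ Y, ∃ g : B →ₗ[R] R, g e = y)
    (d : ℕ) (T : Fin d → R) (hT : ∀ i, T i ∈ Q)
    (H : ∀ (k : ℕ) (hk : k < d) (b : B), T ⟨k, hk⟩ • b ∈ ((Ideal.span (T '' {i | (i : ℕ) < k}) ⊔ J) • ⊤ : Submodule R B) → b ∈ ((Ideal.span (T '' {i | (i : ℕ) < k}) ⊔ J) • ⊤ : Submodule R B))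
    (x : Fin d → G) (hx : ∀ i, x i ∈ maximalIdeal G) (hrad : maximalIdeal G ≤ (Ideal.span (Set.range x)).radical)
    (i : Fin d) (a : G) (ha : a * x i ∈ Ideal.span (x '' {j | j < i})) (y : G) (hy : y ∈ maximalIdeal G) :
    y * a ∈ Ideal.span (x '' {j | j < i}) := by
  have hJf : ∀ a ∈ J, f (algebraMap R _ a) = 0 := by
    intro a ha
    rw [← RingHom.mem_ker, hker]; exact Ideal.mem_map_of_mem _ ha
  refine final_cm Q f hf J hker hΛ hinf (B ⧸ (J • ⊤ : Submodule R B)) ?_ Y hY (Submodule.Quotient.mk e) ?_ d (List.ofFn T) ?_ (by simp) (wr_quot T J H) x hx hrad i a ha y hy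
  · intro a ha c
    obtain ⟨b, rfl⟩ := Submodule.mkQ_surjective _ c
    rw [← map_smul]
    exact (Submodule.Quotient.mk_eq_zero _).2 (Submodule.smul_mem_smul ha trivial)
  · intro y hy
    obtain ⟨g, hg⟩ := μ y hy
    let g0 : B →+ G := (f.comp (algebraMap R _)).toAddMonoidHom.comp g.toAddMonoidHom
    have h0 : ∀ b ∈ (J • ⊤ : Submodule R B).toAddSubgroup, g0 b = 0 := by
      intro b hb
      refine Submodule.smul_induction_on (p := fun b => g0 b = 0) hb ?_ ?_
      · intro a ha n _
        change f (algebraMap R _ (g (a • n))) = 0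
        rw [map_smul, smul_eq_mul, map_mul, map_mul, hJf a ha, zero_mul]
      · intro u v hu hv; rw [map_add, hu, hv, add_zero]
    refine ⟨QuotientAddGroup.lift (J • ⊤ : Submodule R B).toAddSubgroup g0 h0, ?_, ?_⟩
    · intro a c
      obtain ⟨b, rfl⟩ := Submodule.mkQ_surjective _ c
      change f (algebraMap R _ (g (a • b))) = f (algebraMap R _ a) * f (algebraMap R _ (g b))
      rw [map_smul, smul_eq_mul, map_mul, map_mul]
    · change f (algebraMap R _ (g e)) = _
      rw [hg]
  · intro t ht
    obtain ⟨k, rfl⟩ := (List.mem_ofFn' _ _).1 ht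
    exact hT k
end gen


lemma val_mem {n : ℕ} {x : ↥(reesAlg A r M)} (hx : x ∈ gr A r M n) : (x : SS) ∈ 𝒮 n := (mem_gr A r M).1 hx

lemma grB (H : NSys (𝒜 := gr A r M) Q T h (reesAlg A r M).val φ F N p q) (i : ℕ) : ∀ (n : ℕ) (x : ↥(reesAlg A r M)) (_ : x ∈ gr A r M i) (b : SS) (_ : b ∈ H.B n), (x : SS) * b ∈ H.B (n + i) := by
  induction i with
  | zero =>
    intro n x hx b hb
    obtain ⟨c, rfl⟩ := gr_zero A r M x hx
    have := (H.B n).smul_mem c hb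
    rw [Algebra.smul_def] at this
    exact this
  | succ i ih =>
    intro n x hx b hb
    rw [gr_gen] at hx
    refine Submodule.mul_induction_on hx ?_ ?_
    · intro u hu v hv
      have := H.MB _ hu (ih n v hv b hb)
      have e : ((u * v : ↥(reesAlg A r M)) : SS) * b = (reesAlg A r M).val u * ((v : SS) * b) := by
        change (u : SS) * v * b = u * (v * b); ring
      rw [e]; exact this
    · intro u v hu hv
      have e : ((u + v : ↥(reesAlg A r M)) : SS) * b = u * b + v * b := by
        change ((u : SS) + v) * b = u * b + v * b; ring
      rw [e]; exact add_mem hu hv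

lemma BhS (H : NSys (𝒜 := gr A r M) Q T h (reesAlg A r M).val φ F N p q) (hN : N ≤ 𝒮 1) (n : ℕ) : H.B n ≤ 𝒮 n := by
  by_cases hn : n = 1
  · subst hn; rw [H.B1]; exact hN
  · have : H.B n = (gr A r M n).map (reesAlg A r M).val.toLinearMap := by simp [NSys.B, hn]
    rw [this]
    rintro _ ⟨x, hx, rfl⟩
    exact val_mem hx

/-- the module -/
noncomputable def BB (H : NSys (𝒜 := gr A r M) Q T h (reesAlg A r M).val φ F N p q) : Submodule ↥(reesAlg A r M) SS where
  carrier := {b | ∀ n, pr 𝒮 n b ∈ H.B n}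
  zero_mem' := by intro n; have : pr 𝒮 n (0 : SS) = 0 := by simp [pr]
                  rw [this]; exact zero_mem _
  add_mem' := by intro a b ha hb n; rw [pr_add]; exact add_mem (ha n) (hb n)
  smul_mem' := by
    intro x b hb
    rw [pr_sum (gr A r M) x, Finset.sum_smul]
    have add : ∀ (s : Finset ℕ) (g : ℕ → SS), (∀ i ∈ s, ∀ n, pr 𝒮 n (g i) ∈ H.B n) → ∀ n, pr 𝒮 n (∑ i ∈ s, g i) ∈ H.B n := by
      classical
      intro s g hg n
      induction s using Finset.induction_on with
      | empty => have : pr 𝒮 n (0 : SS) = 0 := by simp [pr]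
                 rw [Finset.sum_empty, this]; exact zero_mem _
      | insert a s ha ih =>
        rw [Finset.sum_insert ha, pr_add]
        exact add_mem (hg a (Finset.mem_insert_self _ _) n) (ih fun i hi => hg i (Finset.mem_insert_of_mem hi))
    refine add _ _ fun i _ n => ?_
    change pr 𝒮 n (((pr (gr A r M) i x : ↥(reesAlg A r M)) : SS) * b) ∈ H.B n
    have hx := pr_mem (gr A r M) i x
    by_cases hn : n < i
    · rw [pr_mul_lt 𝒮 (val_mem hx) n hn]; exact zero_mem _
    · obtain ⟨m, rfl⟩ := Nat.exists_eq_add_of_le (not_lt.1 hn)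
      rw [pr_mul 𝒮 (val_mem hx), add_comm i m]
      exact grB H i m _ hx _ (hb m)

variable (H : NSys (𝒜 := gr A r M) Q T h (reesAlg A r M).val φ F N p q)

lemma mem_BB {b : SS} : b ∈ BB H ↔ ∀ n, pr 𝒮 n b ∈ H.B n := Iff.rfl

lemma B_BB (hN : N ≤ 𝒮 1) {n : ℕ} {b : SS} (hb : b ∈ H.B n) : b ∈ BB H := by
  intro m
  by_cases hm : n = m
  · subst hm; rwa [pr_same 𝒮 (BhS H hN n hb)]
  · rw [pr_ne 𝒮 (BhS H hN n hb) hm]; exact zero_mem _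

lemma one_B0 : (1 : SS) ∈ H.B 0 := by
  rw [H.B0]
  exact ⟨1, (mem_gr A r M).2 (isHomogeneous_one _ _), map_one (reesAlg A r M).val⟩

lemma BB_fin [IsNoetherianRing A] (hNfg : N.FG) : Module.Finite ↥(reesAlg A r M) (BB H) := by
  haveI : IsNoetherianRing ↥(reesAlg A r M) := rees_noeth
  obtain ⟨s, hs⟩ := hNfg
  let W : Submodule ↥(reesAlg A r M) SS := Submodule.span ↥(reesAlg A r M) (insert 1 (s : Set SS))
  have hWfg : W.FG := Submodule.fg_span (s.finite_toSet.insert 1)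
  have hle : BB H ≤ W := by
    intro b hb
    rw [pr_sum 𝒮 b]
    refine sum_mem fun n _ => ?_
    have h1 := hb n
    by_cases hn : n = 1
    · subst hn
      rw [H.B1, ← hs] at h1
      have : Submodule.span A (s : Set SS) ≤ W.restrictScalars A := Submodule.span_le.2 fun x hx => Submodule.subset_span (Set.mem_insert_of_mem _ hx)
      exact this h1
    · have h2 : H.B n = (gr A r M n).map (reesAlg A r M).val.toLinearMap := by simp [NSys.B, hn]
      rw [h2] at h1
      obtain ⟨x, hx, e⟩ := h1
      rw [← e]
      have : x • (1 : SS) ∈ W := W.smul_mem x (Submodule.subset_span (Set.mem_insert _ _))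
      have e2 : x • (1 : SS) = (x : SS) := by change (x : SS) * 1 = x; rw [mul_one]
      rw [e2] at this
      exact this
  haveI : Module.Finite ↥(reesAlg A r M) W := Module.Finite.iff_fg.2 hWfg
  haveI : IsNoetherian ↥(reesAlg A r M) W := isNoetherian_of_isNoetherianRing_of_finite ↥(reesAlg A r M) W
  haveI : IsNoetherian ↥(reesAlg A r M) (BB H) := isNoetherian_of_le hle
  infer_instance

/-- J -/
noncomputable abbrev JJ (A : Type) [CommRing A] [IsLocalRing A] (r : ℕ) (M : Submodule A (Fin r → A)) : Ideal ↥(reesAlg A r M) :=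
  Ideal.map (algebraMap A _) (maximalIdeal A)

/-- homogeneous pieces of the submodule -/
noncomputable def V (H : NSys (𝒜 := gr A r M) Q T h (reesAlg A r M).val φ F N p q) (k : ℕ) (n : ℕ) : Submodule A SS :=
  match n with
  | 0 => maximalIdeal A • H.B 0
  | n + 1 => TL (fun i => (reesAlg A r M).val (T i)) (Finset.univ.filter fun i => (i : ℕ) < k) (H.B n) ⊔ maximalIdeal A • H.B (n + 1)

lemma mV (k n : ℕ) : maximalIdeal A • H.B n ≤ V H k n := by
  cases n with
  | zero => exact le_rfl
  | succ n => exact le_sup_right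

lemma mem_to_V (hT : ∀ i, T i ∈ gr A r M 1) (k : ℕ) (b : BB H)
    (hb : b ∈ ((Ideal.span (T '' {i | (i : ℕ) < k}) ⊔ JJ A r M) • ⊤ : Submodule ↥(reesAlg A r M) (BB H))) (n : ℕ) : pr 𝒮 n (b : SS) ∈ V H k n := by
  let I : Ideal ↥(reesAlg A r M) :=
    { carrier := {x | ∀ b ∈ BB H, ∀ n, pr 𝒮 n ((x : SS) * b) ∈ V H k n}
      zero_mem' := by
        intro b _ n
        have e : ((0 : ↥(reesAlg A r M)) : SS) * b = 0 := by simp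
        have : pr 𝒮 n (0 : SS) = 0 := by simp [pr]
        rw [e, this]; exact zero_mem _
      add_mem' := by
        intro x y hx hy b hb n
        have e : ((x + y : ↥(reesAlg A r M)) : SS) * b = x * b + y * b := by
          change ((x : SS) + y) * b = x * b + y * b; ring
        rw [e, pr_add]
        exact add_mem (hx b hb n) (hy b hb n)
      smul_mem' := by
        intro y x hx b hb n
        have e : ((y • x : ↥(reesAlg A r M)) : SS) * b = x * (y * b) := by
          change ((y : SS) * x) * b = x * (y * b); ring
        rw [e]
        exact hx _ ((BB H).smul_mem y hb) n }
  have hI : Ideal.span (T '' {i | (i : ℕ) < k}) ⊔ JJ A r M ≤ I := by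
    refine sup_le ?_ ?_
    · rw [Ideal.span_le]
      rintro _ ⟨i, hi, rfl⟩ b hb n
      cases n with
      | zero => rw [pr_mul_lt 𝒮 (val_mem (hT i)) 0 (by norm_num)]; exact zero_mem _
      | succ n =>
        rw [add_comm, pr_mul 𝒮 (val_mem (hT i)), add_comm]
        refine Submodule.mem_sup_left ?_
        exact mul_mem_TL (t := fun i => (reesAlg A r M).val (T i)) (Finset.mem_filter.2 ⟨Finset.mem_univ _, hi⟩) (hb n)
    · rw [Ideal.map_le_iff_le_comap]
      intro t ht b hb n
      have := pr_alg 𝒮 n t b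
      change pr 𝒮 n (algebraMap A SS t * b) ∈ _
      rw [this, ← Algebra.smul_def]
      exact mV H k n (Submodule.smul_mem_smul ht (hb n))
  refine Submodule.smul_induction_on hb ?_ ?_
  · intro x hx b _
    exact hI hx b b.2 n
  · intro x y hx hy
    change pr 𝒮 n ((x : SS) + y) ∈ _
    rw [pr_add]; exact add_mem hx hy

lemma V_to_mem (hN : N ≤ 𝒮 1) (k : ℕ) (b : BB H) (hb : ∀ n, pr 𝒮 n (b : SS) ∈ V H k n) :
    b ∈ ((Ideal.span (T '' {i | (i : ℕ) < k}) ⊔ JJ A r M) • ⊤ : Submodule ↥(reesAlg A r M) (BB H)) := by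
  set W := ((Ideal.span (T '' {i | (i : ℕ) < k}) ⊔ JJ A r M) • ⊤ : Submodule ↥(reesAlg A r M) (BB H)) with hW
  have hm : ∀ n, maximalIdeal A • H.B n ≤ (W.map (BB H).subtype).restrictScalars A := by
    intro n
    rw [Submodule.smul_le]
    intro t ht c hc
    refine ⟨algebraMap A ↥(reesAlg A r M) t • ⟨c, B_BB H hN hc⟩, Submodule.smul_mem_smul (Ideal.mem_sup_right (Ideal.mem_map_of_mem _ ht)) trivial, ?_⟩
    rw [Algebra.smul_def]; rfl
  have key : ∀ n, V H k n ≤ (W.map (BB H).subtype).restrictScalars A := by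
    intro n
    cases n with
    | zero => exact hm 0
    | succ n =>
      refine sup_le ?_ (hm _)
      rintro _ ⟨s, hs, rfl⟩
      refine sum_mem fun i hi => ?_
      refine ⟨T i • ⟨s i, B_BB H hN (hs i)⟩, Submodule.smul_mem_smul (Ideal.mem_sup_left (Ideal.subset_span ⟨i, (Finset.mem_filter.1 hi).2, rfl⟩)) trivial, rfl⟩
  have : (b : SS) ∈ W.map (BB H).subtype := by
    rw [pr_sum 𝒮 (b : SS)]
    exact sum_mem fun n _ => key n (hb n)
  obtain ⟨w, hw, e⟩ := this
  have : w = b := Subtype.ext e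
  rwa [← this]

lemma CC_reg0 [Nontrivial (Fin d)] (hN : N ≤ 𝒮 1) (hT : ∀ i, T i ∈ gr A r M 1) (k : ℕ) (hk : k < d) (b : BB H)
    (hc : T ⟨k, hk⟩ • b ∈ ((Ideal.span (T '' {i | (i : ℕ) < k}) ⊔ JJ A r M) • ⊤ : Submodule ↥(reesAlg A r M) (BB H))) :
    b ∈ ((Ideal.span (T '' {i | (i : ℕ) < k}) ⊔ JJ A r M) • ⊤ : Submodule ↥(reesAlg A r M) (BB H)) := by
  refine V_to_mem H hN k b fun n => ?_
  have h1 := mem_to_V H hT k _ hc (n + 1)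
  have h2 : pr 𝒮 (n + 1) ((T ⟨k, hk⟩ • b : BB H) : SS) = (T ⟨k, hk⟩ : SS) * pr 𝒮 n (b : SS) := by
    rw [add_comm]; exact pr_mul 𝒮 (val_mem (hT _)) n _
  change pr 𝒮 (n + 1) ((T ⟨k, hk⟩ • b : BB H) : SS) ∈ _ at h1
  rw [h2] at h1
  rcases H.reg (Equiv.refl (Fin d)) n k hk _ (b.2 n) h1 with ⟨rfl, h3⟩ | ⟨n', rfl, h3⟩
  · exact h3
  · exact h3


lemma Bmul (hN : N ≤ 𝒮 1) {y : ↥(reesAlg A r M)} (hy : y ∈ gr A r M 1) {b : SS} (hb : b ∈ BB H) : (y : SS) * b ∈ reesAlg A r M := by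
  rw [pr_sum 𝒮 b, Finset.mul_sum]
  refine sum_mem fun n _ => ?_
  have h1 := hb n
  have h2 := H.MB n hy h1
  by_cases hn : n = 0
  · subst hn
    rw [H.B0] at h1
    obtain ⟨z, _, e⟩ := h1
    rw [← e]
    exact (y * z).2
  · have h3 : H.B (n + 1) = (gr A r M (n + 1)).map (reesAlg A r M).val.toLinearMap := by simp [NSys.B, hn]
    rw [h3] at h2
    obtain ⟨z, _, e⟩ := h2
    change (reesAlg A r M).val y * pr 𝒮 n b ∈ _
    rw [← e]
    exact z.2

include H in
theorem fib_main [IsNoetherianRing A] {Λ : Set A} (hΛ : UnitDiff Λ) (hinf : Λ.Infinite) (hNfg : N.FG) [Nontrivial (Fin d)] (hN : N ≤ 𝒮 1) (hT : ∀ i, T i ∈ gr A r M 1)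
    {G : Type} [CommRing G] [IsLocalRing G] (f : Localization.AtPrime (gradedMax A r M) →+* G) (hf : Function.Surjective f)
    (hker : RingHom.ker f = (JJ A r M).map (algebraMap ↥(reesAlg A r M) (Localization.AtPrime (gradedMax A r M))))
    (x : Fin d → G) (hx : ∀ i, x i ∈ maximalIdeal G) (hrad : maximalIdeal G ≤ (Ideal.span (Set.range x)).radical)
    (i : Fin d) (a : G) (ha : a * x i ∈ Ideal.span (x '' {j | j < i})) (y : G) (hy : y ∈ maximalIdeal G) :
    y * a ∈ Ideal.span (x '' {j | j < i}) := by
  haveI : IsNoetherianRing ↥(reesAlg A r M) := rees_noeth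
  haveI := BB_fin H hNfg
  set L := Localization.AtPrime (gradedMax A r M)
  let k : A →+* L := (algebraMap ↥(reesAlg A r M) L).comp (algebraMap A ↥(reesAlg A r M))
  have hinj : Set.InjOn k Λ := by
    intro a ha b hb hab
    by_contra hne
    have h1 := (hΛ a ha b hb hne).map k
    rw [map_sub, hab, sub_self] at h1
    exact not_isUnit_zero h1
  have hΛ' : UnitDiff (k '' Λ) := by
    rintro _ ⟨a, ha, rfl⟩ _ ⟨b, hb, rfl⟩ hne
    have h1 := (hΛ a ha b hb (fun h => hne (by rw [h]))).map k
    rwa [map_sub] at h1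
  refine final_cm2 (B := BB H) (gradedMax A r M) f hf (JJ A r M) hker hΛ' (hinf.image hinj) (gr A r M 1 : Set _) ?_ ⟨1, B_BB H hN (one_B0 H)⟩ ?_ d T ?_ ?_ x hx hrad i a ha y hy
  · intro z hz
    rw [pr_sum (gr A r M) z]
    refine sum_mem fun n _ => ?_
    cases n with
    | zero =>
      rw [pr0]
      exact Ideal.mem_sup_left (Ideal.mem_map_of_mem _ hz)
    | succ n =>
      refine Ideal.mem_sup_right ?_
      have h1 := pr_mem (gr A r M) (n + 1) z
      rw [gr_gen] at h1
      refine Submodule.mul_induction_on h1 ?_ ?_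
      · intro u hu v _
        exact Ideal.mul_mem_right _ _ (Ideal.subset_span hu)
      · intro u v hu hv; exact add_mem hu hv
  · intro y hy
    refine ⟨{ toFun := fun b => ⟨(y : SS) * b, Bmul H hN hy b.2⟩, map_add' := ?_, map_smul' := ?_ }, ?_⟩
    · intro a b
      exact Subtype.ext (mul_add (y : SS) a b)
    · intro a b
      exact Subtype.ext (mul_left_comm (y : SS) a b)
    · exact Subtype.ext (mul_one (y : SS))
  · intro i; exact gr_le_Q A r M one_ne_zero (hT i)
  · intro k hk b hb
    exact CC_reg0 H hN hT k hk b hb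
end Fib
end fib

section locq

lemma loc_quot {R : Type} [CommRing R] (J Q : Ideal R) [Q.IsPrime] (P : Ideal (R ⧸ J)) [P.IsPrime] (hPQ : P.comap (Ideal.Quotient.mk J) = Q) :
    ∃ f : Localization.AtPrime Q →+* Localization.AtPrime P, Function.Surjective f ∧ RingHom.ker f = J.map (algebraMap R (Localization.AtPrime Q)) ∧
      ∀ a, f (algebraMap R _ a) = algebraMap (R ⧸ J) _ (Ideal.Quotient.mk J a) := by
  let f := Localization.localRingHom Q P (Ideal.Quotient.mk J) hPQ.symm
  have hfa : ∀ a, f (algebraMap R _ a) = algebraMap (R ⧸ J) _ (Ideal.Quotient.mk J a) := fun a => Localization.localRingHom_to_map _ _ _ _ _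
  have hs : ∀ s : Q.primeCompl, Ideal.Quotient.mk J (s : R) ∈ P.primeCompl := by
    intro s h
    exact s.2 (hPQ ▸ h)
  have hfm : ∀ a (s : Q.primeCompl), f (IsLocalization.mk' _ a s) = IsLocalization.mk' _ (Ideal.Quotient.mk J a) (⟨_, hs s⟩ : P.primeCompl) :=
    fun a s => Localization.localRingHom_mk' _ _ _ _ _ _
  refine ⟨f, ?_, ?_, hfa⟩
  · intro z
    obtain ⟨a, ⟨s, hs'⟩, rfl⟩ := IsLocalization.exists_mk'_eq P.primeCompl z
    obtain ⟨a, rfl⟩ := Ideal.Quotient.mk_surjective a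
    obtain ⟨s, rfl⟩ := Ideal.Quotient.mk_surjective s
    exact ⟨IsLocalization.mk' _ a (⟨s, fun h => hs' (by rw [← hPQ] at h; exact h)⟩ : Q.primeCompl), hfm _ _⟩
  · apply le_antisymm
    · intro z hz
      obtain ⟨a, s, rfl⟩ := IsLocalization.exists_mk'_eq Q.primeCompl z
      rw [RingHom.mem_ker, hfm, IsLocalization.mk'_eq_zero_iff] at hz
      obtain ⟨⟨t, ht⟩, h⟩ := hz
      obtain ⟨t, rfl⟩ := Ideal.Quotient.mk_surjective t
      change Ideal.Quotient.mk J t * Ideal.Quotient.mk J a = 0 at h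
      rw [← map_mul, Ideal.Quotient.eq_zero_iff_mem] at h
      have htQ : t ∉ Q := fun h => ht (by rw [← hPQ] at h; exact h)
      have hu := IsLocalization.map_units (Localization.AtPrime Q) (⟨t, htQ⟩ : Q.primeCompl)
      rw [IsLocalization.mk'_eq_mul_mk'_one]
      refine Ideal.mul_mem_right _ _ ?_
      have h2 := Ideal.mem_map_of_mem (algebraMap R (Localization.AtPrime Q)) h
      rw [map_mul] at h2
      exact (Ideal.unit_mul_mem_iff_mem _ hu).1 h2
    · rw [Ideal.map_le_iff_le_comap]
      intro a ha
      rw [Ideal.mem_comap, RingHom.mem_ker, hfa, Ideal.Quotient.eq_zero_iff_mem.2 ha, map_zero]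

/-- dimension cannot drop by more than the number of generators -/
lemma dim_le_add {L G : Type} [CommRing L] [CommRing G] [IsLocalRing L] [IsNoetherianRing L] (f : L →+* G) (hf : Function.Surjective f) (s : Finset L)
    (hs : (s : Set L) ⊆ maximalIdeal L) (hk : RingHom.ker f = Ideal.span (s : Set L)) : ringKrullDim L ≤ ringKrullDim G + s.card := by
  have h1 := ringKrullDim_le_ringKrullDim_quotient_add_card (R := L) s (by rw [IsLocalRing.ringJacobson_eq_maximalIdeal]; exact hs)
  have e := ringKrullDim_eq_of_ringEquiv (RingHom.quotientKerEquivOfSurjective hf)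
  rw [← e, hk]
  exact h1

lemma dim_adjoin {A S : Type} [CommRing A] [IsNoetherianRing A] [CommRing S] [IsDomain S] [Algebra A S] (B B' : Subalgebra A S) [IsNoetherianRing B]
    (hle : B ≤ B') (x : S) (hB' : B' ≤ B ⊔ Algebra.adjoin A {x}) (hx : x ∈ B') (c : S) (hc : c ∈ B) (hc0 : c ≠ 0) (hcx : c * x ∈ B) :
    ringKrullDim B' ≤ ringKrullDim B := by
  let i : B →+* B' := (Subalgebra.inclusion hle).toRingHom
  let f : Polynomial B →+* B' := Polynomial.eval₂RingHom i ⟨x, hx⟩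
  have hf : Function.Surjective f := by
    intro y
    let W : Subalgebra A S :=
      { ((B'.val.toRingHom.comp f).range) with
        algebraMap_mem' := fun a => ⟨Polynomial.C (algebraMap A B a), by
          change ((f (Polynomial.C (algebraMap A B a)) : B') : S) = _
          simp only [f, Polynomial.coe_eval₂RingHom, Polynomial.eval₂_C]; rfl⟩ }
    have h1 : B ⊔ Algebra.adjoin A {x} ≤ W := by
      refine sup_le ?_ ?_
      · intro b hb
        refine ⟨Polynomial.C ⟨b, hb⟩, ?_⟩
        change ((f (Polynomial.C ⟨b, hb⟩) : B') : S) = b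
        simp only [f, Polynomial.coe_eval₂RingHom, Polynomial.eval₂_C]; rfl
      · rw [Algebra.adjoin_le_iff]
        rintro _ rfl
        refine ⟨Polynomial.X, ?_⟩
        change ((f Polynomial.X : B') : S) = _
        simp only [f, Polynomial.coe_eval₂RingHom, Polynomial.eval₂_X]
    obtain ⟨z, hz⟩ := h1 (hB' y.2)
    exact ⟨z, Subtype.ext hz⟩
  have h := ringKrullDim_succ_le_of_surjective f hf (r := Polynomial.C ⟨c, hc⟩ * Polynomial.X - Polynomial.C ⟨_, hcx⟩)
    (mem_nonZeroDivisors_of_ne_zero (by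
      intro h0
      have := congrArg (fun p => Polynomial.coeff p 1) h0
      simp only [Polynomial.coeff_sub, Polynomial.coeff_C_mul, Polynomial.coeff_X_one, mul_one, Polynomial.coeff_C_succ, sub_zero, Polynomial.coeff_zero] at this
      exact hc0 (congrArg Subtype.val this)))
    (by
      simp only [f, Polynomial.coe_eval₂RingHom, Polynomial.eval₂_sub, Polynomial.eval₂_mul, Polynomial.eval₂_C, Polynomial.eval₂_X]
      refine sub_eq_zero.2 (Subtype.ext ?_)
      rfl)
  rw [Polynomial.ringKrullDim_of_isNoetherianRing] at h
  exact ENat.WithBot.add_le_add_one_right_iff.1 h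

variable {A : Type} [CommRing A] [IsNoetherianRing A] {r : ℕ} {M : Submodule A (Fin r → A)}

lemma rees_dim [IsDomain A] {n : ℕ} (hdim : ringKrullDim A = n) {a : A} (ha : a ≠ 0) (hM : ∀ v, a • v ∈ M) :
    ringKrullDim ↥(reesAlg A r M) ≤ (n + r : ℕ) := by
  classical
  let S := MvPolynomial (Fin r) A
  let u : MvPolynomial (Fin r) A →ₐ[A] S := aeval fun i => C a * X i
  obtain ⟨s, hs⟩ : (sub1 A r M).FG := (IsNoetherian.noetherian M).map _
  have hu : ∀ s : Finset S, ((s : Set S) ⊆ sub1 A r M) → ringKrullDim ↥(u.range ⊔ Algebra.adjoin A (s : Set S)) ≤ (n + r : ℕ) ∧ IsNoetherianRing ↥(u.range ⊔ Algebra.adjoin A (s : Set S)) := by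
    intro s
    induction s using Finset.induction_on with
    | empty =>
      intro _
      rw [Finset.coe_empty, Algebra.adjoin_empty, sup_bot_eq]
      constructor
      · have := ringKrullDim_le_of_surjective u.rangeRestrict.toRingHom u.rangeRestrict_surjective
        refine this.trans ?_
        rw [MvPolynomial.ringKrullDim_of_isNoetherianRing, hdim]
        simp
      · exact isNoetherianRing_of_surjective _ _ u.rangeRestrict.toRingHom u.rangeRestrict_surjective
    | insert x s hx ih =>
      intro h
      have hx1 : x ∈ sub1 A r M := h (by simp)
      obtain ⟨h1, h2⟩ := ih (fun y hy => h (by simp [Finset.mem_coe.1 hy]))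
      have hle : u.range ⊔ Algebra.adjoin A (s : Set S) ≤ u.range ⊔ Algebra.adjoin A ((insert x s : Finset S) : Set S) :=
        sup_le_sup_left (Algebra.adjoin_mono (by simp)) _
      have hxm : x ∈ u.range ⊔ Algebra.adjoin A ((insert x s : Finset S) : Set S) :=
        (le_sup_right : Algebra.adjoin A ((insert x s : Finset S) : Set S) ≤ _) (Algebra.subset_adjoin (by simp))
      constructor
      · refine (dim_adjoin _ _ hle x ?_ hxm (C a) ?_ ?_ ?_).trans h1
        · rw [sup_assoc, ← Algebra.adjoin_union, Finset.coe_insert, Set.union_singleton]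
        · exact Subalgebra.algebraMap_mem _ a
        · exact fun h => ha (C_injective _ _ (h.trans C_0.symm))
        · refine (le_sup_left : u.range ≤ _) ?_
          obtain ⟨v, _, rfl⟩ := hx1
          refine ⟨emb A r v, ?_⟩
          change u (emb A r v) = C a * emb A r v
          simp only [emb, Fintype.linearCombination_apply, map_sum, map_smul, Finset.mul_sum]
          refine Finset.sum_congr rfl fun i _ => ?_
          simp only [u, aeval_X, mul_smul_comm]
      · have hfg : (u.range ⊔ Algebra.adjoin A ((insert x s : Finset S) : Set S)).FG := by
          refine Subalgebra.FG.sup ?_ ⟨_, rfl⟩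
          rw [← Algebra.map_top]
          exact Subalgebra.FG.map _ Algebra.FiniteType.out
        have : Algebra.FiniteType A ↥(u.range ⊔ Algebra.adjoin A ((insert x s : Finset S) : Set S)) :=
          (Subalgebra.fg_iff_finiteType _).1 hfg
        exact Algebra.FiniteType.isNoetherianRing A _
  have hss : (s : Set S) ⊆ sub1 A r M := by rw [← hs]; exact Submodule.subset_span
  have e : u.range ⊔ Algebra.adjoin A (s : Set S) = reesAlg A r M := by
    have e1 : reesAlg A r M = Algebra.adjoin A (s : Set S) := by
      rw [reesAlg, ← hs, Algebra.adjoin_span]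
    rw [← e1]
    refine sup_eq_right.2 ?_
    rintro _ ⟨p, rfl⟩
    change u p ∈ _
    induction p using MvPolynomial.induction_on with
    | C c => rw [← MvPolynomial.algebraMap_eq, AlgHom.commutes]; exact Subalgebra.algebraMap_mem _ c
    | add p q hp hq => rw [map_add]; exact add_mem hp hq
    | mul_X p i hp =>
      rw [map_mul]
      refine mul_mem hp ?_
      refine Algebra.subset_adjoin ?_
      refine ⟨a • Pi.single i 1, hM _, ?_⟩
      rw [map_smul]
      simp only [u, aeval_X, MvPolynomial.smul_eq_C_mul]
      congr 1
      simp [emb, Fintype.linearCombination_apply_single]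
  have := (hu s hss).1
  rw [e] at this
  exact this

lemma fin_colength [IsLocalRing A] {W : Type} [AddCommGroup W] [Module A W] [Module.Finite A W] (hlen : ∃ n : ℕ, modLength A W = (n : WithBot ℕ∞)) :
    ∃ c : ℕ, ∀ t ∈ maximalIdeal A ^ c, ∀ w : W, t • w = 0 := by
  obtain ⟨n, hn⟩ := hlen
  have hst : ∃ c, maximalIdeal A ^ c • (⊤ : Submodule A W) = maximalIdeal A ^ (c + 1) • (⊤ : Submodule A W) := by
    by_contra hcon
    push Not at hcon
    let g : ℕ → Submodule A W := fun c => maximalIdeal A ^ c • ⊤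
    have hanti : StrictAnti g := by
      refine strictAnti_nat_of_succ_lt fun c => lt_of_le_of_ne ?_ (hcon c).symm
      exact Submodule.smul_mono_left (Ideal.pow_le_pow_right (Nat.le_succ c))
    let p : LTSeries (Submodule A W) :=
      { length := n + 1
        toFun := fun i => g (n + 1 - i)
        step := fun i => hanti (by have := i.2; simp only [Fin.val_succ, Fin.val_castSucc]; omega) }
    have := Order.LTSeries.length_le_krullDim p
    rw [modLength] at hn
    rw [hn] at this
    have h2 : n + 1 ≤ n := by exact_mod_cast this
    omega
  obtain ⟨c, hc⟩ := hst
  have h0 : maximalIdeal A ^ c • (⊤ : Submodule A W) = ⊥ := by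
    refine Submodule.eq_bot_of_le_smul_of_le_jacobson_bot (maximalIdeal A) _ ?_ ?_ (IsLocalRing.maximalIdeal_le_jacobson _)
    · exact IsNoetherian.noetherian _
    · rw [← Submodule.mul_smul, ← pow_succ', ← hc]
  refine ⟨c, fun t ht w => ?_⟩
  have : t • w ∈ maximalIdeal A ^ c • (⊤ : Submodule A W) := Submodule.smul_mem_smul ht trivial
  rw [h0] at this
  exact this
end locq

section sop

lemma unitDiff_image {A G : Type} [CommRing A] [CommRing G] [Nontrivial G] (k : A →+* G) {Λ : Set A} (hΛ : UnitDiff Λ) (hinf : Λ.Infinite) :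
    UnitDiff (k '' Λ) ∧ (k '' Λ).Infinite := by
  have hinj : Set.InjOn k Λ := by
    intro a ha b hb hab
    by_contra hne
    have h1 := (hΛ a ha b hb hne).map k
    rw [map_sub, hab, sub_self] at h1
    exact not_isUnit_zero h1
  refine ⟨?_, hinf.image hinj⟩
  rintro _ ⟨a, ha, rfl⟩ _ ⟨b, hb, rfl⟩ hne
  rw [← map_sub]
  exact (hΛ a ha b hb (fun h => hne (by rw [h]))).map k

/-- general elements form a system of parameters -/
lemma exists_sop {A G : Type} [CommRing A] [CommRing G] [IsLocalRing G] [IsNoetherianRing G] (k : A →+* G) {Λ : Set A} (hΛ : UnitDiff Λ)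
    (hinf : Λ.Infinite) {n : ℕ} (y : Fin n → G) (hy : ∀ P : Ideal G, P.IsPrime → (∀ i, y i ∈ P) → P = maximalIdeal G)
    {d : ℕ} (hd : ringKrullDim G = d) :
    ∃ l : Fin d → A, maximalIdeal G ≤ (Ideal.span (Set.range fun j => ∑ i : Fin n, k (l j) ^ (i : ℕ) * y i)).radical := by
  obtain ⟨hΛ', hinf'⟩ := unitDiff_image k hΛ hinf
  have hmax : (maximalIdeal G).height = d := by
    have := IsLocalRing.maximalIdeal_height_eq_ringKrullDim (R := G)
    rw [hd] at this
    exact WithBot.coe_injective this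
  let g : A → G := fun l => ∑ i : Fin n, k l ^ (i : ℕ) * y i
  have key : ∀ m ≤ d, ∃ l : Fin m → A, ∀ P : Ideal G, P.IsPrime → (∀ j, g (l j) ∈ P) → (m : ℕ∞) ≤ P.height := by
    intro m
    induction m with
    | zero => intro _; exact ⟨Fin.elim0, fun P _ _ => by simp⟩
    | succ m ih =>
      intro hm
      obtain ⟨l, hl⟩ := ih (by omega)
      set I := Ideal.span (Set.range fun j => g (l j)) with hI
      obtain ⟨_, ⟨l', hl', rfl⟩, hP⟩ := avoid_primes hΛ' hinf' (I.minimalPrimes \ {maximalIdeal G})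
        ((Ideal.finite_minimalPrimes_of_isNoetherianRing G I).subset Set.diff_subset) (fun P hP => hP.1.1.1) y
        (fun P hP h => hP.2 (hy P hP.1.1.1 h))
      refine ⟨Fin.snoc l l', fun P hPp h => ?_⟩
      have h1 : ∀ j, g (l j) ∈ P := fun j => by simpa using h j.castSucc
      have h2 : g l' ∈ P := by simpa using h (Fin.last m)
      have hIP : I ≤ P := by rw [hI, Ideal.span_le]; rintro _ ⟨j, rfl⟩; exact h1 j
      obtain ⟨P0, hP0, hle⟩ := Ideal.exists_minimalPrimes_le hIP
      by_cases hm0 : P0 = maximalIdeal G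
      · have : P = maximalIdeal G := le_antisymm (IsLocalRing.le_maximalIdeal hPp.ne_top) (hm0 ▸ hle)
        rw [this, hmax]; exact_mod_cast hm
      · have h3 : g l' ∉ P0 := hP P0 ⟨hP0, hm0⟩
        have hlt : P0 < P := lt_of_le_of_ne hle (by rintro rfl; exact h3 h2)
        haveI := hP0.1.1
        haveI := hPp
        have h4 := hl P0 hP0.1.1 (fun j => hP0.1.2 (Ideal.subset_span ⟨j, rfl⟩))
        have h5 := Ideal.height_strict_mono_of_isPrime hlt
        push_cast
        exact (Order.add_one_le_of_lt (lt_of_le_of_lt h4 h5))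
  obtain ⟨l, hl⟩ := key d le_rfl
  refine ⟨l, ?_⟩
  rw [Ideal.radical_eq_sInf]
  refine le_sInf ?_
  rintro P ⟨hP, hPp⟩
  have h := hl P hPp (fun j => hP (Ideal.subset_span ⟨j, rfl⟩))
  haveI := hPp
  rw [← hmax] at h
  exact (Ideal.eq_of_le_of_height_le _ (IsLocalRing.le_maximalIdeal hPp.ne_top) h).ge

/-- few elements do not generate up to radical -/
lemma dim_le_of_rad {G : Type} [CommRing G] [IsLocalRing G] [IsNoetherianRing G] {n : ℕ} (y : Fin n → G) (hy : ∀ i, y i ∈ maximalIdeal G)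
    (h : maximalIdeal G ≤ (Ideal.span (Set.range y)).radical) : ringKrullDim G ≤ n := by
  classical
  have hmin : maximalIdeal G ∈ (Ideal.span ((Finset.univ.image y : Finset G) : Set G)).minimalPrimes := by
    rw [Finset.coe_image, Finset.coe_univ, Set.image_univ]
    refine ⟨⟨inferInstance, ?_⟩, ?_⟩
    · rw [Ideal.span_le]; rintro _ ⟨i, rfl⟩; exact hy i
    · rintro P ⟨hP, hle⟩ _
      exact h.trans ((Ideal.IsPrime.radical_le_iff hP).2 hle)
  have h1 := Ideal.height_le_card_of_mem_minimalPrimes_span_finset hmin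
  rw [← IsLocalRing.maximalIdeal_height_eq_ringKrullDim]
  have h2 : (Finset.univ.image y).card ≤ n := by
    simpa using (Finset.card_image_le (s := Finset.univ) (f := y))
  have h3 : (maximalIdeal G).height ≤ (n : ℕ∞) := h1.trans (by exact_mod_cast h2)
  exact_mod_cast h3

end sop

section minors
variable {A : Type} [CommRing A] {r : ℕ}

lemma hdet_map {κ : Type} [CommRing κ] (k : A →+* κ) (τ : Fin (r + 1) → Fin r → A) (i) :
    hdet (fun i j => k (τ i j)) i = k (hdet τ i) := by
  rw [hdet_eq, hdet_eq, map_mul, map_pow, map_neg, map_one]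
  congr 1
  exact (RingHom.map_det k (Matrix.of fun (a b : Fin r) => τ (i.succAbove a) b)).symm

lemma exists_kernel {κ : Type} [Field κ] (τ : Fin (r + 1) → Fin r → κ) (h : ∀ i, hdet τ i = 0) :
    ∃ ψ : Fin r → κ, ψ ≠ 0 ∧ ∀ i, ∑ j, τ i j * ψ j = 0 := by
  by_contra hcon
  push Not at hcon
  have hsurj : Function.Surjective (Matrix.mulVecLin (Matrix.of τ)) := by
    intro v
    have hd : (NM τ v).det = 0 := by
      rw [NM_det]; exact Finset.sum_eq_zero fun i _ => by rw [h, mul_zero]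
    obtain ⟨c, hc, hc0⟩ := Matrix.exists_mulVec_eq_zero_iff.2 hd
    have hrow : ∀ i, v i * c 0 + ∑ j : Fin r, τ i j * c j.succ = 0 := by
      intro i
      have := congrFun hc0 i
      simp only [Matrix.mulVec, dotProduct, NM, Fin.sum_univ_succ, Fin.cons_zero, Fin.cons_succ, Pi.zero_apply] at this
      exact this
    have hc1 : c 0 ≠ 0 := by
      intro h0
      obtain ⟨i, hi⟩ := hcon (fun j => c j.succ) (by
        intro hz
        apply hc
        ext j
        refine Fin.cases h0 (fun j => ?_) j
        exact congrFun hz j)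
      apply hi
      have := hrow i
      rwa [h0, mul_zero, zero_add] at this
    refine ⟨fun j => - (c 0)⁻¹ * c j.succ, ?_⟩
    ext i
    simp only [Matrix.mulVecLin_apply, Matrix.mulVec, dotProduct, Matrix.of_apply]
    have e : ∑ j, τ i j * (-(c 0)⁻¹ * c j.succ) = -(c 0)⁻¹ * ∑ j, τ i j * c j.succ := by
      rw [Finset.mul_sum]; exact Finset.sum_congr rfl fun j _ => by ring
    rw [e, eq_neg_of_add_eq_zero_right (hrow i)]
    field_simp
  have := LinearMap.finrank_le_finrank_of_surjective hsurj
  simp at this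

end minors

section redn
variable {A : Type} [CommRing A] [IsLocalRing A] [IsNoetherianRing A] {r : ℕ} {M : Submodule A (Fin r → A)}

lemma gr_fg (n : ℕ) : (gr A r M n).FG := by
  have h1 : (sub1 A r M ^ n).FG := Submodule.FG.pow ((IsNoetherian.noetherian M).map _) n
  have e : (gr A r M n).map (reesAlg A r M).val.toLinearMap = sub1 A r M ^ n := by
    ext x
    constructor
    · rintro ⟨y, hy, rfl⟩; exact (mem_gr' A r M).1 hy
    · intro hx; exact ⟨⟨x, sub1_pow_le A r M n x hx⟩, (mem_gr' A r M).2 hx, rfl⟩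
  rw [← e] at h1
  exact Submodule.fg_of_fg_map_injective _ Subtype.val_injective h1

lemma JJ_hom : (Fib.JJ A r M).IsHomogeneous (gr A r M) := by
  refine Ideal.homogeneous_span _ _ ?_
  rintro _ ⟨t, _, rfl⟩
  exact ⟨0, (mem_gr A r M).2 (isHomogeneous_C _ _)⟩

lemma JJ_pr {z : ↥(reesAlg A r M)} (hz : z ∈ Fib.JJ A r M) (n : ℕ) : pr (gr A r M) n z ∈ maximalIdeal A • gr A r M n := by
  have : ∀ c, pr (gr A r M) n (c * z) ∈ maximalIdeal A • gr A r M n := by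
    refine Submodule.span_induction (p := fun z _ => ∀ c, pr (gr A r M) n (c * z) ∈ maximalIdeal A • gr A r M n) ?_ ?_ ?_ ?_ hz
    · rintro _ ⟨t, ht, rfl⟩ c
      rw [mul_comm, pr_alg, ← Algebra.smul_def]
      exact Submodule.smul_mem_smul ht (pr_mem _ _ _)
    · intro c
      rw [mul_zero, pr_same _ (zero_mem _)]; exact zero_mem _
    · intro x y _ _ hx hy c
      rw [mul_add, pr_add]; exact add_mem (hx c) (hy c)
    · intro a x _ hx c
      rw [smul_eq_mul, ← mul_assoc]; exact hx _
  simpa using this 1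

/-- reduction from the fibre cone -/
lemma redn_of_rad {d : ℕ} (T : Fin d → ↥(reesAlg A r M)) (hT : ∀ i, T i ∈ gr A r M 1)
    (h : ∀ x ∈ gr A r M 1, ∃ N s, s ∉ gradedMax A r M ∧ s * x ^ N ∈ Ideal.span (Set.range T) ⊔ Fib.JJ A r M) :
    ∃ n : ℕ, ∀ x ∈ gr A r M (n + 1), x ∈ Ideal.span (Set.range T) := by
  haveI : IsNoetherianRing ↥(reesAlg A r M) := rees_noeth
  have hTh : (Ideal.span (Set.range T)).IsHomogeneous (gr A r M) := by
    refine Ideal.homogeneous_span _ _ ?_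
    rintro _ ⟨i, rfl⟩; exact ⟨1, hT i⟩
  set X := Ideal.span (Set.range T) ⊔ Fib.JJ A r M with hX
  have hXh : X.IsHomogeneous (gr A r M) := hTh.sup JJ_hom
  have h1 : Ideal.span (gr A r M 1 : Set ↥(reesAlg A r M)) ≤ X.radical := by
    rw [Ideal.span_le]
    intro x hx
    obtain ⟨N, s, hs, hsx⟩ := h x hx
    exact ⟨N, graded_cancel _ hXh s (pr0_unit A r M hs) _ hsx⟩
  obtain ⟨N, hN⟩ := Ideal.exists_pow_le_of_le_radical_of_fg h1 (IsNoetherian.noetherian _)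
  have h2 : ∀ n, ∀ x ∈ gr A r M n, x ∈ Ideal.span (gr A r M 1 : Set ↥(reesAlg A r M)) ^ n := by
    intro n
    induction n with
    | zero => intro x _; simp
    | succ n ih =>
      intro x hx
      rw [gr_gen] at hx
      rw [pow_succ']
      exact Submodule.mul_induction_on hx (fun a ha b hb => Ideal.mul_mem_mul (Ideal.subset_span ha) (ih b hb)) fun a b => add_mem
  refine ⟨N, ?_⟩
  have h3 : gr A r M (N + 1) ≤ (Ideal.span (Set.range T)).restrictScalars A := by
    refine Submodule.le_of_le_smul_of_le_jacobson_bot (I := maximalIdeal A) (gr_fg _) (IsLocalRing.maximalIdeal_le_jacobson _) ?_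
    intro x hx
    have hxX : x ∈ X := hN (Ideal.pow_le_pow_right (Nat.le_succ N) (h2 _ x hx))
    obtain ⟨a, _, ha, b, hb, hbJ, rfl⟩ := hom_sup _ hTh JJ_hom hx hxX
    refine Submodule.add_mem_sup ha ?_
    have := JJ_pr hbJ (N + 1)
    rwa [pr_same _ hb] at this
  exact fun x hx => h3 hx

/-- the maximal minors of a reduction define the closed point -/
lemma hdet_rad [IsDomain A] {c : ℕ} (hc : ∀ t ∈ maximalIdeal A ^ c, ∀ w : Fin r → A, t • w ∈ M)
    {τ : Fin (r + 1) → Fin r → A} {hτ : ∀ i, τ i ∈ M} (hred : Redn τ hτ) {P : Ideal A} (hP : P.IsPrime) (h : ∀ i, hdet τ i ∈ P) :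
    P = maximalIdeal A := by
  by_contra hne
  obtain ⟨s, hs, hsP⟩ : ∃ s ∈ maximalIdeal A, s ∉ P := by
    by_contra hcon
    push Not at hcon
    exact hne (le_antisymm (IsLocalRing.le_maximalIdeal hP.ne_top) hcon)
  let κ := FractionRing (A ⧸ P)
  let k : A →+* κ := (algebraMap (A ⧸ P) κ).comp (Ideal.Quotient.mk P)
  have hk : ∀ a, k a = 0 ↔ a ∈ P := by
    intro a
    rw [RingHom.comp_apply, FaithfulSMul.algebraMap_eq_zero_iff, Ideal.Quotient.eq_zero_iff_mem]
  obtain ⟨ψ, hψ, hψτ⟩ := exists_kernel (fun i j => k (τ i j)) (fun i => by rw [hdet_map, hk]; exact h i)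
  let χ : MvPolynomial (Fin r) A →+* κ := eval₂Hom k ψ
  have hχ : ∀ w, χ (emb A r w) = ∑ j, k (w j) * ψ j := by
    intro w
    rw [emb, Fintype.linearCombination_apply, map_sum]
    refine Finset.sum_congr rfl fun j _ => ?_
    rw [MvPolynomial.smul_eq_C_mul, map_mul]
    simp [χ]
  let χ' : ↥(reesAlg A r M) →+* κ := χ.comp (reesAlg A r M).val.toRingHom
  have h1 := gr1_le_prime hred (P := RingHom.ker χ') (RingHom.ker_isPrime _) (fun i => by
    rw [RingHom.mem_ker]
    exact (hχ (τ i)).trans (hψτ i))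
  apply hψ
  ext j
  have hm : s ^ c • (Pi.single j 1 : Fin r → A) ∈ M := hc _ (Ideal.pow_mem_pow hs c) _
  have h2 := h1 ⟨emb A r (s ^ c • Pi.single j 1), Algebra.subset_adjoin ⟨_, hm, rfl⟩⟩ (emb_hom A r _)
  rw [RingHom.mem_ker] at h2
  have h3 : χ (emb A r (s ^ c • Pi.single j 1)) = 0 := h2
  rw [hχ, Finset.sum_eq_single j] at h3
  · simp only [Pi.smul_apply, Pi.single_eq_same, smul_eq_mul, mul_one] at h3
    rcases mul_eq_zero.1 h3 with h4 | h4
    · exact absurd (hP.mem_of_pow_mem _ ((hk _).1 h4)) hsP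
    · exact h4
  · intro b _ hb
    simp [hb]
  · simp

lemma top_of_unit {τ : Fin (r + 1) → Fin r → A} (hτ : ∀ i, τ i ∈ M) {i} (h : IsUnit (hdet τ i)) : M = ⊤ := by
  rw [eq_top_iff]
  intro w _
  have h1 : hdet τ i • w ∈ M := by
    rw [Phi_cr]
    exact sum_mem fun j _ => M.smul_mem _ (hτ j)
  exact (Submodule.smul_mem_iff_of_isUnit M h).1 h1

lemma hdet_zero_row {τ : Fin (r + 1) → Fin r → A} {k i : Fin (r + 1)} (hk : τ k = 0) (hik : i ≠ k) : hdet τ i = 0 := by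
  rw [hdet_eq]
  obtain ⟨a, ha⟩ := Fin.exists_succAbove_eq hik.symm
  have : Matrix.det (Matrix.of fun (a b : Fin r) => τ (i.succAbove a) b) = 0 :=
    Matrix.det_eq_zero_of_row_eq_zero a (fun b => by simp [ha, hk])
  exact mul_eq_zero_of_right _ this
end redn

section big

lemma ker_le_max {L G : Type} [CommRing L] [CommRing G] [IsLocalRing L] [IsLocalRing G] (f : L →+* G) (hf : Function.Surjective f) (t : L) :
    f t ∈ maximalIdeal G ↔ t ∈ maximalIdeal L := by
  have h1 : ∀ t, f t ∈ maximalIdeal G → t ∈ maximalIdeal L := by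
    intro t h
    rw [mem_maximalIdeal, mem_nonunits_iff] at h ⊢
    exact fun hu => h (hu.map f)
  refine ⟨h1 t, fun ht => ?_⟩
  rw [mem_maximalIdeal, mem_nonunits_iff]
  intro hu
  obtain ⟨v, hv⟩ := hu.exists_right_inv
  obtain ⟨v, rfl⟩ := hf v
  have h2 : t * v - 1 ∈ maximalIdeal L := h1 _ (by rw [map_sub, map_mul, hv, map_one, sub_self]; exact zero_mem _)
  have h3 : (1 : L) ∈ maximalIdeal L := by
    have := sub_mem (Ideal.mul_mem_right v _ ht) h2
    simpa using this
  exact (Ideal.ne_top_iff_one _).1 (maximalIdeal.isMaximal L).ne_top h3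

lemma big_case {L G : Type} [CommRing L] [CommRing G] [IsLocalRing L] [IsLocalRing G] (f : L →+* G) (hf : Function.Surjective f)
    (p q : L) (hp : p ∈ maximalIdeal L) (hq : q ∈ maximalIdeal L) (hk : RingHom.ker f = Ideal.span {p, q}) {d : ℕ}
    (hd : ringKrullDim L = (d + 2 : ℕ)) (hB : IsBuchsbaumLocalRing L) (x : Fin d → G) (hx : ∀ i, x i ∈ maximalIdeal G)
    (hrad : maximalIdeal G ≤ (Ideal.span (Set.range x)).radical) (i : Fin d) (a : G) (ha : a * x i ∈ Ideal.span (x '' {j | j < i}))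
    (y : G) (hy : y ∈ maximalIdeal G) : y * a ∈ Ideal.span (x '' {j | j < i}) := by
  choose z hz using fun i => hf (x i)
  have hzx : (fun i => f (z i)) = x := funext hz
  let w : Fin (d + 2) → L := Fin.cons p (Fin.cons q z)
  have hw0 : w 0 = p := rfl
  have hw1 : w (Fin.succ 0) = q := rfl
  have hw2 : ∀ j : Fin d, w j.succ.succ = z j := fun j => rfl
  have hle : ∀ S : Set (Fin d), ∀ U : Set (Fin (d + 2)), 0 ∈ U → Fin.succ 0 ∈ U → (∀ j ∈ S, j.succ.succ ∈ U) →
      Ideal.span (z '' S) ⊔ RingHom.ker f ≤ Ideal.span (w '' U) := by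
    intro S U h0 h1 h2
    rw [hk]
    refine sup_le (Ideal.span_le.2 ?_) (Ideal.span_le.2 ?_)
    · rintro _ ⟨j, hj, rfl⟩
      exact Ideal.subset_span ⟨_, h2 j hj, rfl⟩
    · rintro t (rfl | ht)
      · exact Ideal.subset_span ⟨_, h0, rfl⟩
      · rw [Set.mem_singleton_iff.1 ht]
        exact Ideal.subset_span ⟨_, h1, rfl⟩
  have hw : ∀ j, w j ∈ maximalIdeal L := by
    intro j
    refine Fin.cases hp (fun j => Fin.cases hq (fun j => ?_) j) j
    change z j ∈ _
    rw [← ker_le_max f hf, hz]; exact hx j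
  have hwr : maximalIdeal L ≤ (Ideal.span (Set.range w)).radical := by
    intro t ht
    obtain ⟨N, hN⟩ := hrad ((ker_le_max f hf t).2 ht)
    refine ⟨N, ?_⟩
    rw [← Set.image_univ]
    refine hle Set.univ Set.univ trivial trivial (fun _ _ => trivial) ?_
    refine mem_map_of_surj f hf z Set.univ ?_
    rw [hzx, Set.image_univ, map_pow]; exact hN
  obtain ⟨a, rfl⟩ := hf a
  obtain ⟨y, rfl⟩ := hf y
  have h1 : a * z i ∈ Ideal.span (w '' {j | j < i.succ.succ}) := by
    refine hle {j | j < i} _ ?_ ?_ ?_ (mem_map_of_surj f hf z _ ?_)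
    · exact Fin.succ_pos _
    · exact Fin.succ_lt_succ_iff.2 (Fin.succ_pos _)
    · intro j hj
      exact Fin.succ_lt_succ_iff.2 (Fin.succ_lt_succ_iff.2 hj)
    · rw [hzx, map_mul, hz]; exact ha
  have h2 := hB _ hd w hw hwr i.succ.succ (show a ∈ _ by
    rw [Submodule.mem_colon]
    intro s hs
    obtain ⟨c, rfl⟩ := Ideal.mem_span_singleton.1 hs
    rw [hw2, smul_eq_mul, ← mul_assoc]
    exact Ideal.mul_mem_right _ _ h1)
  rw [Submodule.mem_colon] at h2
  have h3 := h2 y ((ker_le_max f hf y).1 hy)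
  have h4 : Ideal.span (w '' {j | j < i.succ.succ}) ≤ (Ideal.span (x '' {j | j < i})).comap f := by
    rw [Ideal.span_le]
    have hkz : ∀ t ∈ ({p, q} : Set L), f t = 0 := fun t ht => by
      rw [← RingHom.mem_ker, hk]; exact Ideal.subset_span ht
    rintro _ ⟨j, hj, rfl⟩
    change f (w j) ∈ Ideal.span (x '' {j | j < i})
    revert hj
    refine Fin.cases (fun _ => ?_) (fun j => Fin.cases (fun _ => ?_) (fun j => ?_) j) j
    · rw [hw0, hkz _ (by simp)]; exact zero_mem _
    · rw [hw1, hkz _ (by simp)]; exact zero_mem _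
    · intro hj
      rw [hw2, hz]
      exact Ideal.subset_span ⟨j, Fin.succ_lt_succ_iff.1 (Fin.succ_lt_succ_iff.1 hj), rfl⟩
  have h5 := h4 h3
  rw [Ideal.mem_comap, smul_eq_mul, mul_comm, map_mul] at h5
  exact h5
end big

section topdim
variable {A : Type} [CommRing A] [IsLocalRing A] [IsNoetherianRing A] [IsDomain A] {r : ℕ} {M : Submodule A (Fin r → A)}

lemma JJ_eq {p q : A} (hpq : Ideal.span {p, q} = maximalIdeal A) (L : Type) [CommRing L] [Algebra ↥(reesAlg A r M) L] :
    (Fib.JJ A r M).map (algebraMap ↥(reesAlg A r M) L) =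
      Ideal.span {algebraMap ↥(reesAlg A r M) L (algebraMap A _ p), algebraMap ↥(reesAlg A r M) L (algebraMap A _ q)} := by
  have e : Fib.JJ A r M = Ideal.map (algebraMap A ↥(reesAlg A r M)) (Ideal.span {p, q}) := by rw [hpq]
  rw [e, Ideal.map_span, Ideal.map_span, Set.image_pair, Set.image_pair]

lemma rees_top (hM : M = ⊤) (x : MvPolynomial (Fin r) A) : x ∈ reesAlg A r M := by
  subst hM
  induction x using MvPolynomial.induction_on with
  | C c => exact Subalgebra.algebraMap_mem _ c
  | add p q hp hq => exact add_mem hp hq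
  | mul_X p i hp =>
    refine mul_mem hp (Algebra.subset_adjoin ⟨Pi.single i 1, trivial, ?_⟩)
    simp [emb, Fintype.linearCombination_apply_single]

lemma p_nzd {p : A} (hp0 : p ≠ 0) (L : Type) [CommRing L] [Algebra ↥(reesAlg A r M) L]
    [IsLocalization.AtPrime L (gradedMax A r M)] :
    algebraMap ↥(reesAlg A r M) L (algebraMap A _ p) ∈ nonZeroDivisors L := by
  refine IsLocalization.map_nonZeroDivisors_le (gradedMax A r M).primeCompl L ⟨_, ?_, rfl⟩
  refine mem_nonZeroDivisors_of_ne_zero fun h => hp0 ?_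
  have h2 : (C p : MvPolynomial (Fin r) A) = 0 := congrArg Subtype.val h
  exact C_injective _ _ (h2.trans C_0.symm)

lemma dim_abs {L G : Type} [CommRing L] [CommRing G] (f : L →+* G) (hf : Function.Surjective f) (P Q : L) (hPn : P ∈ nonZeroDivisors L)
    (hcan : ∀ a : L, a * Q ∈ Ideal.span {P} → a ∈ Ideal.span {P}) (hp : f P = 0) (hq : f Q = 0) :
    ringKrullDim G + 1 + 1 ≤ ringKrullDim L := by
  have h1 := ringKrullDim_quotient_succ_le_of_nonZeroDivisor hPn
  have hker : ∀ a ∈ Ideal.span {P}, f a = 0 := by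
    intro a ha
    obtain ⟨c, rfl⟩ := Ideal.mem_span_singleton.1 ha
    rw [map_mul, hp, zero_mul]
  let g : L ⧸ Ideal.span {P} →+* G := Ideal.Quotient.lift _ f hker
  have hg : Function.Surjective g := Ideal.Quotient.lift_surjective_of_surjective _ hker hf
  have h2 := ringKrullDim_succ_le_of_surjective g hg (r := Ideal.Quotient.mk _ Q) (by
    rw [mem_nonZeroDivisors_iff_right]
    intro z hz
    obtain ⟨z, rfl⟩ := Ideal.Quotient.mk_surjective z
    rw [← map_mul, Ideal.Quotient.eq_zero_iff_mem] at hz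
    exact Ideal.Quotient.eq_zero_iff_mem.2 (hcan z hz)) hq
  exact (add_le_add_left h2 1).trans h1

lemma can_top (hM : M = ⊤) {p q : A} (hpp : (Ideal.span {p}).IsPrime) (hqp : q ∉ Ideal.span {p}) (L : Type) [CommRing L] [Algebra ↥(reesAlg A r M) L]
    [IsLocalization.AtPrime L (gradedMax A r M)] {P Q : L} (hP : P = algebraMap ↥(reesAlg A r M) L (algebraMap A _ p))
    (hQ : Q = algebraMap ↥(reesAlg A r M) L (algebraMap A _ q)) (a : L) (ha : a * Q ∈ Ideal.span {P}) : a ∈ Ideal.span {P} := by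
  obtain ⟨b, s, rfl⟩ := IsLocalization.exists_mk'_eq (S := L) (gradedMax A r M).primeCompl a
  have hmap : Ideal.span {P} = (Ideal.span {algebraMap A ↥(reesAlg A r M) p}).map (algebraMap ↥(reesAlg A r M) L) := by
    rw [Ideal.map_span, Set.image_singleton, hP]
  have h2 : algebraMap ↥(reesAlg A r M) L (b * algebraMap A _ q) ∈ Ideal.span {P} := by
    have := Ideal.mul_mem_left _ (algebraMap ↥(reesAlg A r M) L s) ha
    rwa [hQ, ← mul_assoc, IsLocalization.mk'_spec', ← map_mul] at this
  rw [hmap, IsLocalization.algebraMap_mem_map_algebraMap_iff (gradedMax A r M).primeCompl] at h2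
  obtain ⟨t, ht, h3⟩ := h2
  have h4 : t * b ∈ Ideal.span {algebraMap A ↥(reesAlg A r M) p} := by
    obtain ⟨c, hc⟩ := Ideal.mem_span_singleton.1 h3
    have hc' : (t : MvPolynomial (Fin r) A) * ((b : MvPolynomial (Fin r) A) * C q) = C p * (c : MvPolynomial (Fin r) A) := congrArg Subtype.val hc
    have hdvd : (C p : MvPolynomial (Fin r) A) ∣ (t : MvPolynomial (Fin r) A) * (b : MvPolynomial (Fin r) A) := by
      rw [MvPolynomial.C_dvd_iff_dvd_coeff]
      intro n
      have h5 : coeff n ((t : MvPolynomial (Fin r) A) * (b : MvPolynomial (Fin r) A) * C q) = p * coeff n (c : MvPolynomial (Fin r) A) := by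
        rw [mul_assoc, hc', coeff_C_mul]
      rw [mul_comm _ (C q), coeff_C_mul, mul_comm q] at h5
      have h6 : coeff n ((t : MvPolynomial (Fin r) A) * (b : MvPolynomial (Fin r) A)) * q ∈ Ideal.span {p} := Ideal.mem_span_singleton.2 ⟨_, h5⟩
      exact Ideal.mem_span_singleton.1 ((hpp.mem_or_mem h6).resolve_right hqp)
    obtain ⟨e, he⟩ := hdvd
    exact Ideal.mem_span_singleton.2 ⟨⟨e, rees_top hM e⟩, Subtype.ext he⟩
  have h5 := Ideal.mem_map_of_mem (algebraMap ↥(reesAlg A r M) L) h4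
  rw [← hmap, map_mul] at h5
  rw [IsLocalization.mk'_eq_mul_mk'_one]
  exact Ideal.mul_mem_right _ _ ((Ideal.unit_mul_mem_iff_mem _ (IsLocalization.map_units L (⟨t, ht⟩ : (gradedMax A r M).primeCompl))).1 h5)

lemma dim_top (hM : M = ⊤) {p q : A} (hpp : (Ideal.span {p}).IsPrime) (hp0 : p ≠ 0) (hqp : q ∉ Ideal.span {p})
    (L : Type) [CommRing L] [Algebra ↥(reesAlg A r M) L]
    [IsLocalization.AtPrime L (gradedMax A r M)]
    {G : Type} [CommRing G] (f : L →+* G) (hf : Function.Surjective f)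
    (hp : f (algebraMap ↥(reesAlg A r M) L (algebraMap A _ p)) = 0) (hq : f (algebraMap ↥(reesAlg A r M) L (algebraMap A _ q)) = 0) :
    ringKrullDim G + 1 + 1 ≤ ringKrullDim L :=
  dim_abs f hf _ _ (p_nzd hp0 L) (can_top hM hpp hqp L rfl rfl) hp hq

lemma exists_redn {Λ : Set A} (hΛ : UnitDiff Λ) (hinf : Λ.Infinite) {G : Type} [CommRing G] [IsLocalRing G] [IsNoetherianRing G]
    (L : Type) [CommRing L] [Algebra ↥(reesAlg A r M) L]
    [IsLocalization.AtPrime L (gradedMax A r M)] [IsLocalRing L]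
    (f : L →+* G) (hf : Function.Surjective f)
    (hker : RingHom.ker f = (Fib.JJ A r M).map (algebraMap ↥(reesAlg A r M) L))
    {d : ℕ} (hd : ringKrullDim G = d) (hdr : d ≤ r + 1) :
    ∃ (τ : Fin (r + 1) → Fin r → A) (hτ : ∀ i, τ i ∈ M), Redn τ hτ ∧ ∀ i : Fin (r + 1), d ≤ i → τ i = 0 := by
  classical
  let k : A →+* G := f.comp ((algebraMap ↥(reesAlg A r M) L).comp (algebraMap A ↥(reesAlg A r M)))
  have hJ0 : ∀ t ∈ maximalIdeal A, f (algebraMap ↥(reesAlg A r M) L (algebraMap A _ t)) = 0 := by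
    intro t ht
    rw [← RingHom.mem_ker, hker]
    exact Ideal.mem_map_of_mem _ (Ideal.mem_map_of_mem _ ht)
  obtain ⟨n, w, hw⟩ := Submodule.fg_iff_exists_fin_generating_family.1 (IsNoetherian.noetherian M)
  have hwM : ∀ i, w i ∈ M := fun i => hw ▸ Submodule.subset_span ⟨i, rfl⟩
  let em : M → ↥(reesAlg A r M) := fun v => ⟨emb A r v, Algebra.subset_adjoin ⟨v, v.2, rfl⟩⟩
  let y : Fin n → G := fun i => f (algebraMap ↥(reesAlg A r M) L (em ⟨w i, hwM i⟩))
  have hy : ∀ P : Ideal G, P.IsPrime → (∀ i, y i ∈ P) → P = maximalIdeal G := by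
    intro P hP h
    have h1 : gradedMax A r M ≤ P.comap (f.comp (algebraMap ↥(reesAlg A r M) L)) := by
      refine Q_le_prime (hP.comap _) ?_ ?_
      · intro t ht
        rw [Ideal.mem_comap, RingHom.comp_apply, hJ0 t ht]; exact zero_mem _
      · intro x hx
        obtain ⟨v, hv, hvx⟩ := gr1_emb hx
        let W : Submodule A (Fin r → A) := (((P.comap (f.comp (algebraMap ↥(reesAlg A r M) L))).restrictScalars A).map (reesAlg A r M).val.toLinearMap).comap (emb A r)
        have hle : M ≤ W := by
          rw [← hw, Submodule.span_le]
          rintro _ ⟨i, rfl⟩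
          exact ⟨em ⟨w i, hwM i⟩, h i, rfl⟩
        obtain ⟨x', hx', hxx⟩ := hle hv
        have : x' = x := Subtype.ext (hxx.trans hvx)
        rw [← this]; exact hx'
    refine le_antisymm (IsLocalRing.le_maximalIdeal hP.ne_top) ?_
    intro g hg
    obtain ⟨t, rfl⟩ := hf g
    have ht := (ker_le_max f hf t).1 hg
    have h2 : maximalIdeal L ≤ P.comap f := by
      rw [← IsLocalization.AtPrime.map_eq_maximalIdeal (gradedMax A r M) L, Ideal.map_le_iff_le_comap]
      exact h1
    exact h2 ht
  obtain ⟨l, hl⟩ := exists_sop k hΛ hinf y hy hd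
  let v : Fin d → Fin r → A := fun j => ∑ i : Fin n, l j ^ (i : ℕ) • w i
  have hv : ∀ j, v j ∈ M := fun j => sum_mem fun i _ => M.smul_mem _ (hwM i)
  let T : Fin d → ↥(reesAlg A r M) := fun j => em ⟨v j, hv j⟩
  have hTf : ∀ j, f (algebraMap ↥(reesAlg A r M) L (T j)) = ∑ i : Fin n, k (l j) ^ (i : ℕ) * y i := by
    intro j
    have e : T j = ∑ i : Fin n, algebraMap A _ (l j) ^ (i : ℕ) * em ⟨w i, hwM i⟩ := by
      apply Subtype.ext
      rw [AddSubmonoidClass.coe_finsetSum]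
      change emb A r (∑ i : Fin n, l j ^ (i : ℕ) • w i) = _
      rw [map_sum]
      refine Finset.sum_congr rfl fun i _ => ?_
      rw [map_smul, Algebra.smul_def, map_pow]
      rfl
    rw [e, map_sum, map_sum]
    refine Finset.sum_congr rfl fun i _ => ?_
    rw [map_mul, map_mul, map_pow, map_pow]
    rfl
  obtain ⟨N, hN⟩ := redn_of_rad T (fun j => emb_hom A r _) (by
    intro x hx
    have h1 : f (algebraMap ↥(reesAlg A r M) L x) ∈ maximalIdeal G := by
      rw [ker_le_max f hf, ← IsLocalization.AtPrime.map_eq_maximalIdeal (gradedMax A r M) L]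
      exact Ideal.mem_map_of_mem _ (gr_le_Q A r M one_ne_zero hx)
    obtain ⟨N, hN⟩ := hl h1
    have h2 : algebraMap ↥(reesAlg A r M) L x ^ N ∈ Ideal.span ((fun j => algebraMap ↥(reesAlg A r M) L (T j)) '' Set.univ) ⊔ RingHom.ker f := by
      refine mem_map_of_surj f hf (fun j => algebraMap ↥(reesAlg A r M) L (T j)) Set.univ ?_
      rw [map_pow, Set.image_univ]
      simp only [hTf]
      exact hN
    have e : Ideal.span ((fun j => algebraMap ↥(reesAlg A r M) L (T j)) '' Set.univ) = (Ideal.span (Set.range T)).map (algebraMap ↥(reesAlg A r M) L) := by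
      rw [Ideal.map_span, Set.image_univ, ← Set.range_comp]; rfl
    rw [e, hker, ← Ideal.map_sup, ← map_pow, IsLocalization.algebraMap_mem_map_algebraMap_iff (gradedMax A r M).primeCompl] at h2
    obtain ⟨s, hs, h3⟩ := h2
    exact ⟨N, s, hs, h3⟩)
  let τ : Fin (r + 1) → Fin r → A := fun i => if h : (i : ℕ) < d then v ⟨i, h⟩ else 0
  have hτ : ∀ i, τ i ∈ M := by
    intro i
    simp only [τ]
    split_ifs
    · exact hv _
    · exact zero_mem _
  refine ⟨τ, hτ, ⟨N, fun x hx => ?_⟩, fun i hi => dif_neg (by omega)⟩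
  refine Ideal.span_mono ?_ (hN x hx)
  rintro _ ⟨j, rfl⟩
  refine ⟨⟨j, by omega⟩, ?_⟩
  apply Subtype.ext
  change emb A r (τ ⟨j, _⟩) = emb A r (v j)
  congr 1
  exact dif_pos j.2
end topdim

section assembly
variable {A : Type} [CommRing A] [IsLocalRing A] [IsNoetherianRing A] [IsDomain A] {r : ℕ} {M : Submodule A (Fin r → A)}

lemma hG_of_dim {G : Type} [CommRing G] [IsLocalRing G] [IsNoetherianRing G]
    (f : Localization.AtPrime (gradedMax A r M) →+* G) (hf : Function.Surjective f)
    (hker : RingHom.ker f = (Fib.JJ A r M).map (algebraMap ↥(reesAlg A r M) (Localization.AtPrime (gradedMax A r M))))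
    (hd : ringKrullDim G = (r + 1 : ℕ)) (u : Fin r → ↥(reesAlg A r M)) (hu : ∀ i, u i ∈ gradedMax A r M) :
    ¬ gradedMax A r M ≤ (Ideal.map (algebraMap A _) (maximalIdeal A) ⊔ Ideal.span (Set.range u)).radical := by
  intro h
  set L := Localization.AtPrime (gradedMax A r M)
  let k : ↥(reesAlg A r M) →+* G := f.comp (algebraMap ↥(reesAlg A r M) L)
  have hk : ∀ z ∈ gradedMax A r M, k z ∈ maximalIdeal G := by
    intro z hz
    refine (ker_le_max f hf (algebraMap ↥(reesAlg A r M) L z)).2 ?_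
    rw [← Localization.AtPrime.map_eq_maximalIdeal]
    exact Ideal.mem_map_of_mem _ hz
  have hle : Ideal.map (algebraMap A _) (maximalIdeal A) ⊔ Ideal.span (Set.range u) ≤ (Ideal.span (Set.range fun i => k (u i))).comap k := by
    refine sup_le ?_ ?_
    · intro z hz
      have h0 : k z = 0 := by
        have : algebraMap ↥(reesAlg A r M) L z ∈ RingHom.ker f := by
          rw [hker]; exact Ideal.mem_map_of_mem _ hz
        exact this
      rw [Ideal.mem_comap, h0]; exact zero_mem _
    · rw [Ideal.span_le]
      rintro _ ⟨i, rfl⟩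
      exact Ideal.subset_span ⟨i, rfl⟩
  have h2 : ringKrullDim G ≤ (r : ℕ) := by
    refine dim_le_of_rad (fun i => k (u i)) (fun i => hk _ (hu i)) ?_
    intro g hg
    obtain ⟨t, rfl⟩ := hf g
    have ht := (ker_le_max f hf t).1 hg
    rw [← Localization.AtPrime.map_eq_maximalIdeal] at ht
    have h3 : Ideal.map (algebraMap ↥(reesAlg A r M) L) (gradedMax A r M) ≤ ((Ideal.span (Set.range fun i => k (u i))).radical).comap f := by
      rw [Ideal.map_le_iff_le_comap]
      intro z hz
      obtain ⟨n, hn⟩ := h hz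
      refine ⟨n, ?_⟩
      have := hle hn
      rw [Ideal.mem_comap, map_pow] at this
      exact this
    exact h3 ht
  rw [hd] at h2
  have : r + 1 ≤ r := by exact_mod_cast h2
  omega

lemma exists_good (hdim : ringKrullDim A = 2) (hr : 0 < r) {p q : A} (hpq : Ideal.span {p, q} = maximalIdeal A) (hpp : (Ideal.span {p}).IsPrime) (hp0 : p ≠ 0) (hqp : q ∉ Ideal.span {p})
    {Λ : Set A} (hΛ : UnitDiff Λ) (hinf : Λ.Infinite) {c : ℕ} (hc : ∀ t ∈ maximalIdeal A ^ c, ∀ w : Fin r → A, t • w ∈ M)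
    {G : Type} [CommRing G] [IsLocalRing G] [IsNoetherianRing G]
    (f : Localization.AtPrime (gradedMax A r M) →+* G) (hf : Function.Surjective f)
    (hker : RingHom.ker f = (Fib.JJ A r M).map (algebraMap ↥(reesAlg A r M) (Localization.AtPrime (gradedMax A r M))))
    {d : ℕ} (hd : ringKrullDim G = d) (he : ringKrullDim (Localization.AtPrime (gradedMax A r M)) = (d + 1 : ℕ)) :
    d = r + 1 ∧ ∃ (τ : Fin (r + 1) → Fin r → A) (hτ : ∀ i, τ i ∈ M), Redn τ hτ ∧ (∀ i, hdet τ i ∈ maximalIdeal A) ∧ (∀ i, hdet τ i ≠ 0) ∧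
      (∀ a b, a ≠ b → maximalIdeal A ≤ (Ideal.span {hdet τ a, hdet τ b}).radical) ∧
      maximalIdeal A ≤ (Ideal.span (Set.range (hdet τ))).radical := by
  set L := Localization.AtPrime (gradedMax A r M)
  have hpm : p ∈ maximalIdeal A := hpq ▸ Ideal.subset_span (by simp)
  have hdr : d ≤ r + 1 := by
    have h1 : ringKrullDim ↥(reesAlg A r M) ≤ ((2 + r : ℕ) : WithBot ℕ∞) :=
      rees_dim (n := 2) (by exact_mod_cast hdim) (pow_ne_zero c hp0) (fun v => hc _ (Ideal.pow_mem_pow hpm c) v)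
    have h2 := (IsLocalization.AtPrime.ringKrullDim_eq_height (gradedMax A r M) L).symm.trans he
    have h3 := Ideal.height_le_ringKrullDim_of_ne_top (Ideal.IsPrime.ne_top (inferInstance : (gradedMax A r M).IsPrime))
    rw [h2] at h3
    have : d + 1 ≤ 2 + r := by exact_mod_cast h3.trans h1
    omega
  have hkz : ∀ z ∈ maximalIdeal A, f (algebraMap ↥(reesAlg A r M) L (algebraMap A _ z)) = 0 := by
    intro z hz
    have : algebraMap ↥(reesAlg A r M) L (algebraMap A _ z) ∈ RingHom.ker f := by
      rw [hker]; exact Ideal.mem_map_of_mem _ (Ideal.mem_map_of_mem _ hz)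
    exact this
  have htop : M ≠ ⊤ := by
    intro hM
    have h := dim_top hM hpp hp0 hqp L f hf (hkz p hpm) (hkz q (hpq ▸ Ideal.subset_span (by simp)))
    rw [hd, he] at h
    have : d + 1 + 1 ≤ d + 1 := by exact_mod_cast h
    omega
  obtain ⟨τ, hτ, hred, hz⟩ := exists_redn hΛ hinf L f hf hker hd hdr
  have hm : ∀ i, hdet τ i ∈ maximalIdeal A := by
    intro i
    rw [mem_maximalIdeal, mem_nonunits_iff]
    exact fun h => htop (top_of_unit hτ h)
  have hh : maximalIdeal A ≤ (Ideal.span (Set.range (hdet τ))).radical := by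
    rw [Ideal.radical_eq_sInf]
    refine le_sInf ?_
    rintro P ⟨hP1, hP2⟩
    exact (hdet_rad hc hred hP2 fun i => hP1 (Ideal.subset_span ⟨i, rfl⟩)).ge
  have hd1 : d = r + 1 := by
    by_contra hne
    have h0 : τ (Fin.last r) = 0 := hz _ (by simp; omega)
    have hlt : Ideal.span {hdet τ (Fin.last r)} ≠ ⊤ := by
      intro h
      exact (mem_maximalIdeal _).1 (hm (Fin.last r)) (Ideal.span_singleton_eq_top.1 h)
    obtain ⟨P, hP⟩ := Ideal.nonempty_minimalPrimes hlt
    refine dim2_minprime hdim hP (hdet_rad hc hred hP.1.1 fun i => ?_)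
    by_cases hi : i = Fin.last r
    · subst hi; exact hP.1.2 (Ideal.subset_span rfl)
    · rw [hdet_zero_row h0 hi]; exact zero_mem _
  refine ⟨hd1, ?_⟩
  obtain ⟨P, Q, hPQ, hQP, hne, hrad, hu⟩ := exists_chg hdim hΛ hinf τ hh ∅ (by simp)
  refine ⟨chg τ P, chg_mem hτ P, Redn_chg P Q hQP hred, ?_, hne, hrad, ?_⟩
  · intro i
    obtain ⟨l, -, -, u, -, e⟩ := hu i
    rw [e]
    exact Ideal.mul_mem_left _ _ (sum_mem fun k _ => Ideal.mul_mem_left _ _ (hm k))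
  · have h01 : (0 : Fin (r + 1)) ≠ Fin.last r := by
      intro h
      have := congrArg Fin.val h
      simp at this
      omega
    refine (hrad _ _ h01).trans (Ideal.radical_mono (Ideal.span_mono ?_))
    rintro _ (rfl | rfl) <;> exact ⟨_, rfl⟩

end assembly

/-- Theorem at the end of Section 5. Let `(A, 𝔪)` be a two-dimensional
regular local ring with infinite residue field and `M ≠ (0)` a finitely generated
torsion-free `A`-module with `F = M** = A^r` (`r > 0`). Suppose `R(M)` is a Buchsbaum
ring and `widetilde{M} = overline{M}`. Then the fiber cone
`F(M) = A/𝔪 ⊗_A R(M) ≅ R(M)/𝔪R(M)` is a Buchsbaum ring (i.e. its localization at its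
graded maximal ideal `𝔐/𝔪R(M)` — a prime ideal — is a Buchsbaum local ring). -/
theorem ratliffRush_statement_19 (A : Type) [CommRing A] [IsLocalRing A]
    [IsNoetherianRing A]
    (hdim : ringKrullDim A = 2)
    (hreg : ∃ x y : A, Ideal.span {x, y} = maximalIdeal A)
    (hres : Infinite (ResidueField A))
    (r : ℕ) (hr : 0 < r) (M : Submodule A (Fin r → A)) (hM0 : M ≠ ⊥)
    (hlen : ∃ n : ℕ, modLength A ((Fin r → A) ⧸ M) = (n : WithBot ℕ∞))
    (hB : IsBuchsbaumLocalRing (Localization.AtPrime (gradedMax A r M)))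
    (h1 : ratliffRush A r (freeSub A r) (sub1 A r M) = barPow A r M 1) :
    ∀ [_hp : (fiberConeMax A r M).IsPrime],
      IsBuchsbaumLocalRing (Localization.AtPrime (fiberConeMax A r M)) := by
  intro _hp
  obtain ⟨hDom, p, q, hpq, hpp, hp0, hqp⟩ := exists_prime_param A hdim hreg hres
  obtain ⟨Λ, hΛ, hinf⟩ := exists_unitDiff A hres
  have dep := depthTwo A p q hpq hpp hp0 hqp
  obtain ⟨c, hc0⟩ := fin_colength hlen
  have hc : ∀ t ∈ maximalIdeal A ^ c, ∀ w : Fin r → A, t • w ∈ M := by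
    intro t ht w
    have h := hc0 t ht (Submodule.Quotient.mk w)
    rwa [← Submodule.Quotient.mk_smul, Submodule.Quotient.mk_eq_zero] at h
  have hJQ : Fib.JJ A r M ≤ gradedMax A r M := by
    rw [Ideal.map_le_iff_le_comap]
    intro t ht
    rw [Ideal.mem_comap, mem_gradedMax]
    simpa [MvPolynomial.algebraMap_eq] using ht
  have hcm : Ideal.comap (Ideal.Quotient.mk (Fib.JJ A r M)) (fiberConeMax A r M) = gradedMax A r M := by
    change Ideal.comap (Ideal.Quotient.mk (Fib.JJ A r M)) (Ideal.map (Ideal.Quotient.mk (Fib.JJ A r M)) (gradedMax A r M)) = _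
    rw [Ideal.comap_map_of_surjective' _ Ideal.Quotient.mk_surjective, Ideal.mk_ker]
    exact sup_eq_left.2 hJQ
  obtain ⟨f, hf, hker, -⟩ := loc_quot (Fib.JJ A r M) (gradedMax A r M) (fiberConeMax A r M) hcm
  haveI : IsNoetherianRing ↥(reesAlg A r M) := rees_noeth
  haveI hLN : IsNoetherianRing (Localization.AtPrime (gradedMax A r M)) := IsLocalization.isNoetherianRing (gradedMax A r M).primeCompl _ inferInstance
  haveI hGN : IsNoetherianRing (Localization.AtPrime (fiberConeMax A r M)) := isNoetherianRing_of_surjective _ _ f hf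
  intro d hd x hx hrad i a ha
  have ha' := Ideal.mem_colon_span_singleton.1 ha
  suffices hgoal : ∀ y ∈ maximalIdeal (Localization.AtPrime (fiberConeMax A r M)), y * a ∈ Ideal.span (x '' {j | j < i}) by
    refine Submodule.mem_colon.2 fun y hy => ?_
    rw [smul_eq_mul, mul_comm]
    exact hgoal y hy
  clear ha
  have hpm : p ∈ maximalIdeal A := hpq ▸ Ideal.subset_span (by simp)
  have hqm : q ∈ maximalIdeal A := hpq ▸ Ideal.subset_span (by simp)
  have hmL : ∀ t ∈ maximalIdeal A, algebraMap ↥(reesAlg A r M) (Localization.AtPrime (gradedMax A r M)) (algebraMap A _ t) ∈ maximalIdeal (Localization.AtPrime (gradedMax A r M)) := by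
    intro t ht
    rw [← Localization.AtPrime.map_eq_maximalIdeal]
    exact Ideal.mem_map_of_mem _ (hJQ (Ideal.mem_map_of_mem _ ht))
  have hker2 := hker.trans (JJ_eq hpq (Localization.AtPrime (gradedMax A r M)))
  have hlow : ringKrullDim (Localization.AtPrime (fiberConeMax A r M)) + 1 ≤ ringKrullDim (Localization.AtPrime (gradedMax A r M)) := by
    refine ringKrullDim_succ_le_of_surjective f hf (p_nzd (r := r) (M := M) hp0 (Localization.AtPrime (gradedMax A r M))) ?_
    rw [← RingHom.mem_ker, hker2]
    exact Ideal.subset_span (by simp)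
  have hup : ringKrullDim (Localization.AtPrime (gradedMax A r M)) ≤ ringKrullDim (Localization.AtPrime (fiberConeMax A r M)) + (2 : ℕ) := by
    classical
    have hs := dim_le_add (L := Localization.AtPrime (gradedMax A r M)) (G := Localization.AtPrime (fiberConeMax A r M)) f hf ({algebraMap ↥(reesAlg A r M) (Localization.AtPrime (gradedMax A r M)) (algebraMap A _ p), algebraMap ↥(reesAlg A r M) (Localization.AtPrime (gradedMax A r M)) (algebraMap A _ q)} : Finset (Localization.AtPrime (gradedMax A r M)))
    refine (hs ?_ ?_).trans ?_
    · intro z hz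
      simp only [Finset.coe_insert, Finset.coe_singleton] at hz
      rcases hz with rfl | rfl
      · exact hmL p hpm
      · exact hmL q hqm
    · rw [hker2]; simp
    · refine add_le_add le_rfl ?_
      exact_mod_cast Finset.card_le_two
  rw [hd] at hlow hup
  obtain ⟨e, he⟩ : ∃ e : ℕ, ringKrullDim (Localization.AtPrime (gradedMax A r M)) = (e : ℕ) := by
    generalize ringKrullDim (Localization.AtPrime (gradedMax A r M)) = z at hlow hup
    induction z using WithBot.recBotCoe with
    | bot => exact absurd hlow (by simp)
    | coe z =>
      induction z using ENat.recTopCoe with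
      | top => exact absurd hup (by
          rw [not_le]
          exact WithBot.coe_lt_coe.2 (ENat.coe_lt_top (d + 2)))
      | coe z => exact ⟨z, rfl⟩
  have h1e : d + 1 ≤ e := by rw [he] at hlow; exact_mod_cast hlow
  have h2e : e ≤ d + 2 := by rw [he] at hup; exact_mod_cast hup
  by_cases hcase : e = d + 2
  · rw [hcase] at he
    exact big_case f hf _ _ (hmL p hpm) (hmL q hqm) hker2 he hB x hx hrad i a ha'
  · have he' : e = d + 1 := by omega
    rw [he'] at he
    obtain ⟨hdr, τ, hτ, hred, hhm, hne, hrad2, hh⟩ := exists_good hdim hr hpq hpp hp0 hqp hΛ hinf hc f hf hker hd he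
    subst hdr
    have H := build_nsys hdim hr dep hΛ hinf hpq hpp hp0 hqp hB he h1 (hG_of_dim f hf hker hd) hred hhm hne hrad2 hh
    haveI : Nontrivial (Fin (r + 1)) := Fin.nontrivial_iff_two_le.2 (by omega)
    have hFfg : (freeSub A r).FG := Submodule.FG.map _ Module.Finite.fg_top
    have hNfg : (barPow A r M 1).FG := by
      haveI : Module.Finite A ↥(freeSub A r) := Module.Finite.iff_fg.2 hFfg
      exact Submodule.FG.of_le hFfg (fun z hz => (mem_barPow.1 hz).1)
    refine Fib.fib_main H hΛ hinf hNfg ?_ (TT_mem τ hτ) f hf hker x hx hrad i a ha'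
    intro z hz
    obtain ⟨w, rfl⟩ := mem_freeSub.1 (mem_barPow.1 hz).1
    exact emb_hom A r w
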